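/- arXiv:1411.3695 — 2 statements merged into one kernel-verified Lean document; each statement's English description precedes it below -/
import Mathlib

section
/- Let d ≥ 1 and let j be an integer with 1 ≤ j ≤ d/2. Then the graded Betti numbers of the Stanley-Reisner ring of the barycentric subdivision of the (d-1)-simplex satisfy: β_{i,i+j}(K[sd(Δ_{d-1})]) = 0 for 0 ≤ i ≤ j-1; β_{i,i+j}(K[sd(Δ_{d-1})]) ≠ 0 for every integer i with j ≤ i ≤ 2^d - d - 1 - m_{d-j-1}(d); and β_{i,i+j}(K[sd(Δ_{d-1})]) = 0 for 2^d - 2d + j < i ≤ 2^d - d - 1. -/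
open Finset BigOperators

noncomputable section
open scoped Classical

/-- A finite abstract simplicial complex on (a finite subset of) `ℕ`,
given as its finite set of faces. -/
abbrev SC := Finset (Finset ℕ)

/-- `Δ` is a simplicial complex: it is closed under taking subsets of faces. -/
def IsComplex {α : Type*} [DecidableEq α] (Δ : Finset (Finset α)) : Prop :=
  ∀ s ∈ Δ, ∀ t ⊆ s, t ∈ Δ

/-- The vertex set (ground set) of a complex: the union of all of its faces. -/
def vertexSet {α : Type*} [DecidableEq α] (Δ : Finset (Finset α)) : Finset α :=
  Δ.sup id

/-- The number of vertices of a complex. -/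
def nverts {α : Type*} [DecidableEq α] (Δ : Finset (Finset α)) : ℕ :=
  (vertexSet Δ).card

/-- The full `(d-1)`-simplex `Δ_{d-1}`: all subsets of a `d`-element vertex set. -/
def simplexC (d : ℕ) : SC := (Finset.range d).powerset

/-- The boundary complex of the simplex on `k` vertices (a `(k-2)`-sphere):
all proper subsets of a `k`-element vertex set. -/
def boundaryC (k : ℕ) : SC := ((Finset.range k).powerset).erase (Finset.range k)

/-- Encoding of finite subsets of `ℕ` as natural numbers (injective). -/
def enc : Finset ℕ → ℕ := Encodable.encode

/-- `C` is a chain of sets under inclusion. -/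
def IsChainF (C : Finset (Finset ℕ)) : Prop := ∀ s ∈ C, ∀ t ∈ C, s ⊆ t ∨ t ⊆ s

/-- The barycentric subdivision `sd(Δ)`: its vertices are (encodings of) the
nonempty faces of `Δ`, and its faces are the chains of nonempty faces of `Δ`. -/
def sd (Δ : SC) : SC :=
  ((Δ.erase ∅).powerset.filter IsChainF).image (fun C => C.image enc)

/-- The induced subcomplex `Δ_W` on a vertex subset `W`. -/
def inducedSC {α : Type*} [DecidableEq α] (Δ : Finset (Finset α)) (W : Finset α) :
    Finset (Finset α) := Δ.filter (fun s => s ⊆ W)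

/-- `fvec Δ k` is the number of faces of `Δ` of cardinality `k`
(i.e. of dimension `k-1`); so `f_{i}^Δ = fvec Δ (i+1)`. -/
def fvec (Δ : SC) (k : ℕ) : ℕ := (Δ.filter (fun s => s.card = k)).card

/-- A minimal non-face of a complex. -/
def IsMinNonFace {α : Type*} [DecidableEq α] (Δ : Finset (Finset α)) (N : Finset α) : Prop :=
  N ⊆ vertexSet Δ ∧ N ∉ Δ ∧ ∀ M ⊂ N, M ∈ Δ

/-- `t_1(K[Δ])`: the largest cardinality of a minimal non-face of `Δ`, equivalently the
largest degree of a minimal generator of the Stanley-Reisner ideal `I_Δ`. -/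
def t1 {α : Type*} [DecidableEq α] (Δ : Finset (Finset α)) : ℕ :=
  ((vertexSet Δ).powerset.filter (fun N => IsMinNonFace Δ N)).sup Finset.card

/-- A complex is flag if all its minimal non-faces have cardinality `2`. -/
def IsFlag {α : Type*} [DecidableEq α] (Δ : Finset (Finset α)) : Prop :=
  ∀ N : Finset α, IsMinNonFace Δ N → N.card = 2

/-- A complex is a full simplex if it consists of all subsets of its vertex set. -/
def IsFullSimplex {α : Type*} [DecidableEq α] (Δ : Finset (Finset α)) : Prop :=
  Δ = (vertexSet Δ).powerset

/-- Abstract isomorphism of simplicial complexes (possibly on different ground sets):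
there is a map of vertices, injective on the vertex set, carrying the faces of the first
complex exactly onto the faces of the second. -/
def ComplexIso {α β : Type*} [DecidableEq α] [DecidableEq β]
    (Δ : Finset (Finset α)) (Γ : Finset (Finset β)) : Prop :=
  ∃ φ : α → β, Set.InjOn φ ↑(vertexSet Δ) ∧ Γ = Δ.image (fun s => s.image φ)

variable (K : Type*) [Field K]

/-- The boundary of (the indicator chain of) a single face, with the usual signs coming
from the ordering of the vertices. -/
def bdryFace (s : Finset ℕ) : Finset ℕ →₀ K :=
  ∑ v ∈ s, ((-1 : K) ^ ((s.filter (fun w => w < v)).card)) • Finsupp.single (s.erase v) (1 : K)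

/-- The simplicial boundary operator on the (augmented/reduced) chain space. -/
def bdry : (Finset ℕ →₀ K) →ₗ[K] (Finset ℕ →₀ K) :=
  Finsupp.lsum K fun s => LinearMap.toSpanSingleton K (Finset ℕ →₀ K) (bdryFace K s)

/-- The span of the faces of `Δ` of cardinality `n` (empty for `n < 0`):
the space of `(n-1)`-dimensional reduced chains of `Δ`. -/
def facesSpan (Δ : SC) (n : ℤ) : Submodule K (Finset ℕ →₀ K) :=
  Submodule.span K ((fun s => Finsupp.single s (1 : K)) '' {s | s ∈ Δ ∧ (s.card : ℤ) = n})

/-- Reduced `(n-1)`-cycles of `Δ`. -/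
def cyclesOn (Δ : SC) (n : ℤ) : Submodule K (Finset ℕ →₀ K) :=
  facesSpan K Δ n ⊓ LinearMap.ker (bdry K)

/-- Reduced `(n-1)`-boundaries of `Δ`. -/
def boundariesOn (Δ : SC) (n : ℤ) : Submodule K (Finset ℕ →₀ K) :=
  Submodule.map (bdry K) (facesSpan K Δ (n + 1))

/-- `redHdim K Δ n = dim_K H̃_{n-1}(Δ; K)`, the dimension of reduced simplicial homology
of `Δ` in the degree whose chains are the faces of cardinality `n`. -/
def redHdim (Δ : SC) (n : ℤ) : ℕ :=
  Module.finrank K ↥(cyclesOn K Δ n) -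
    Module.finrank K ↥(boundariesOn K Δ n ⊓ cyclesOn K Δ n)

/-- The graded Betti number `β_{i,j}(K[Δ]) = dim_K Tor_i^S(K[Δ], K)_j` of the
Stanley-Reisner ring of `Δ`, expressed (via Hochster's formula) through reduced homology of
induced subcomplexes: `β_{i,j} = Σ_{W ⊆ Ω, #W = j} dim_K H̃_{j-i-1}(Δ_W; K)`. -/
def bettiSR (Δ : SC) (i j : ℕ) : ℕ :=
  ∑ W ∈ (vertexSet Δ).powerset.filter (fun W => W.card = j),
    redHdim K (inducedSC Δ W) ((j : ℤ) - i)

/-- The projective dimension of `K[Δ]` over the polynomial ring: the largest homological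
degree with a nonzero Betti number. -/
def pdimSR (Δ : SC) : ℕ :=
  ((Finset.range (nverts Δ + 1)).filter
    (fun i => ∃ j ∈ Finset.range (2 * nverts Δ + 1), bettiSR K Δ i j ≠ 0)).sup id

/-- The depth of `K[Δ]` (via the Auslander–Buchsbaum formula). -/
def depthSR (Δ : SC) : ℕ := nverts Δ - pdimSR K Δ

/-- The Castelnuovo–Mumford regularity of `K[Δ]`:
the largest `j - i` with `β_{i,j}(K[Δ]) ≠ 0`. -/
def regSR (Δ : SC) : ℕ :=
  ((Finset.range (nverts Δ + 1) ×ˢ Finset.range (2 * nverts Δ + 1))).sup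
    (fun p => if bettiSR K Δ p.1 p.2 ≠ 0 then p.2 - p.1 else 0)

/-- The number of homological degrees `i` with `β_{i,i+j}(K[Δ]) ≠ 0`. -/
def strandCount (Δ : SC) (j : ℕ) : ℕ :=
  ((Finset.range (nverts Δ + 1)).filter (fun i => bettiSR K Δ i (i + j) ≠ 0)).card

/-- The numbers `m_j(d)`: `m_j(d) = j` if `j ≤ d/2`, and
`m_j(d) = 2^{a+2}(c+d-j) - 2d + j` if `j ≥ d/2`, where `2j-d = a(d-j)+c`, `0 ≤ c < d-j`. -/
def mj (d j : ℕ) : ℕ :=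
  if 2 * j ≤ d then j
  else 2 ^ ((2 * j - d) / (d - j) + 2) * ((2 * j - d) % (d - j) + (d - j)) + j - 2 * d

/-- `N(d)`: the number of vertices of `sd^3(Δ_{d-1})` not lying on the boundary
of `sd^3(Δ_{d-1})`. -/
def Nd (d : ℕ) : ℕ :=
  ((vertexSet (sd^[3] (simplexC d))) \ (vertexSet (sd^[3] (boundaryC d)))).card

/-- The induced subcomplex `σ̃` of `Δ` spanned by the support of a chain `σ`:
all faces of `Δ` contained in some face of the support of `σ`. -/
def cycleCplx (Δ : SC) (σ : Finset ℕ →₀ K) : SC :=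
  Δ.filter (fun F => ∃ G ∈ σ.support, F ⊆ G)

/-- `σ` is a minimal homology `(d-1)`-cycle of the `(d-1)`-dimensional complex `Δ`:
a nonzero `(d-1)`-cycle such that no nonzero `(d-1)`-cycle `σ'` satisfies
`f_i^{σ̃} > f_i^{σ̃'}` and `f_j^{σ̃} = f_j^{σ̃'}` for all `i < j ≤ d-1`, for some `i`. -/
def IsMinimalCycle (Δ : SC) (d : ℕ) (σ : Finset ℕ →₀ K) : Prop :=
  σ ≠ 0 ∧ σ ∈ cyclesOn K Δ (d : ℤ) ∧
    ∀ σ' : Finset ℕ →₀ K, σ' ≠ 0 → σ' ∈ cyclesOn K Δ (d : ℤ) →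
      ¬ ∃ i ≤ d - 1, fvec (cycleCplx K Δ σ') (i + 1) < fvec (cycleCplx K Δ σ) (i + 1) ∧
          ∀ j, i < j → j ≤ d - 1 →
            fvec (cycleCplx K Δ σ) (j + 1) = fvec (cycleCplx K Δ σ') (j + 1)

/-- The support of a lattice point, as a set of natural numbers. -/
def tupSupp {n : ℕ} (a : Fin n → ℕ) : Finset ℕ :=
  (Finset.univ.filter (fun l : Fin n => a l ≠ 0)).image Fin.val

/-- The `k`-th component of `𝔦(a) = Σ_l a_l u_l`, where `u_l = e_l + ⋯ + e_n`;
so `𝔦(a)_k = Σ_{l ≤ k} a_l`. -/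
def iComp {n : ℕ} (a : Fin n → ℤ) (k : Fin n) : ℤ :=
  ∑ l ∈ Finset.univ.filter (fun l : Fin n => l ≤ k), a l

/-- The compatibility condition on pairs of vertices in the edgewise subdivision:
`𝔦(a-b) ∈ {0,1}^n` or `𝔦(b-a) ∈ {0,1}^n`. -/
def edgeOK {n : ℕ} (a b : Fin n → ℕ) : Prop :=
  (∀ k, iComp (fun l => (a l : ℤ) - (b l : ℤ)) k ∈ ({0, 1} : Set ℤ)) ∨
  (∀ k, iComp (fun l => (b l : ℤ) - (a l : ℤ)) k ∈ ({0, 1} : Set ℤ))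

/-- The `r`-th edgewise subdivision of a complex `Δ` on vertex set `[n]`, as a complex on
the ground set `Ω_{r,n}` of lattice points (tuples). -/
def edgewiseT (n r : ℕ) (Δ : SC) : Finset (Finset (Fin n → ℕ)) :=
  (Finset.Nat.antidiagonalTuple n r).powerset.filter
    (fun F => F.sup tupSupp ∈ Δ ∧ ∀ a ∈ F, ∀ b ∈ F, edgeOK a b)

/-- Encoding of lattice points as natural numbers (injective). -/
def encTup {n : ℕ} (a : Fin n → ℕ) : ℕ := Encodable.encode (List.ofFn a)

/-- The `r`-th edgewise subdivision `Δ^{⟨r⟩}`, re-encoded as a complex on `ℕ`. -/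
def edgewise (n r : ℕ) (Δ : SC) : SC :=
  (edgewiseT n r Δ).image (fun F => F.image encTup)

end


namespace SdProof
section
open scoped Classical
variable (K : Type*) [Field K]

noncomputable def epsF (v : ℕ) (s : Finset ℕ) : Finset ℕ →₀ K :=
  if v ∈ s then 0 else ((-1 : K) ^ ((s.filter (fun w => w < v)).card)) • Finsupp.single (insert v s) (1 : K)

noncomputable def iotF (v : ℕ) (s : Finset ℕ) : Finset ℕ →₀ K :=
  if v ∈ s then ((-1 : K) ^ ((s.filter (fun w => w < v)).card)) • Finsupp.single (s.erase v) (1 : K) else 0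

noncomputable def eps (v : ℕ) : (Finset ℕ →₀ K) →ₗ[K] (Finset ℕ →₀ K) :=
  Finsupp.lsum K fun s => LinearMap.toSpanSingleton K (Finset ℕ →₀ K) (epsF K v s)

noncomputable def iot (v : ℕ) : (Finset ℕ →₀ K) →ₗ[K] (Finset ℕ →₀ K) :=
  Finsupp.lsum K fun s => LinearMap.toSpanSingleton K (Finset ℕ →₀ K) (iotF K v s)

lemma eps_single (v : ℕ) (s : Finset ℕ) : eps K v (Finsupp.single s 1) = epsF K v s := by
  simp [eps]
lemma iot_single (v : ℕ) (s : Finset ℕ) : iot K v (Finsupp.single s 1) = iotF K v s := by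
  simp [iot]
lemma bdry_single (s : Finset ℕ) : bdry K (Finsupp.single s 1) = bdryFace K s := by
  simp [bdry]

lemma hom_ext {M : Type*} [AddCommMonoid M] [Module K M] (f g : (Finset ℕ →₀ K) →ₗ[K] M)
    (h : ∀ s, f (Finsupp.single s 1) = g (Finsupp.single s 1)) : f = g := by
  apply Finsupp.lhom_ext'
  intro s
  apply LinearMap.ext_ring
  simpa using h s

lemma sgn_sq (n : ℕ) : ((-1 : K) ^ n) * ((-1 : K) ^ n) = 1 := by
  rw [← mul_pow]; simp

/-- sign identity -/
lemma sgn_insert (v u : ℕ) (s : Finset ℕ) (hv : v ∉ s) (hu : u ∈ s) :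
    ((-1 : K) ^ ((s.filter (fun w => w < v)).card)) *
      ((-1 : K) ^ (((insert v s).filter (fun w => w < u)).card))
    = - (((-1 : K) ^ ((s.filter (fun w => w < u)).card)) *
      ((-1 : K) ^ (((s.erase u).filter (fun w => w < v)).card))) := by
  have huv : u ≠ v := fun h => hv (h ▸ hu)
  rw [Finset.filter_insert, Finset.filter_erase]
  rcases lt_or_gt_of_ne huv with h | h
  · rw [if_neg (by omega)]
    have hm : u ∈ s.filter (fun w => w < v) := by simp [hu, h]
    rw [← Finset.card_erase_add_one hm]
    ring
  · rw [if_pos h, Finset.card_insert_of_notMem (by simp [hv]), Finset.erase_eq_of_notMem (by simp; omega)]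
    ring

lemma bdry_eps (v : ℕ) (x : Finset ℕ →₀ K) : bdry K (eps K v x) + eps K v (bdry K x) = x := by
  have : (bdry K) ∘ₗ (eps K v) + (eps K v) ∘ₗ (bdry K) = LinearMap.id := by
    apply hom_ext
    intro s
    simp only [LinearMap.add_apply, LinearMap.comp_apply, LinearMap.id_apply, eps_single, bdry_single]
    by_cases hv : v ∈ s
    · simp only [epsF, hv, if_true, map_zero, zero_add, bdryFace, map_sum, map_smul, eps_single]
      rw [Finset.sum_eq_single v]
      · rw [if_neg (by simp), Finset.insert_erase hv, smul_smul]
        have : (s.erase v).filter (fun w => w < v) = s.filter (fun w => w < v) := by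
          ext w; simp; intro h _; omega
        rw [this, sgn_sq, one_smul]
      · intro u hu huv
        rw [if_pos (by simp [hv]; exact fun h => huv h.symm), smul_zero]
      · exact fun h => absurd hv h
    · rw [epsF, if_neg hv, map_smul, bdry_single, bdryFace, bdryFace, Finset.sum_insert hv, smul_add,
        Finset.erase_insert hv]
      have : (insert v s).filter (fun w => w < v) = s.filter (fun w => w < v) := by
        ext w
        simp only [Finset.mem_filter, Finset.mem_insert]
        constructor
        · rintro ⟨h1 | h1, h2⟩
          · omega
          · exact ⟨h1, h2⟩
        · rintro ⟨h1, h2⟩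
          exact ⟨Or.inr h1, h2⟩
      rw [this, smul_smul, sgn_sq, one_smul, map_sum, add_assoc, Finset.smul_sum, ← Finset.sum_add_distrib]
      rw [Finset.sum_eq_zero, add_zero]
      intro u hu
      have huv : v ≠ u := fun h => hv (h ▸ hu)
      rw [map_smul, eps_single, epsF, if_neg (by simp [hv]), smul_smul, smul_smul,
        sgn_insert K v u s hv hu, Finset.erase_insert_of_ne huv, neg_smul, neg_add_cancel]
  exact LinearMap.congr_fun this x

lemma iot_eps (v : ℕ) (x : Finset ℕ →₀ K) : iot K v (eps K v x) + eps K v (iot K v x) = x := by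
  have : (iot K v) ∘ₗ (eps K v) + (eps K v) ∘ₗ (iot K v) = LinearMap.id := by
    apply hom_ext
    intro s
    simp only [LinearMap.add_apply, LinearMap.comp_apply, LinearMap.id_apply, eps_single, iot_single]
    by_cases hv : v ∈ s
    · have : (s.erase v).filter (fun w => w < v) = s.filter (fun w => w < v) := by
        ext w; simp; intro h _; omega
      simp [epsF, iotF, hv, eps_single, Finset.insert_erase hv, smul_smul, this, sgn_sq, -Finsupp.smul_single]
    · have : (insert v s).filter (fun w => w < v) = s.filter (fun w => w < v) := by
        ext w
        simp only [Finset.mem_filter, Finset.mem_insert]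
        constructor
        · rintro ⟨h1 | h1, h2⟩
          · omega
          · exact ⟨h1, h2⟩
        · rintro ⟨h1, h2⟩
          exact ⟨Or.inr h1, h2⟩
      simp only [epsF, iotF, hv, if_false, map_zero, add_zero, map_smul, iot_single,
        Finset.mem_insert_self, if_true, Finset.erase_insert hv, smul_smul, this, sgn_sq, one_smul]
  exact LinearMap.congr_fun this x

lemma eps_eps (v : ℕ) (x : Finset ℕ →₀ K) : eps K v (eps K v x) = 0 := by
  have : (eps K v) ∘ₗ (eps K v) = 0 := by
    apply hom_ext
    intro s
    by_cases hv : v ∈ s <;> simp [epsF, eps_single, hv, -Finsupp.smul_single]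
  exact LinearMap.congr_fun this x

lemma iot_iot (v : ℕ) (x : Finset ℕ →₀ K) : iot K v (iot K v x) = 0 := by
  have : (iot K v) ∘ₗ (iot K v) = 0 := by
    apply hom_ext
    intro s
    by_cases hv : v ∈ s <;> simp [iotF, iot_single, hv, -Finsupp.smul_single]
  exact LinearMap.congr_fun this x

lemma iot_bdry_iot (v : ℕ) (x : Finset ℕ →₀ K) : iot K v (bdry K (iot K v x)) = 0 := by
  have : (iot K v) ∘ₗ (bdry K) ∘ₗ (iot K v) = 0 := by
    apply hom_ext
    intro s
    by_cases hv : v ∈ s <;> simp [iotF, iot_single, hv, bdry_single, bdryFace, -Finsupp.smul_single]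
  exact LinearMap.congr_fun this x

lemma iot_bdry_ie (v : ℕ) (x : Finset ℕ →₀ K) : iot K v (bdry K (iot K v (eps K v x))) = 0 :=
  iot_bdry_iot K v _

/-- anticommutation -/
lemma bdry_iot (v : ℕ) (x : Finset ℕ →₀ K) : bdry K (iot K v x) + iot K v (bdry K x) = 0 := by
  -- x = ιεx + ειx
  set b := iot K v x with hb
  have h1 : x = iot K v (eps K v x) + eps K v b := (iot_eps K v x).symm
  have h2 : bdry K x = bdry K (iot K v (eps K v x)) + bdry K (eps K v b) := by
    conv_lhs => rw [h1]
    rw [map_add]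
  have h3 : bdry K (eps K v b) = b - eps K v (bdry K b) := by
    rw [eq_sub_iff_add_eq]; exact bdry_eps K v b
  have h4 : iot K v (eps K v (bdry K b)) = bdry K b := by
    have := iot_eps K v (bdry K b)
    rw [hb, iot_bdry_iot, map_zero, add_zero] at this
    exact this
  rw [h2, map_add, iot_bdry_iot, h3, map_sub, h4, hb, iot_iot]
  simp

lemma span_map {M : Type*} [AddCommMonoid M] [Module K M] (Δ : SC) (n : ℤ)
    (f : (Finset ℕ →₀ K) →ₗ[K] M) (N : Submodule K M)
    (h : ∀ s ∈ Δ, (s.card : ℤ) = n → f (Finsupp.single s 1) ∈ N) :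
    ∀ x ∈ facesSpan K Δ n, f x ∈ N := by
  have : facesSpan K Δ n ≤ N.comap f := by
    rw [facesSpan, Submodule.span_le]
    rintro _ ⟨s, ⟨hs, hc⟩, rfl⟩
    exact h s hs hc
  exact this

lemma single_mem (Δ : SC) (n : ℤ) (s : Finset ℕ) (hs : s ∈ Δ) (hc : (s.card : ℤ) = n) :
    Finsupp.single s (1 : K) ∈ facesSpan K Δ n :=
  Submodule.subset_span ⟨s, ⟨hs, hc⟩, rfl⟩

lemma facesSpan_mono {Δ Γ : SC} (h : Δ ⊆ Γ) (n : ℤ) : facesSpan K Δ n ≤ facesSpan K Γ n := by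
  intro x hx
  exact span_map K Δ n LinearMap.id _ (fun s hs hc => single_mem K Γ n s (h hs) hc) x hx

def Ac (Δ : SC) (n : ℤ) : Prop := ∀ z ∈ facesSpan K Δ n, bdry K z = 0 →
  ∃ c ∈ facesSpan K Δ (n + 1), bdry K c = z

structure Split (Δ D L : SC) (v : ℕ) : Prop where
  del : ∀ s, s ∈ D ↔ s ∈ Δ ∧ v ∉ s
  lnk : ∀ s, s ∈ L ↔ v ∉ s ∧ insert v s ∈ Δ
  LD : L ⊆ D

variable {K}

lemma Split.iot_mem {Δ D L : SC} {v : ℕ} (h : Split Δ D L v) {n : ℤ} {z : Finset ℕ →₀ K}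
    (hz : z ∈ facesSpan K Δ n) : iot K v z ∈ facesSpan K L (n - 1) := by
  refine span_map K Δ n (iot K v) _ ?_ z hz
  intro s hs hc
  rw [iot_single, iotF]
  split_ifs with hv
  · apply Submodule.smul_mem
    apply single_mem
    · rw [h.lnk]; simp [Finset.insert_erase hv, hs]
    · rw [← hc, ← Finset.card_erase_add_one hv]; push_cast; ring
  · exact zero_mem _

lemma Split.eps_mem {Δ D L : SC} {v : ℕ} (h : Split Δ D L v) {n : ℤ} {z : Finset ℕ →₀ K}
    (hz : z ∈ facesSpan K L n) : eps K v z ∈ facesSpan K Δ (n + 1) := by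
  refine span_map K L n (eps K v) _ ?_ z hz
  intro s hs hc
  rw [eps_single, epsF]
  split_ifs with hv
  · exact zero_mem _
  · apply Submodule.smul_mem
    apply single_mem
    · exact ((h.lnk s).1 hs).2
    · rw [Finset.card_insert_of_notMem hv, ← hc]; push_cast; ring

lemma Split.ie_mem {Δ D L : SC} {v : ℕ} (h : Split Δ D L v) {n : ℤ} {z : Finset ℕ →₀ K}
    (hz : z ∈ facesSpan K Δ n) : iot K v (eps K v z) ∈ facesSpan K D n := by
  refine span_map K Δ n ((iot K v) ∘ₗ (eps K v)) _ ?_ z hz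
  intro s hs hc
  rw [LinearMap.comp_apply, eps_single, epsF]
  split_ifs with hv
  · rw [map_zero]; exact zero_mem _
  · rw [map_smul]
    apply Submodule.smul_mem
    rw [iot_single, iotF, if_pos (by simp), Finset.erase_insert hv]
    apply Submodule.smul_mem
    exact single_mem _ _ _ _ ((h.del s).2 ⟨hs, hv⟩) hc

lemma Split.sub {Δ D L : SC} {v : ℕ} (h : Split Δ D L v) : D ⊆ Δ := fun s hs => ((h.del s).1 hs).1

lemma Split.L1 {Δ D L : SC} {v : ℕ} (h : Split Δ D L v) {n : ℤ} (hD : Ac K D n)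
    (hL : Ac K L (n - 1)) : Ac K Δ n := by
  intro z hz hz0
  have hb := h.iot_mem hz
  have hb0 : bdry K (iot K v z) = 0 := by
    have := bdry_iot K v z
    rwa [hz0, map_zero, add_zero] at this
  obtain ⟨c, hc, hcb⟩ := hL _ hb hb0
  rw [sub_add_cancel] at hc
  have he := bdry_eps K v c
  rw [hcb] at he
  have hie := iot_eps K v z
  have hbe := bdry_eps K v (iot K v z)
  rw [hb0, map_zero, add_zero] at hbe
  have hz' : iot K v (eps K v z) + c ∈ facesSpan K D n :=
    add_mem (h.ie_mem hz) (facesSpan_mono K h.LD n hc)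
  have hzb : bdry K (iot K v (eps K v z) + c) = 0 := by
    have : iot K v (eps K v z) = z - eps K v (iot K v z) := by rw [eq_sub_iff_add_eq, hie]
    rw [this, map_add, map_sub, hz0, hbe, hcb]; simp
  obtain ⟨e, he1, he2⟩ := hD _ hz' hzb
  refine ⟨e - eps K v c, sub_mem (facesSpan_mono K h.sub _ he1) (h.eps_mem hc), ?_⟩
  rw [map_sub, he2]
  have : bdry K (eps K v c) = c - eps K v (iot K v z) := by rw [eq_sub_iff_add_eq, he]
  rw [this]
  nth_rewrite 3 [← hie]
  abel

lemma Split.L2 {Δ D L : SC} {v : ℕ} (h : Split Δ D L v) {n : ℤ} (hΔ : Ac K Δ n)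
    (hL : Ac K L n) : Ac K D n := by
  intro z hz hz0
  obtain ⟨w, hw, hwz⟩ := hΔ z (facesSpan_mono K h.sub _ hz) hz0
  have hb := h.iot_mem hw
  rw [add_sub_cancel_right] at hb
  have hiz : iot K v z = 0 := by
    have := span_map K D n (iot K v) ⊥ (fun s hs _ => by
      rw [iot_single, iotF, if_neg ((h.del s).1 hs).2]; exact zero_mem _) z hz
    simpa using this
  have hb0 : bdry K (iot K v w) = 0 := by
    have := bdry_iot K v w
    rwa [hwz, hiz, add_zero] at this
  obtain ⟨c, hc, hcb⟩ := hL _ hb hb0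
  refine ⟨iot K v (eps K v w) + c, add_mem (h.ie_mem hw) (facesSpan_mono K h.LD _ hc), ?_⟩
  have hie := iot_eps K v w
  have : iot K v (eps K v w) = w - eps K v (iot K v w) := by rw [eq_sub_iff_add_eq, hie]
  have hbe := bdry_eps K v (iot K v w)
  rw [hb0, map_zero, add_zero] at hbe
  rw [map_add, this, map_sub, hwz, hbe, hcb]; simp

lemma Split.L3 {Δ D L : SC} {v : ℕ} (h : Split Δ D L v) (hDL : D ⊆ L) (n : ℤ) : Ac K Δ n := by
  intro z hz hz0
  refine ⟨eps K v (iot K v (eps K v z)), h.eps_mem (facesSpan_mono K hDL _ (h.ie_mem hz)), ?_⟩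
  have hie := iot_eps K v z
  have h1 : iot K v (eps K v z) = z - eps K v (iot K v z) := by rw [eq_sub_iff_add_eq, hie]
  rw [h1, map_sub, eps_eps, sub_zero]
  have := bdry_eps K v z
  rwa [hz0, map_zero, add_zero] at this

lemma Ac_neg (Δ : SC) (n : ℤ) (hn : n < 0) : Ac K Δ n := by
  intro z hz _
  have := span_map K Δ n LinearMap.id ⊥ (fun s _ hc => by omega) z hz
  refine ⟨0, zero_mem _, ?_⟩
  simpa using this.symm

lemma fd_facesSpan (Δ : SC) (n : ℤ) : FiniteDimensional K (facesSpan K Δ n) := by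
  apply FiniteDimensional.span_of_finite
  apply Set.Finite.image
  exact Δ.finite_toSet.subset (fun s hs => hs.1)

lemma redH_zero {Δ : SC} {n : ℤ} (h : Ac K Δ n) : redHdim K Δ n = 0 := by
  have : boundariesOn K Δ n ⊓ cyclesOn K Δ n = cyclesOn K Δ n := by
    apply inf_eq_right.2
    rintro z ⟨hz, hz0⟩
    obtain ⟨c, hc, hcz⟩ := h z hz hz0
    exact ⟨c, hc, hcz⟩
  rw [redHdim, this, Nat.sub_self]

lemma redH_ne {Δ : SC} {n : ℤ} (h : ¬ Ac K Δ n) : redHdim K Δ n ≠ 0 := by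
  intro h0
  apply h
  have := fd_facesSpan (K := K) Δ n
  have : FiniteDimensional K (cyclesOn K Δ n) := 
    Submodule.finiteDimensional_of_le (inf_le_left : cyclesOn K Δ n ≤ facesSpan K Δ n)
  have hle : Module.finrank K (cyclesOn K Δ n) ≤
      Module.finrank K ↥(boundariesOn K Δ n ⊓ cyclesOn K Δ n) := by
    rw [redHdim] at h0; omega
  have := Submodule.eq_of_le_of_finrank_le (inf_le_right : boundariesOn K Δ n ⊓ cyclesOn K Δ n ≤ _) hle
  intro z hz hz0
  have hz' : z ∈ cyclesOn K Δ n := ⟨hz, hz0⟩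
  rw [← this] at hz'
  obtain ⟨c, hc, hcz⟩ := hz'.1
  exact ⟨c, hc, hcz⟩


noncomputable def FC (V : Finset (Finset ℕ)) : SC :=
  (V.powerset.filter IsChainF).image (fun C => C.image enc)

lemma enc_inj : Function.Injective enc := Encodable.encode_injective

lemma mem_FC {V : Finset (Finset ℕ)} {s : Finset ℕ} :
    s ∈ FC V ↔ ∃ C, C ⊆ V ∧ IsChainF C ∧ C.image enc = s := by
  simp [FC, and_assoc]

lemma mem_FC' {V C : Finset (Finset ℕ)} :
    C.image enc ∈ FC V ↔ C ⊆ V ∧ IsChainF C := by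
  rw [mem_FC]
  constructor
  · rintro ⟨D, h1, h2, h3⟩
    have := Finset.image_injective enc_inj h3
    subst this; exact ⟨h1, h2⟩
  · rintro ⟨h1, h2⟩; exact ⟨C, h1, h2, rfl⟩

lemma FC_mono {V W : Finset (Finset ℕ)} (h : V ⊆ W) : FC V ⊆ FC W := by
  intro s hs
  obtain ⟨C, h1, h2, h3⟩ := mem_FC.1 hs
  exact mem_FC.2 ⟨C, h1.trans h, h2, h3⟩

noncomputable def lkV (V : Finset (Finset ℕ)) (v : Finset ℕ) : Finset (Finset ℕ) :=
  V.filter (fun x => x ≠ v ∧ (x ⊆ v ∨ v ⊆ x))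

lemma mem_lkV {V : Finset (Finset ℕ)} {v x : Finset ℕ} :
    x ∈ lkV V v ↔ x ∈ V ∧ x ≠ v ∧ (x ⊆ v ∨ v ⊆ x) := by simp [lkV]

lemma chain_mono {C D : Finset (Finset ℕ)} (h : IsChainF D) (hC : C ⊆ D) : IsChainF C :=
  fun s hs t ht => h s (hC hs) t (hC ht)

lemma chain_ins {C : Finset (Finset ℕ)} (h : IsChainF C) {v : Finset ℕ}
    (hv : ∀ x ∈ C, x ⊆ v ∨ v ⊆ x) : IsChainF (insert v C) := by
  intro s hs t ht
  rw [Finset.mem_insert] at hs ht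
  rcases hs with rfl | hs <;> rcases ht with rfl | ht
  · exact Or.inl subset_rfl
  · exact (hv t ht).symm
  · exact hv s hs
  · exact h s hs t ht

lemma split_FC {V : Finset (Finset ℕ)} {v : Finset ℕ} (hv : v ∈ V) :
    Split (FC V) (FC (V.erase v)) (FC (lkV V v)) (enc v) where
  del s := by
    constructor
    · intro hs
      obtain ⟨C, h1, h2, rfl⟩ := mem_FC.1 hs
      refine ⟨mem_FC'.2 ⟨h1.trans (Finset.erase_subset _ _), h2⟩, ?_⟩
      rw [Finset.mem_image]
      rintro ⟨x, hx, hxv⟩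
      have := enc_inj hxv
      subst this
      simpa using h1 hx
    · rintro ⟨hs, hvs⟩
      obtain ⟨C, h1, h2, rfl⟩ := mem_FC.1 hs
      refine mem_FC'.2 ⟨fun x hx => Finset.mem_erase.2 ⟨?_, h1 hx⟩, h2⟩
      rintro rfl
      exact hvs (Finset.mem_image_of_mem _ hx)
  lnk s := by
    constructor
    · intro hs
      obtain ⟨C, h1, h2, rfl⟩ := mem_FC.1 hs
      constructor
      · rw [Finset.mem_image]
        rintro ⟨x, hx, hxv⟩
        have := enc_inj hxv
        subst this
        exact (mem_lkV.1 (h1 hx)).2.1 rfl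
      · rw [← Finset.image_insert, mem_FC']
        refine ⟨?_, chain_ins h2 (fun x hx => (mem_lkV.1 (h1 hx)).2.2)⟩
        intro x hx
        rcases Finset.mem_insert.1 hx with rfl | hx
        · exact hv
        · exact (mem_lkV.1 (h1 hx)).1
    · rintro ⟨hvs, hs⟩
      obtain ⟨C, h1, h2, h3⟩ := mem_FC.1 hs
      have hvC : v ∈ C := by
        have : enc v ∈ C.image enc := by rw [h3]; simp
        obtain ⟨x, hx, hxv⟩ := Finset.mem_image.1 this
        rwa [← enc_inj hxv]
      have hs' : s = (C.erase v).image enc := by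
        rw [Finset.image_erase enc_inj, h3, Finset.erase_insert hvs]
      rw [hs', mem_FC']
      refine ⟨fun x hx => ?_, chain_mono h2 (Finset.erase_subset _ _)⟩
      rw [Finset.mem_erase] at hx
      exact mem_lkV.2 ⟨h1 hx.2, hx.1, h2 _ hx.2 _ hvC⟩
  LD := by
    apply FC_mono
    intro x hx
    rw [mem_lkV] at hx
    exact Finset.mem_erase.2 ⟨hx.2.1, hx.1⟩

variable (K) in
def AcV (V : Finset (Finset ℕ)) (n : ℤ) : Prop := Ac K (FC V) n

lemma AcV_L1 {V : Finset (Finset ℕ)} {n : ℤ} (v : Finset ℕ) (hv : v ∈ V)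
    (h1 : AcV K (V.erase v) n) (h2 : AcV K (lkV V v) (n - 1)) : AcV K V n :=
  (split_FC hv).L1 h1 h2

lemma AcV_L2 {V : Finset (Finset ℕ)} {n : ℤ} (v : Finset ℕ) (hv : v ∈ V)
    (h1 : AcV K V n) (h2 : AcV K (lkV V v) n) : AcV K (V.erase v) n :=
  (split_FC hv).L2 h1 h2

lemma AcV_cone {V : Finset (Finset ℕ)} (n : ℤ) (v : Finset ℕ) (hv : v ∈ V)
    (h : ∀ x ∈ V, x ⊆ v ∨ v ⊆ x) : AcV K V n := by
  refine (split_FC hv).L3 (FC_mono ?_) n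
  intro x hx
  rw [Finset.mem_erase] at hx
  exact mem_lkV.2 ⟨hx.2, hx.1, h x hx.2⟩

lemma AcV_neg {V : Finset (Finset ℕ)} (n : ℤ) (hn : n < 0) : AcV K V n := Ac_neg _ _ hn

lemma AcV_empty (n : ℤ) (hn : n ≠ 0) : AcV K ∅ n := by
  intro z hz _
  have := span_map K (FC ∅) n LinearMap.id ⊥ (fun s hs hc => by
    obtain ⟨C, h1, h2, rfl⟩ := mem_FC.1 hs
    rw [Finset.subset_empty.1 h1] at hc
    simp at hc; omega) z hz
  refine ⟨0, zero_mem _, ?_⟩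
  simpa using this.symm

/-- Part 1: flag complexes with few vertices. -/
lemma few_vertices (N : ℕ) : ∀ (V : Finset (Finset ℕ)) (n : ℤ), V.card ≤ N → (V.card : ℤ) < 2 * n →
    AcV K V n := by
  induction N with
  | zero =>
    intro V n hV hn
    have : V = ∅ := Finset.card_eq_zero.1 (by omega)
    subst this
    apply AcV_empty; simp at hn; omega
  | succ N ih =>
    intro V n hV hn
    by_cases hc : IsChainF V
    · rcases V.eq_empty_or_nonempty with rfl | ⟨v, hv⟩
      · apply AcV_empty; simp at hn; omega
      · exact AcV_cone n v hv (fun x hx => hc x hx v hv)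
    · simp only [IsChainF] at hc
      push Not at hc
      obtain ⟨v, hv, w, hw, h1, h2⟩ := hc
      have hcard := Finset.card_erase_add_one hv
      refine AcV_L1 v hv (ih _ _ (by omega) (by omega)) ?_
      have hw' : w ∈ V.erase v := Finset.mem_erase.2 ⟨fun h => h1 (by rw [h]), hw⟩
      have hcard2 := Finset.card_erase_add_one hw'
      have : (lkV V v).card ≤ ((V.erase v).erase w).card := by
        apply Finset.card_le_card
        intro x hx
        rw [mem_lkV] at hx
        simp only [Finset.mem_erase]
        refine ⟨?_, hx.2.1, hx.1⟩
        rintro rfl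
        exact hx.2.2.elim h2 h1
      exact ih _ _ (by omega) (by omega)

/-- Lemma D. -/
lemma acyclic_D (A B : Finset ℕ) (p : ℕ) (hpB : p ∈ B) (hAB : A ⊆ B) (N : ℕ) :
    ∀ (S : Finset (Finset ℕ)), (S.filter (fun x => A ⊂ x ∧ x ⊂ B ∧ p ∉ x)).card ≤ N →
    insert p A ∈ S →
    (∀ x ∈ S, (A ⊂ x ∧ x ⊂ B) ∨ x ⊆ A ∨ B ⊆ x) →
    (∀ x ∈ S, A ⊂ x → x ⊂ B → p ∉ x → insert p x ∈ S) → ∀ n : ℤ, AcV K S n := by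
  induction N with
  | zero =>
    intro S hN hq htri _ n
    refine AcV_cone n _ hq ?_
    intro x hx
    rcases htri x hx with h | h | h
    · right
      have hpx : p ∈ x := by
        by_contra hp
        have : x ∈ S.filter (fun x => A ⊂ x ∧ x ⊂ B ∧ p ∉ x) := by simp [hx, h, hp]
        rw [Finset.card_eq_zero.1 (Nat.le_zero.1 hN)] at this
        simp at this
      exact Finset.insert_subset hpx h.1.1
    · exact Or.inl (h.trans (Finset.subset_insert _ _))
    · exact Or.inr (Finset.insert_subset (h hpB) (hAB.trans h))
  | succ N ih =>
    intro S hN hq htri hcl n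
    rcases (S.filter (fun x => A ⊂ x ∧ x ⊂ B ∧ p ∉ x)).eq_empty_or_nonempty with h0 | h0
    · exact ih S (by rw [h0]; simp) hq htri hcl n
    · obtain ⟨x, hx, hmax⟩ := Finset.exists_max_image _ Finset.card h0
      have hx' := hx
      rw [Finset.mem_filter] at hx'
      obtain ⟨hxS, hAx, hxB, hpx⟩ := hx'
      refine AcV_L1 x hxS (ih _ ?_ ?_ ?_ ?_ n) ?_
      · rw [Finset.filter_erase]
        have := Finset.card_erase_add_one hx
        omega
      · refine Finset.mem_erase.2 ⟨?_, hq⟩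
        rintro h; apply hpx; rw [← h]; simp
      · exact fun y hy => htri y (Finset.mem_of_mem_erase hy)
      · intro y hy h1 h2 h3
        refine Finset.mem_erase.2 ⟨?_, hcl y (Finset.mem_of_mem_erase hy) h1 h2 h3⟩
        rintro h; apply hpx; rw [← h]; simp
      · have hne : insert p x ≠ x := fun h => hpx (by rw [← h]; simp)
        refine AcV_cone _ (insert p x) (mem_lkV.2 ⟨hcl x hxS hAx hxB hpx, hne,
          Or.inr (Finset.subset_insert _ _)⟩) ?_
        intro y hy
        obtain ⟨hyS, hyx, hc⟩ := mem_lkV.1 hy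
        rcases hc with hc | hc
        · exact Or.inl (hc.trans (Finset.subset_insert _ _))
        · right
          refine Finset.insert_subset ?_ hc
          rcases htri y hyS with h | h | h
          · by_contra hpy
            have h1 := hmax y (Finset.mem_filter.2 ⟨hyS, h.1, h.2, hpy⟩)
            exact hyx (Finset.eq_of_subset_of_card_le hc h1).symm
          · exact absurd (hc.trans h) hAx.2
          · exact h hpB

noncomputable def Pd (d : ℕ) : Finset (Finset ℕ) :=
  (Finset.range d).powerset.filter (fun x => x ≠ ∅ ∧ x ≠ Finset.range d)

/-- vertices of the link of the chain F -/
noncomputable def lkF (d : ℕ) (F : Finset (Finset ℕ)) : Finset (Finset ℕ) :=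
  (Pd d).filter (fun x => x ∉ F ∧ ∀ f ∈ F, x ⊆ f ∨ f ⊆ x)

lemma mem_Pd {d : ℕ} {x : Finset ℕ} : x ∈ Pd d ↔ x ⊆ range d ∧ x ≠ ∅ ∧ x ≠ range d := by
  simp [Pd]

lemma mem_lkF {d : ℕ} {F : Finset (Finset ℕ)} {x : Finset ℕ} :
    x ∈ lkF d F ↔ x ∈ Pd d ∧ x ∉ F ∧ ∀ f ∈ F, x ⊆ f ∨ f ⊆ x := by simp [lkF]

lemma lkV_lkF {d : ℕ} {F D : Finset (Finset ℕ)} {v : Finset ℕ} :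
    lkV (lkF d F \ D) v = lkF d (insert v F) \ D := by
  ext x
  simp only [mem_lkV, mem_lkF, Finset.mem_sdiff, Finset.mem_insert, forall_eq_or_imp, not_or]
  tauto

lemma lkF_insert_sub {d : ℕ} {F : Finset (Finset ℕ)} {v : Finset ℕ} :
    lkF d (insert v F) ⊆ lkF d F := by
  intro x
  simp only [mem_lkF, Finset.mem_insert, forall_eq_or_imp, not_or]
  tauto

lemma chain_insert {d : ℕ} {F : Finset (Finset ℕ)} {v : Finset ℕ} (hF : IsChainF F)
    (hv : v ∈ lkF d F) : IsChainF (insert v F) :=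
  chain_ins hF (fun x hx => ((mem_lkF.1 hv).2.2 x hx).symm)

/-- the gap of a chain around an r -/
lemma gap {d : ℕ} {F : Finset (Finset ℕ)} (hF : IsChainF F) (hFP : F ⊆ Pd d) (r : ℕ)
    (hr0 : 0 < r) (hrd : r < d) (_hr : ∀ f ∈ F, f.card ≠ r) :
    ∃ A B : Finset ℕ, A ⊆ B ∧ A.card < r ∧ r < B.card ∧ B ⊆ range d ∧ (A = ∅ ∨ A ∈ F) ∧
      (B = range d ∨ B ∈ F) ∧ ∀ f ∈ F, (f.card < r → f ⊆ A) ∧ (r < f.card → B ⊆ f) := by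
  have hA : ∃ A, A.card < r ∧ (A = ∅ ∨ A ∈ F) ∧ ∀ f ∈ F, f.card < r → f ⊆ A := by
    rcases (F.filter (fun f => f.card < r)).eq_empty_or_nonempty with h0 | h0
    · refine ⟨∅, by simpa, Or.inl rfl, ?_⟩
      intro f hf hc
      have : f ∈ F.filter (fun f => f.card < r) := by simp [hf, hc]
      rw [h0] at this; simp at this
    · obtain ⟨A, hA, hmax⟩ := Finset.exists_max_image _ Finset.card h0
      rw [Finset.mem_filter] at hA
      refine ⟨A, hA.2, Or.inr hA.1, ?_⟩
      intro f hf hc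
      rcases hF f hf A hA.1 with h | h
      · exact h
      · rw [Finset.eq_of_subset_of_card_le h (hmax f (by simp [hf, hc]))]
  have hB : ∃ B, r < B.card ∧ (B = range d ∨ B ∈ F) ∧ ∀ f ∈ F, r < f.card → B ⊆ f := by
    rcases (F.filter (fun f => r < f.card)).eq_empty_or_nonempty with h0 | h0
    · refine ⟨range d, by simpa, Or.inl rfl, ?_⟩
      intro f hf hc
      have : f ∈ F.filter (fun f => r < f.card) := by simp [hf, hc]
      rw [h0] at this; simp at this
    · obtain ⟨B, hB, hmin⟩ := Finset.exists_min_image _ Finset.card h0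
      rw [Finset.mem_filter] at hB
      refine ⟨B, hB.2, Or.inr hB.1, ?_⟩
      intro f hf hc
      rcases hF B hB.1 f hf with h | h
      · exact h
      · rw [Finset.eq_of_subset_of_card_le h (hmin f (by simp [hf, hc]))]
  obtain ⟨A, hA1, hA2, hA3⟩ := hA
  obtain ⟨B, hB1, hB2, hB3⟩ := hB
  have hBd : B ⊆ range d := by
    rcases hB2 with rfl | h
    · exact subset_rfl
    · exact (mem_Pd.1 (hFP h)).1
  refine ⟨A, B, ?_, hA1, hB1, hBd, hA2, hB2, fun f hf => ⟨hA3 f hf, hB3 f hf⟩⟩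
  rcases hA2 with rfl | h
  · simp
  rcases hB2 with rfl | h'
  · exact (mem_Pd.1 (hFP h)).1
  rcases hF A h B h' with h1 | h1
  · exact h1
  · have := Finset.card_le_card h1; omega

lemma between_mem {d : ℕ} {F : Finset (Finset ℕ)} {A B x : Finset ℕ} 
    (hBd : B ⊆ range d) (hF : ∀ f ∈ F, f ⊆ A ∨ B ⊆ f) (h1 : A ⊂ x) (h2 : x ⊂ B) :
    x ∈ lkF d F := by
  refine mem_lkF.2 ⟨mem_Pd.2 ⟨h2.1.trans hBd, ?_, ?_⟩, ?_, ?_⟩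
  · rintro rfl; exact h1.2 (by simp)
  · rintro rfl; exact h2.2 hBd
  · intro hx
    rcases hF x hx with h | h
    · exact h1.2 h
    · exact h2.2 h
  · intro f hf
    rcases hF f hf with h | h
    · exact Or.inr (h.trans h1.1)
    · exact Or.inl (h2.1.trans h)

lemma lk_nonempty {d : ℕ} {F : Finset (Finset ℕ)} (hF : IsChainF F) (hFP : F ⊆ Pd d)
    (hc : F.card + 1 < d) : (lkF d F).Nonempty := by
  have : ∃ r ∈ Finset.Ioo 0 d, r ∉ F.image Finset.card := by
    apply Finset.exists_mem_notMem_of_card_lt_card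
    have := Finset.card_image_le (s := F) (f := Finset.card)
    simp; omega
  obtain ⟨r, hr, hrF⟩ := this
  rw [Finset.mem_Ioo] at hr
  have hr' : ∀ f ∈ F, f.card ≠ r := by
    intro f hf h; exact hrF (Finset.mem_image.2 ⟨f, hf, h⟩)
  obtain ⟨A, B, hAB, hA, hB, hBd, -, -, hall⟩ := gap hF hFP r hr.1 hr.2 hr'
  obtain ⟨x, hAx, hxB, hxr⟩ := Finset.exists_subsuperset_card_eq hAB hA.le hB.le
  refine ⟨x, between_mem (A := A) (B := B) hBd ?_ ?_ ?_⟩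
  · intro f hf
    rcases lt_or_gt_of_ne (hr' f hf) with h | h
    · exact Or.inl ((hall f hf).1 h)
    · exact Or.inr ((hall f hf).2 h)
  · refine ⟨hAx, fun h => ?_⟩
    have := Finset.card_le_card h; omega
  · refine ⟨hxB, fun h => ?_⟩
    have := Finset.card_le_card h; omega

/-- removing one vertex of the link yields an acyclic complex -/
lemma lkF_erase (d : ℕ) (N : ℕ) : ∀ (F : Finset (Finset ℕ)), IsChainF F → F ⊆ Pd d →
    (lkF d F).card ≤ N → ∀ v ∈ lkF d F, ∀ n : ℤ, AcV K (lkF d F \ {v}) n := by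
  induction N with
  | zero =>
    intro F _ _ hN v hv
    rw [Finset.card_eq_zero.1 (by omega : (lkF d F).card = 0)] at hv
    simp at hv
  | succ N ih =>
    intro F hF hFP hN v hv n
    obtain ⟨hvP, hvF, hvc⟩ := mem_lkF.1 hv
    obtain ⟨hvd, hv0, hv1⟩ := mem_Pd.1 hvP
    have hr' : ∀ f ∈ F, f.card ≠ v.card := by
      intro f hf h
      apply hvF
      rcases hvc f hf with h' | h'
      · rwa [Finset.eq_of_subset_of_card_le h' h.le]
      · rwa [← Finset.eq_of_subset_of_card_le h' h.ge]
    have hvlt : v.card < d := by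
      have := Finset.card_lt_card (Finset.ssubset_iff_subset_ne.2 ⟨hvd, hv1⟩)
      simpa using this
    obtain ⟨A, B, hAB, hA, hB, hBd, hAF, hBF, hall⟩ := gap hF hFP v.card
      (Finset.card_pos.2 (Finset.nonempty_iff_ne_empty.2 hv0)) hvlt hr'
    have hall' : ∀ f ∈ F, f ⊆ A ∨ B ⊆ f := by
      intro f hf
      rcases lt_or_gt_of_ne (hr' f hf) with h | h
      · exact Or.inl ((hall f hf).1 h)
      · exact Or.inr ((hall f hf).2 h)
    have cA : ∀ x ∈ lkF d F, x ≠ A ∧ (x ⊆ A ∨ A ⊆ x) := by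
      intro x hx
      obtain ⟨h1, h2, h3⟩ := mem_lkF.1 hx
      rcases hAF with rfl | h
      · exact ⟨(mem_Pd.1 h1).2.1, by simp⟩
      · exact ⟨fun e => h2 (e ▸ h), h3 A h⟩
    have cB : ∀ x ∈ lkF d F, x ≠ B ∧ (x ⊆ B ∨ B ⊆ x) := by
      intro x hx
      obtain ⟨h1, h2, h3⟩ := mem_lkF.1 hx
      rcases hBF with rfl | h
      · exact ⟨(mem_Pd.1 h1).2.2, Or.inl (mem_Pd.1 h1).1⟩
      · exact ⟨fun e => h2 (e ▸ h), h3 B h⟩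
    have tri : ∀ x ∈ lkF d F, (A ⊂ x ∧ x ⊂ B) ∨ x ⊆ A ∨ B ⊆ x := by
      intro x hx
      obtain ⟨a1, a2⟩ := cA x hx
      obtain ⟨b1, b2⟩ := cB x hx
      rcases a2 with a2 | a2
      · exact Or.inr (Or.inl a2)
      · rcases b2 with b2 | b2
        · exact Or.inl ⟨Finset.ssubset_iff_subset_ne.2 ⟨a2, a1.symm⟩,
            Finset.ssubset_iff_subset_ne.2 ⟨b2, b1⟩⟩
        · exact Or.inr (Or.inr b2)
    have hvAB : A ⊂ v ∧ v ⊂ B := by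
      rcases tri v hv with h | h | h
      · exact h
      · have := Finset.card_le_card h; omega
      · have := Finset.card_le_card h; omega
    obtain ⟨hAv, hvB⟩ := hvAB
    obtain ⟨p, hpB, hpv⟩ := Finset.exists_of_ssubset hvB
    have hpA : p ∉ A := fun h => hpv (hAv.1 h)
    -- Lemma D applies to the set with x0 removed
    have hvx0 : v ⊆ B.erase p := fun y hy =>
      Finset.mem_erase.2 ⟨fun h => hpv (h ▸ hy), hvB.1 hy⟩
    have hD : ∀ m : ℤ, AcV K ((lkF d F \ {v}).erase (B.erase p)) m := by
      refine acyclic_D A B p hpB hAB _ _ le_rfl ?_ ?_ ?_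
      · rw [Finset.mem_erase, Finset.mem_sdiff, Finset.mem_singleton]
        refine ⟨fun h => ?_, between_mem hBd hall' ?_ ?_, fun h => ?_⟩
        · have : p ∈ B.erase p := by rw [← h]; simp
          simp at this
        · exact Finset.ssubset_insert hpA
        · refine ⟨Finset.insert_subset hpB hAB, fun h => ?_⟩
          apply hAv.2
          intro y hy
          have := h (hvB.1 hy)
          rw [Finset.mem_insert] at this
          rcases this with rfl | h'
          · exact absurd hy hpv
          · exact h'
        · apply hpv; rw [← h]; simp
      · intro x hx
        exact tri x (Finset.mem_sdiff.1 (Finset.mem_of_mem_erase hx)).1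
      · intro x hx h1 h2 h3
        rw [Finset.mem_erase, Finset.mem_sdiff, Finset.mem_singleton]
        refine ⟨fun h => ?_, between_mem hBd hall' ?_ ?_, fun h => ?_⟩
        · have : p ∈ B.erase p := by rw [← h]; simp
          simp at this
        · exact h1.trans_subset (Finset.subset_insert _ _)
        · refine Finset.ssubset_iff_subset_ne.2 ⟨Finset.insert_subset hpB h2.1, fun h => ?_⟩
          apply (Finset.mem_erase.1 hx).1
          rw [← h, Finset.erase_insert h3]
        · apply hpv; rw [← h]; simp
    by_cases hvx : B.erase p = v
    · have := hD n
      rwa [Finset.erase_eq_of_notMem (by simp [hvx])] at this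
    · have hx0 : B.erase p ∈ lkF d F :=
        between_mem hBd hall' (hAv.trans_subset hvx0) (Finset.erase_ssubset hpB)
      have hx0' : B.erase p ∈ lkF d F \ {v} := by
        rw [Finset.mem_sdiff, Finset.mem_singleton]; exact ⟨hx0, hvx⟩
      refine AcV_L1 (B.erase p) hx0' (hD n) ?_
      rw [lkV_lkF]
      have hlt : (lkF d (insert (B.erase p) F)).card < (lkF d F).card := by
        apply Finset.card_lt_card
        refine ⟨lkF_insert_sub, fun h => ?_⟩
        have := (mem_lkF.1 (h hx0)).2.1
        simp at this
      refine ih _ (chain_insert hF hx0) (Finset.insert_subset (mem_lkF.1 hx0).1 hFP) (by omega) v ?_ _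
      refine mem_lkF.2 ⟨hvP, ?_, ?_⟩
      · rw [Finset.mem_insert, not_or]; exact ⟨fun h => hvx h.symm, hvF⟩
      · intro f hf
        rcases Finset.mem_insert.1 hf with rfl | hf
        · exact Or.inl hvx0
        · exact hvc f hf

lemma lkF_full (d : ℕ) (N : ℕ) : ∀ (F : Finset (Finset ℕ)), IsChainF F → F ⊆ Pd d →
    (d : ℤ) - 1 - F.card ≤ N → ∀ n : ℤ, n < (d : ℤ) - 1 - F.card → AcV K (lkF d F) n := by
  induction N with
  | zero => 
    intro F hF hFP hN n hn
    exact AcV_neg n (by omega)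
  | succ N ih =>
    intro F hF hFP hN n hn
    rcases lt_or_ge n 0 with h | h
    · exact AcV_neg n h
    obtain ⟨v, hv⟩ := lk_nonempty hF hFP (by omega)
    refine AcV_L1 v hv ?_ ?_
    · rw [← Finset.sdiff_singleton_eq_erase]
      exact lkF_erase d _ F hF hFP le_rfl v hv n
    · have := lkV_lkF (d := d) (F := F) (D := ∅) (v := v)
      rw [Finset.sdiff_empty, Finset.sdiff_empty] at this
      rw [this]
      have hc : (insert v F).card = F.card + 1 := Finset.card_insert_of_notMem (mem_lkF.1 hv).2.1
      refine ih _ (chain_insert hF hv) (Finset.insert_subset (mem_lkF.1 hv).1 hFP) ?_ _ ?_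
      · rw [hc]; push_cast at *; omega
      · rw [hc]; push_cast at *; omega

lemma sdiff_insert_erase {S C : Finset (Finset ℕ)} {v : Finset ℕ} (hv : v ∈ C) :
    S \ C = (S \ C.erase v).erase v := by
  ext x
  simp only [Finset.mem_sdiff, Finset.mem_erase]
  by_cases h : x = v
  · subst h; simp [hv]
  · simp [h]

lemma lkF_clique (d : ℕ) (N : ℕ) : ∀ (F C : Finset (Finset ℕ)), IsChainF F → F ⊆ Pd d →
    IsChainF C → C ⊆ lkF d F → C.card = N + 1 → ∀ n : ℤ, AcV K (lkF d F \ C) n := by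
  induction N with
  | zero =>
    intro F C hF hFP hC hCF hN n
    obtain ⟨v, rfl⟩ := Finset.card_eq_one.1 (by simpa using hN)
    exact lkF_erase d _ F hF hFP le_rfl v (hCF (by simp)) n
  | succ N ih =>
    intro F C hF hFP hC hCF hN n
    obtain ⟨v, hv⟩ : C.Nonempty := Finset.card_pos.1 (by omega)
    have hvF := hCF hv
    have hcard := Finset.card_erase_add_one hv
    rw [sdiff_insert_erase hv]
    apply AcV_L2 v
    · simp [hvF]
    · exact ih F _ hF hFP (chain_mono hC (Finset.erase_subset _ _)) ((Finset.erase_subset _ _).trans hCF)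
        (by omega) n
    · rw [lkV_lkF]
      refine ih _ _ (chain_insert hF hvF) (Finset.insert_subset (mem_lkF.1 hvF).1 hFP)
        (chain_mono hC (Finset.erase_subset _ _)) ?_ (by omega) n
      intro x hx
      rw [Finset.mem_erase] at hx
      have h := mem_lkF.1 (hCF hx.2)
      refine mem_lkF.2 ⟨h.1, by simp [hx.1, h.2.1], ?_⟩
      intro f hf
      rcases Finset.mem_insert.1 hf with rfl | hf
      · exact hC x hx.2 _ hv
      · exact h.2.2 f hf

lemma lkF_few (d : ℕ) (N : ℕ) : ∀ (F C : Finset (Finset ℕ)), IsChainF F → F ⊆ Pd d →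
    C ⊆ lkF d F → C.card ≤ N → ∀ n : ℤ, (C.card : ℤ) < 2 * ((d : ℤ) - 1 - F.card - n) →
    AcV K (lkF d F \ C) n := by
  induction N with
  | zero =>
    intro F C hF hFP hCF hN n hn
    have : C = ∅ := Finset.card_eq_zero.1 (by omega)
    subst this
    rw [Finset.sdiff_empty]
    simp at hn
    exact lkF_full d ((d : ℤ) - 1 - F.card).toNat F hF hFP (by omega) n (by omega)
  | succ N ih =>
    intro F C hF hFP hCF hN n hn
    by_cases hle : C.card ≤ N
    · exact ih F C hF hFP hCF hle n hn
    by_cases hc : IsChainF C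
    · exact lkF_clique d N F C hF hFP hc hCF (by omega) n
    · simp only [IsChainF] at hc
      push Not at hc
      obtain ⟨v, hv, w, hw, h1, h2⟩ := hc
      have hvF := hCF hv
      have hcard := Finset.card_erase_add_one hv
      rw [sdiff_insert_erase hv]
      apply AcV_L2 v
      · simp [hvF]
      · exact ih F _ hF hFP ((Finset.erase_subset _ _).trans hCF) (by omega) n (by omega)
      · rw [lkV_lkF]
        have hw' : w ∈ C.erase v := Finset.mem_erase.2 ⟨fun h => h1 (by rw [h]), hw⟩
        have hcard2 := Finset.card_erase_add_one hw'
        have heq : lkF d (insert v F) \ C.erase v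
            = lkF d (insert v F) \ (lkF d (insert v F) ∩ C.erase v) := by
          simp
        have hle2 : (lkF d (insert v F) ∩ C.erase v).card ≤ ((C.erase v).erase w).card := by
          apply Finset.card_le_card
          intro x hx
          rw [Finset.mem_inter] at hx
          refine Finset.mem_erase.2 ⟨?_, hx.2⟩
          rintro rfl
          have := (mem_lkF.1 hx.1).2.2 v (by simp)
          exact this.elim h2 h1
        have hcF : (insert v F).card = F.card + 1 :=
          Finset.card_insert_of_notMem (mem_lkF.1 hvF).2.1
        rw [heq]
        refine ih _ _ (chain_insert hF hvF) (Finset.insert_subset (mem_lkF.1 hvF).1 hFP)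
          Finset.inter_subset_left (by omega) n ?_
        rw [hcF]; push_cast; omega


/-! nonvanishing -/

noncomputable def detS {j : ℕ} (h : ℕ → Fin j → K) (s : Finset ℕ) : K :=
  if hc : s.card = j then (Matrix.of fun a b => h (s.orderEmbOfFin hc a) b : Matrix (Fin j) (Fin j) K).det
  else 0

noncomputable def phi {j : ℕ} (h : ℕ → Fin j → K) : (Finset ℕ →₀ K) →ₗ[K] K :=
  Finsupp.lsum K fun s => LinearMap.toSpanSingleton K K (detS h s)

lemma phi_single {j : ℕ} (h : ℕ → Fin j → K) (s : Finset ℕ) :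
    phi h (Finsupp.single s 1) = detS h s := by
  simp [phi]

lemma phi_bdry {j : ℕ} (h : ℕ → Fin j → K) (t : Finset ℕ) (ht : t.card = j + 1) :
    phi h (bdryFace K t) =
      (Matrix.of fun a => (Fin.cons 1 (h (t.orderEmbOfFin ht a)) : Fin (j + 1) → K) :
        Matrix (Fin (j + 1)) (Fin (j + 1)) K).det := by
  rw [Matrix.det_succ_column_zero, bdryFace, map_sum]
  have h1 : ∀ f : ℕ → K, ∑ v ∈ t, f v = ∑ i : Fin (j + 1), f (t.orderEmbOfFin ht i) := by
    intro f
    conv_lhs => rw [← Finset.map_orderEmbOfFin_univ t ht]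
    rw [Finset.sum_map]
    rfl
  rw [h1]
  apply Finset.sum_congr rfl
  intro i _
  rw [map_smul, phi_single, smul_eq_mul]
  have hcard : (t.filter (fun w => w < t.orderEmbOfFin ht i)).card = i := by
    have : t.filter (fun w => w < t.orderEmbOfFin ht i)
        = (Finset.Iio i).map (t.orderEmbOfFin ht).toEmbedding := by
      ext w
      simp only [Finset.mem_filter, Finset.mem_map, Finset.mem_Iio]
      constructor
      · rintro ⟨hw, h2⟩
        have hr : w ∈ Set.range (t.orderEmbOfFin ht) := by
          rw [Finset.range_orderEmbOfFin]; exact hw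
        obtain ⟨a, rfl⟩ := hr
        exact ⟨a, by simpa using h2, rfl⟩
      · rintro ⟨a, ha, rfl⟩
        exact ⟨Finset.orderEmbOfFin_mem t ht a, by simpa using ha⟩
    rw [this, Finset.card_map, Fin.card_Iio]
  rw [hcard]
  have hmem : t.orderEmbOfFin ht i ∈ t := Finset.orderEmbOfFin_mem t ht i
  have hc : (t.erase (t.orderEmbOfFin ht i)).card = j := by
    rw [Finset.card_erase_of_mem hmem, ht]; simp
  have hu : (fun a => t.orderEmbOfFin ht (i.succAbove a))
      = (t.erase (t.orderEmbOfFin ht i)).orderEmbOfFin hc := by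
    apply Finset.orderEmbOfFin_unique
    · intro a
      refine Finset.mem_erase.2 ⟨?_, Finset.orderEmbOfFin_mem t ht _⟩
      intro h2
      exact Fin.succAbove_ne i a ((t.orderEmbOfFin ht).injective h2)
    · exact (t.orderEmbOfFin ht).strictMono.comp (Fin.strictMono_succAbove i)
  rw [detS, dif_pos hc]
  have : (Matrix.of fun a b => h ((t.erase (t.orderEmbOfFin ht i)).orderEmbOfFin hc a) b :
      Matrix (Fin j) (Fin j) K) =
      (Matrix.of fun a => (Fin.cons 1 (h (t.orderEmbOfFin ht a)) : Fin (j + 1) → K) :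
        Matrix (Fin (j + 1)) (Fin (j + 1)) K).submatrix i.succAbove Fin.succ := by
    ext a b
    rw [← hu]
    simp
  rw [this]
  simp

lemma phi_bdry_zero {j : ℕ} (h : ℕ → Fin j → K) (t : Finset ℕ) (ht : t.card = j + 1)
    (hd : (∀ v ∈ t, ∃ l, h v = Pi.single l 1) ∨ ∃ l, ∀ v ∈ t, h v l = 0) :
    phi h (bdryFace K t) = 0 := by
  rw [phi_bdry h t ht]
  rcases hd with hd | ⟨l, hl⟩
  · apply Matrix.exists_mulVec_eq_zero_iff.1
    refine ⟨Fin.cons (-1) (fun _ => 1), ?_, ?_⟩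
    · intro h0
      have := congrFun h0 0
      simp at this
    · ext a
      obtain ⟨l, hl⟩ := hd _ (Finset.orderEmbOfFin_mem t ht a)
      simp [Matrix.mulVec, dotProduct, Fin.sum_univ_succ, hl]
  · apply Matrix.det_eq_zero_of_column_eq_zero l.succ
    intro a
    simpa using hl _ (Finset.orderEmbOfFin_mem t ht a)

lemma detS_row_zero {j : ℕ} (h : ℕ → Fin j → K) (s : Finset ℕ) (w : ℕ) (hw : w ∈ s)
    (h0 : h w = 0) : detS h s = 0 := by
  rw [detS]
  split_ifs with hc
  · have : w ∈ Set.range (s.orderEmbOfFin hc) := by rw [Finset.range_orderEmbOfFin]; exact hw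
    obtain ⟨a, rfl⟩ := this
    apply Matrix.det_eq_zero_of_row_eq_zero a
    intro b
    simp [h0]
  · rfl

lemma detS_ne_zero {j : ℕ} (h : ℕ → Fin j → K) (s : Finset ℕ) (hc : s.card = j) (u : Fin j → ℕ)
    (hs : ∀ v ∈ s, ∃ l, v = u l) (hu : ∀ l, h (u l) = Pi.single l 1) : detS h s ≠ 0 := by
  rw [detS, dif_pos hc]
  choose σ hσ using fun a => hs _ (Finset.orderEmbOfFin_mem s hc a)
  have hinj : Function.Injective σ := by
    intro a b hab
    apply (s.orderEmbOfFin hc).injective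
    rw [hσ a, hσ b, hab]
  let τ : Equiv.Perm (Fin j) := Equiv.ofBijective σ (Finite.injective_iff_bijective.1 hinj)
  have : (Matrix.of fun a b => h (s.orderEmbOfFin hc a) b : Matrix (Fin j) (Fin j) K)
      = (1 : Matrix (Fin j) (Fin j) K).submatrix τ id := by
    ext a b
    rw [Matrix.of_apply, hσ a, hu]
    simp [τ, Matrix.one_apply, Pi.single_apply, eq_comm]
  rw [this, Matrix.det_permute, Matrix.det_one, mul_one]
  rcases Int.units_eq_one_or (Equiv.Perm.sign τ) with h' | h' <;> simp [h']

lemma not_Ac {j : ℕ} (h : ℕ → Fin j → K) (Δ : SC) (n : ℤ) (hn : n = j)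
    (hd : ∀ t ∈ Δ, (∀ v ∈ t, ∃ l, h v = Pi.single l 1) ∨ ∃ l, ∀ v ∈ t, h v l = 0)
    (z : Finset ℕ →₀ K) (hz : z ∈ facesSpan K Δ n) (hz0 : bdry K z = 0) (hp : phi h z ≠ 0) :
    ¬ Ac K Δ n := by
  intro hA
  obtain ⟨c, hc, rfl⟩ := hA z hz hz0
  apply hp
  have := span_map K Δ (n + 1) LinearMap.id (LinearMap.ker (phi h ∘ₗ bdry K)) (fun s hs hsc => by
    rw [LinearMap.mem_ker, LinearMap.id_apply, LinearMap.comp_apply, bdry_single,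
      phi_bdry_zero h s (by omega) (hd s hs)]) c hc
  exact LinearMap.mem_ker.1 this

variable (K) in
noncomputable def zc (u w : ℕ → ℕ) : ℕ → (Finset ℕ →₀ K)
  | 0 => Finsupp.single ∅ 1
  | l + 1 => eps K (w l) (zc u w l) - eps K (u l) (zc u w l)

lemma zc_bdry (u w : ℕ → ℕ) (l : ℕ) : bdry K (zc K u w l) = 0 := by
  induction l with
  | zero => simp [zc, bdry_single, bdryFace]
  | succ l ih =>
    have h1 := bdry_eps K (w l) (zc K u w l)
    have h2 := bdry_eps K (u l) (zc K u w l)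
    rw [ih, map_zero, add_zero] at h1 h2
    rw [zc, map_sub, h1, h2, sub_self]

lemma zc_mem (U V : ℕ → Finset ℕ) (S : Finset (Finset ℕ)) (j : ℕ)
    (hU : ∀ l < j, U l ∈ S) (hV : ∀ l < j, V l ∈ S)
    (hn : ∀ m l, m < l → l < j → U m ⊆ U l ∧ U m ⊆ V l ∧ V m ⊆ U l ∧ V m ⊆ V l) (l : ℕ) (hl : l ≤ j) :
    zc K (fun l => enc (U l)) (fun l => enc (V l)) l ∈
      facesSpan K (FC (S.filter (fun x => ∃ m < l, x = U m ∨ x = V m))) l := by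
  induction l with
  | zero =>
    apply single_mem
    · rw [mem_FC]; exact ⟨∅, by simp, by simp [IsChainF], by simp⟩
    · simp
  | succ l ih =>
    have ih := ih (by omega)
    have key : ∀ x, x ∈ S → (x = U l ∨ x = V l) →
        eps K (enc x) (zc K (fun l => enc (U l)) (fun l => enc (V l)) l) ∈
        facesSpan K (FC (S.filter (fun x => ∃ m < l + 1, x = U m ∨ x = V m))) (l + 1 : ℕ) := by
      intro x hxS hx
      refine span_map K _ _ (eps K (enc x)) _ ?_ _ ih
      intro s hs hsc
      obtain ⟨C, h1, h2, rfl⟩ := mem_FC.1 hs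
      rw [eps_single, epsF]
      split_ifs with hm
      · exact zero_mem _
      · apply Submodule.smul_mem
        apply single_mem
        · rw [← Finset.image_insert, mem_FC']
          constructor
          · intro y hy
            rcases Finset.mem_insert.1 hy with rfl | hy
            · exact Finset.mem_filter.2 ⟨hxS, l, by omega, hx⟩
            · obtain ⟨hyS, m, hm, hm'⟩ := Finset.mem_filter.1 (h1 hy)
              exact Finset.mem_filter.2 ⟨hyS, m, by omega, hm'⟩
          · refine chain_ins h2 (fun y hy => Or.inl ?_)
            obtain ⟨hyS, m, hm, hm'⟩ := Finset.mem_filter.1 (h1 hy)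
            obtain ⟨a1, a2, a3, a4⟩ := hn m l hm (by omega)
            rcases hx with rfl | rfl <;> rcases hm' with rfl | rfl <;> assumption
        · rw [Finset.card_insert_of_notMem hm]; push_cast; omega
    rw [zc]
    exact sub_mem (key _ (hV l (by omega)) (Or.inr rfl)) (key _ (hU l (by omega)) (Or.inl rfl))

variable (K) in
noncomputable def Bad (w : ℕ → ℕ) (j : ℕ) : Submodule K (Finset ℕ →₀ K) :=
  Submodule.span K ((fun s => Finsupp.single s (1 : K)) '' {s | ∃ m < j, w m ∈ s})

lemma bad_eps (w : ℕ → ℕ) (j v : ℕ) (x : Finset ℕ →₀ K) (hx : x ∈ Bad K w j) :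
    eps K v x ∈ Bad K w j := by
  have : Bad K w j ≤ (Bad K w j).comap (eps K v) := by
    conv_lhs => rw [Bad]
    rw [Submodule.span_le]
    rintro _ ⟨s, ⟨m, hm, hs⟩, rfl⟩
    simp only [SetLike.mem_coe, Submodule.mem_comap, eps_single, epsF]
    split_ifs
    · exact zero_mem _
    · exact Submodule.smul_mem _ _ (Submodule.subset_span ⟨_, ⟨m, hm, by simp [hs]⟩, rfl⟩)
  exact this hx

lemma bad_eps' (w : ℕ → ℕ) (j m : ℕ) (hm : m < j) (x : Finset ℕ →₀ K) :
    eps K (w m) x ∈ Bad K w j := by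
  have : ∀ x, x ∈ (Bad K w j).comap (eps K (w m)) := by
    intro x
    induction x using Finsupp.induction_linear with
    | zero => exact zero_mem _
    | add f g hf hg => exact add_mem hf hg
    | single s a =>
      rw [← mul_one a, ← smul_eq_mul, ← Finsupp.smul_single]
      apply Submodule.smul_mem
      simp only [Submodule.mem_comap, eps_single, epsF]
      split_ifs
      · exact zero_mem _
      · exact Submodule.smul_mem _ _ (Submodule.subset_span ⟨_, ⟨m, hm, by simp⟩, rfl⟩)
  exact this x

lemma zc_decomp (u w : ℕ → ℕ) (j : ℕ) (hu : ∀ a < j, ∀ b < j, u a = u b → a = b)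
    (l : ℕ) (hl : l ≤ j) : ∃ c : K, c ≠ 0 ∧
      zc K u w l - c • Finsupp.single ((range l).image u) 1 ∈ Bad K w j := by
  induction l with
  | zero => exact ⟨1, one_ne_zero, by simp [zc]⟩
  | succ l ih =>
    obtain ⟨c, hc, hz⟩ := ih (by omega)
    have hnot : u l ∉ (range l).image u := by
      rw [Finset.mem_image]
      rintro ⟨m, hm, hm'⟩
      rw [Finset.mem_range] at hm
      have := hu m (by omega) l (by omega) hm'
      omega
    refine ⟨-(c * (-1) ^ (((range l).image u).filter (fun x => x < u l)).card), ?_, ?_⟩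
    · simp [hc]
    · have h1 := bad_eps w j (u l) _ hz
      rw [map_sub, map_smul, eps_single, epsF, if_neg hnot, smul_smul] at h1
      have h2 := bad_eps' w j l (by omega) (zc K u w l)
      rw [zc, Finset.range_add_one, Finset.image_insert, neg_smul]
      have := sub_mem h2 h1
      convert this using 1
      abel

lemma phi_zc {j : ℕ} (h : ℕ → Fin j → K) (u w : ℕ → ℕ)
    (hu : ∀ l : Fin j, h (u l) = Pi.single l 1) (hw : ∀ m < j, h (w m) = 0) :
    phi h (zc K u w j) ≠ 0 := by
  have hinj : ∀ a < j, ∀ b < j, u a = u b → a = b := by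
    intro a ha b hb hab
    have h1 := hu ⟨a, ha⟩
    have h2 := hu ⟨b, hb⟩
    simp only at h1 h2
    rw [hab, h2] at h1
    have h3 := congrFun h1 ⟨a, ha⟩
    by_contra hne
    rw [Pi.single_eq_same, Pi.single_eq_of_ne (by simp [hne])] at h3
    exact zero_ne_one h3
  obtain ⟨c, hc, hz⟩ := zc_decomp (K := K) u w j hinj j le_rfl
  have hB : Bad K w j ≤ LinearMap.ker (phi h) := by
    rw [Bad, Submodule.span_le]
    rintro _ ⟨s, ⟨m, hm, hs⟩, rfl⟩
    simp only [SetLike.mem_coe, LinearMap.mem_ker, phi_single]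
    exact detS_row_zero h s _ hs (hw m hm)
  have := hB hz
  rw [LinearMap.mem_ker, map_sub, sub_eq_zero, map_smul, phi_single] at this
  rw [this, smul_eq_mul]
  refine mul_ne_zero hc (detS_ne_zero h _ ?_ (fun l => u l) ?_ hu)
  · rw [Finset.card_image_of_injOn, Finset.card_range]
    intro a ha b hb hab
    simp at ha hb
    exact hinj a ha b hb hab
  · intro v hv
    obtain ⟨m, hm, rfl⟩ := Finset.mem_image.1 hv
    exact ⟨⟨m, Finset.mem_range.1 hm⟩, rfl⟩

/-! the block construction -/

def blk (j x : ℕ) : ℕ := (x + 1) % (j + 1)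

def posB (d j : ℕ) (A : Finset ℕ) (l : ℕ) : Prop :=
  (∀ x < d, blk j x = l → x ∈ A) ∧ ∀ x ∈ A, blk j x ≠ l + 1

def negB (d j : ℕ) (A : Finset ℕ) (l : ℕ) : Prop :=
  (∃ x < d, blk j x = l ∧ x ∉ A) ∧ ∃ x ∈ A, blk j x = l + 1

noncomputable def Wm (d j : ℕ) : Finset (Finset ℕ) :=
  (range d).powerset.filter (fun A => ∃ l < j, posB d j A l ∨ negB d j A l)

lemma mem_Wm {d j : ℕ} {A : Finset ℕ} :
    A ∈ Wm d j ↔ A ⊆ range d ∧ ∃ l < j, posB d j A l ∨ negB d j A l := by simp [Wm]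

noncomputable def idx (d j : ℕ) (A : Finset ℕ) : ℕ :=
  if hA : ∃ l < j, posB d j A l ∨ negB d j A l then hA.choose else 0

lemma idx_spec {d j : ℕ} {A : Finset ℕ} (hA : ∃ l < j, posB d j A l ∨ negB d j A l) :
    idx d j A < j ∧ (posB d j A (idx d j A) ∨ negB d j A (idx d j A)) := by
  rw [idx, dif_pos hA]; exact hA.choose_spec

variable (K) in
noncomputable def hv (d j : ℕ) (n : ℕ) (l : Fin j) : K :=
  if idx d j (Function.invFun enc n) = l ∧ posB d j (Function.invFun enc n) l then 1 else 0

lemma hv_enc (d j : ℕ) (A : Finset ℕ) (l : Fin j) :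
    hv K d j (enc A) l = if idx d j A = l ∧ posB d j A l then 1 else 0 := by
  rw [hv, Function.leftInverse_invFun enc_inj A]

lemma pos_neg {d j l : ℕ} {A A' : Finset ℕ} (h : A ⊆ A' ∨ A' ⊆ A) (hp : posB d j A l)
    (hn : negB d j A' l) : False := by
  obtain ⟨h1, h2⟩ := hp
  obtain ⟨⟨x, hx, hxl, hxA⟩, ⟨y, hy, hyl⟩⟩ := hn
  rcases h with h | h
  · exact hxA (h (h1 x hx hxl))
  · exact h2 y (h hy) hyl

lemma dich (d j : ℕ) (S : Finset (Finset ℕ)) (hS : S ⊆ Wm d j) (t : Finset ℕ) (ht : t ∈ FC S) :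
    (∀ v ∈ t, ∃ l, hv K d j v = Pi.single l 1) ∨ ∃ l, ∀ v ∈ t, hv K d j v l = 0 := by
  obtain ⟨C, h1, h2, rfl⟩ := mem_FC.1 ht
  by_cases hn : ∃ A ∈ C, negB d j A (idx d j A)
  · right
    obtain ⟨A, hA, hneg⟩ := hn
    refine ⟨⟨idx d j A, (idx_spec (mem_Wm.1 (hS (h1 hA))).2).1⟩, ?_⟩
    intro v hv'
    obtain ⟨A', hA', rfl⟩ := Finset.mem_image.1 hv'
    rw [hv_enc, if_neg]
    rintro ⟨-, hp⟩
    exact pos_neg (h2 A' hA' A hA) hp hneg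
  · left
    push Not at hn
    intro v hv'
    obtain ⟨A, hA, rfl⟩ := Finset.mem_image.1 hv'
    have hs := idx_spec (mem_Wm.1 (hS (h1 hA))).2
    have hpos := hs.2.resolve_right (hn A hA)
    refine ⟨⟨idx d j A, hs.1⟩, ?_⟩
    ext l
    rw [hv_enc, Pi.single_apply]
    by_cases hl : idx d j A = l
    · rw [if_pos ⟨hl, hl ▸ hpos⟩, if_pos (Fin.ext hl.symm)]
    · rw [if_neg (fun h => hl h.1), if_neg (fun h => hl (by rw [h]))]

noncomputable def Ub (d j l : ℕ) : Finset ℕ := (range d).filter (fun x => blk j x ≤ l)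
noncomputable def Vb (d j l : ℕ) : Finset ℕ :=
  (range d).filter (fun x => blk j x < l ∨ x = l ∨ x + 1 = l)

lemma mem_Ub {d j l x : ℕ} : x ∈ Ub d j l ↔ x < d ∧ blk j x ≤ l := by simp [Ub]
lemma mem_Vb {d j l x : ℕ} : x ∈ Vb d j l ↔ x < d ∧ (blk j x < l ∨ x = l ∨ x + 1 = l) := by simp [Vb]

lemma blk_small {j x : ℕ} (h : x < j) : blk j x = x + 1 := Nat.mod_eq_of_lt (by omega)
lemma blk_add {j l : ℕ} (h : l < j) : blk j (l + j) = l := by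
  rw [blk, show l + j + 1 = l + (j + 1) by ring, Nat.add_mod_right]
  exact Nat.mod_eq_of_lt (by omega)

lemma Ub_pos {d j l : ℕ} : posB d j (Ub d j l) l :=
  ⟨fun x hx h => mem_Ub.2 ⟨hx, h.le⟩, fun x hx h => by have := (mem_Ub.1 hx).2; omega⟩

lemma Vb_neg {d j l : ℕ} (hd : 2 * j ≤ d) (hl : l < j) : negB d j (Vb d j l) l := by
  refine ⟨⟨l + j, by omega, blk_add hl, ?_⟩, ⟨l, ?_, blk_small hl⟩⟩
  · rw [mem_Vb, blk_add hl]; omega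
  · rw [mem_Vb]; omega

lemma Vb_not_pos {d j l m : ℕ} (hd : 2 * j ≤ d) (hl : l < j) (hm : m < j) :
    ¬ posB d j (Vb d j m) l := by
  rintro ⟨h1, h2⟩
  rcases le_or_gt l m with h | h
  · refine h2 l ?_ (blk_small hl)
    rw [mem_Vb, blk_small hl]; omega
  · have := h1 (l + j) (by omega) (blk_add hl)
    rw [mem_Vb, blk_add hl] at this; omega

lemma Ub_idx {d j l m : ℕ} (hd : 2 * j ≤ d) (hl : l < j) (hm : m < j)
    (h : posB d j (Ub d j l) m ∨ negB d j (Ub d j l) m) : m = l := by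
  by_contra hne
  rcases lt_or_gt_of_ne hne with hlt | hlt
  · rcases h with ⟨h1, h2⟩ | ⟨⟨x, hx, hxm, hxU⟩, -⟩
    · refine h2 m ?_ (blk_small hm)
      rw [mem_Ub, blk_small hm]; omega
    · exact hxU (mem_Ub.2 ⟨hx, by omega⟩)
  · rcases h with ⟨h1, h2⟩ | ⟨-, ⟨x, hx, hxm⟩⟩
    · have := h1 (m + j) (by omega) (blk_add hm)
      rw [mem_Ub, blk_add hm] at this; omega
    · have := (mem_Ub.1 hx).2; omega

lemma Ub_mem {d j l : ℕ} (hl : l < j) : Ub d j l ∈ Wm d j :=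
  mem_Wm.2 ⟨Finset.filter_subset _ _, l, hl, Or.inl Ub_pos⟩

lemma Vb_mem {d j l : ℕ} (hd : 2 * j ≤ d) (hl : l < j) : Vb d j l ∈ Wm d j :=
  mem_Wm.2 ⟨Finset.filter_subset _ _, l, hl, Or.inr (Vb_neg hd hl)⟩

lemma nest {d j : ℕ} (m l : ℕ) (hml : m < l) (hl : l < j) :
    Ub d j m ⊆ Ub d j l ∧ Ub d j m ⊆ Vb d j l ∧ Vb d j m ⊆ Ub d j l ∧ Vb d j m ⊆ Vb d j l := by
  have hV : ∀ x, x ∈ Vb d j m → x < d ∧ (blk j x < l ∨ blk j x = l ∧ x + 1 = l) := by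
    intro x hx
    rw [mem_Vb] at hx
    refine ⟨hx.1, ?_⟩
    rcases hx.2 with h | h | h
    · left; omega
    · rw [blk_small (by omega : x < j)]; omega
    · rw [blk_small (by omega : x < j)]; omega
  refine ⟨fun x hx => ?_, fun x hx => ?_, fun x hx => ?_, fun x hx => ?_⟩
  · rw [mem_Ub] at *; omega
  · rw [mem_Ub] at hx; rw [mem_Vb]; omega
  · have := hV x hx; rw [mem_Ub]; omega
  · have := hV x hx; rw [mem_Vb]; omega

lemma nonvanish {d j : ℕ} (hd : 2 * j ≤ d) (S : Finset (Finset ℕ)) (hS : S ⊆ Wm d j)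
    (hU : ∀ l < j, Ub d j l ∈ S) (hV : ∀ l < j, Vb d j l ∈ S) : ¬ AcV K S j := by
  refine not_Ac (hv K d j) (FC S) j rfl (dich d j S hS)
    (zc K (fun l => enc (Ub d j l)) (fun l => enc (Vb d j l)) j) ?_ (zc_bdry _ _ _) ?_
  · exact facesSpan_mono K (FC_mono (Finset.filter_subset _ _)) _
      (zc_mem (Ub d j) (Vb d j) S j hU hV nest j le_rfl)
  · apply phi_zc
    · intro l
      ext m
      have hs := idx_spec (mem_Wm.1 (Ub_mem (d := d) l.2)).2
      have hi := Ub_idx hd l.2 hs.1 hs.2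
      rw [hv_enc, Pi.single_apply, hi]
      by_cases hm : m = l
      · subst hm; rw [if_pos ⟨rfl, Ub_pos⟩, if_pos rfl]
      · rw [if_neg (fun h => hm (Fin.ext h.1.symm)), if_neg hm]
    · intro m hm
      ext l
      rw [hv_enc, if_neg (fun h => Vb_not_pos hd l.2 hm h.2)]
      rfl


/-! counting -/

noncomputable def Bk (d j l : ℕ) : Finset ℕ := (range d).filter (fun x => blk j x = l)

lemma mem_Bk {d j l x : ℕ} : x ∈ Bk d j l ↔ x < d ∧ blk j x = l := by simp [Bk]

lemma blk_lt (j x : ℕ) : blk j x < j + 1 := Nat.mod_lt _ (by omega)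

lemma Bk_succ (d j l : ℕ) : (Bk (d + 1) j l).card = (Bk d j l).card + if blk j d = l then 1 else 0 := by
  rw [Bk, Finset.range_add_one, Finset.filter_insert]
  split_ifs with h
  · rw [Finset.card_insert_of_notMem (by simp)]; rfl
  · rfl

lemma divmod_succ (d e : ℕ) (he : 0 < e) :
    (d % e + 1 < e ∧ (d + 1) / e = d / e ∧ (d + 1) % e = d % e + 1) ∨
    (d % e + 1 = e ∧ (d + 1) / e = d / e + 1 ∧ (d + 1) % e = 0) := by
  have h1 := Nat.mod_lt d he
  have h2 := Nat.div_add_mod d e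
  rcases Nat.lt_or_ge (d % e + 1) e with h | h
  · left
    have := (Nat.div_mod_unique (a := d + 1) (b := e) (c := d % e + 1) (d := d / e) he).2
      ⟨by omega, h⟩
    exact ⟨h, this⟩
  · right
    have h3 : e * (d / e + 1) = e * (d / e) + e := by ring
    have := (Nat.div_mod_unique (a := d + 1) (b := e) (c := 0) (d := d / e + 1) he).2
      ⟨by omega, he⟩
    exact ⟨by omega, this⟩

lemma Bk_card (d j l : ℕ) (hl : l < j + 1) :
    (Bk d j l).card = d / (j + 1) + if 1 ≤ l ∧ l ≤ d % (j + 1) then 1 else 0 := by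
  induction d with
  | zero =>
    rw [if_neg (by rw [Nat.zero_mod]; omega)]
    simp [Bk]
  | succ d ih =>
    rw [Bk_succ, ih, blk]
    rcases divmod_succ d (j + 1) (by omega) with ⟨h1, h2, h3⟩ | ⟨h1, h2, h3⟩
    · rw [h2, h3]; split_ifs <;> omega
    · rw [h2, h3]; split_ifs <;> omega

lemma sum_Bk (d j : ℕ) : ∑ l ∈ range (j + 1), 2 ^ (Bk d j l).card
    = 2 ^ (d / (j + 1)) * ((j + 1) + d % (j + 1)) := by
  have hc := Nat.mod_lt d (show 0 < j + 1 by omega)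
  have h1 : ∀ l ∈ range (j + 1), 2 ^ (Bk d j l).card
      = 2 ^ (d / (j + 1)) * (1 + if l ∈ Finset.Icc 1 (d % (j + 1)) then 1 else 0) := by
    intro l hl
    rw [Bk_card d j l (Finset.mem_range.1 hl), pow_add]
    simp only [Finset.mem_Icc]
    split_ifs <;> simp
  rw [Finset.sum_congr rfl h1, ← Finset.mul_sum, Finset.sum_add_distrib]
  congr 1
  rw [← Finset.card_filter]
  have : (range (j + 1)).filter (fun l => l ∈ Finset.Icc 1 (d % (j + 1))) = Finset.Icc 1 (d % (j + 1)) := by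
    ext l; simp only [Finset.mem_filter, Finset.mem_range, Finset.mem_Icc]; omega
  rw [this]; simp

noncomputable def Zm (d j : ℕ) : Finset (Finset ℕ) := (range d).powerset \ Wm d j

noncomputable def Zc (d j l : ℕ) : Finset (Finset ℕ) :=
  (((Bk d j l).powerset.erase ∅).erase (Bk d j l)).image
    (fun X => (range d).filter (fun x => blk j x < l) ∪ X)

lemma Zm_sub (d j : ℕ) (hjd : j + 1 ≤ d) : Zm d j ⊆
    insert ∅ (insert (range d) ((range (j + 1)).biUnion (Zc d j))) := by
  intro A hA
  rw [Zm, Finset.mem_sdiff, Finset.mem_powerset, mem_Wm] at hA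
  obtain ⟨hAd, hA⟩ := hA
  rw [Finset.mem_insert, Finset.mem_insert]
  by_cases h0 : A = ∅
  · exact Or.inl h0
  by_cases h1 : A = range d
  · exact Or.inr (Or.inl h1)
  right; right
  have hex : ∃ l, ∃ x < d, blk j x = l ∧ x ∉ A := by
    by_contra hcon
    push Not at hcon
    apply h1
    refine Finset.Subset.antisymm hAd fun x hx => ?_
    exact hcon (blk j x) x (Finset.mem_range.1 hx) rfl
  have hP : ∀ l < j, ((∀ x < d, blk j x = l → x ∈ A) → ∃ x ∈ A, blk j x = l + 1) ∧
      ((∃ x < d, blk j x = l ∧ x ∉ A) → ∀ x ∈ A, blk j x ≠ l + 1) := by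
    intro l hl
    constructor
    · intro h
      by_contra hcon
      push Not at hcon
      exact hA ⟨hAd, l, hl, Or.inl ⟨h, hcon⟩⟩
    · intro h x hx hxl
      exact hA ⟨hAd, l, hl, Or.inr ⟨h, x, hx, hxl⟩⟩
  obtain ⟨x0, hx0, hxl, hxA⟩ := Nat.find_spec hex
  have hmin : ∀ m < Nat.find hex, ∀ x < d, blk j x = m → x ∈ A := by
    intro m hm x hx hxm
    by_contra hcon
    exact Nat.find_min hex hm ⟨x, hx, hxm, hcon⟩
  generalize Nat.find hex = l at hxl hmin
  have hl : l < j + 1 := hxl ▸ blk_lt j x0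
  have hlater : ∀ k, l + k < j → ∀ x ∈ A, blk j x ≠ l + k + 1 := by
    intro k
    induction k with
    | zero => intro hk; exact (hP l hk).2 ⟨x0, hx0, hxl, hxA⟩
    | succ k ih =>
      intro hk
      have ih := ih (by omega)
      refine (hP (l + k + 1) (by omega)).2 ⟨l + k, by omega, blk_small (by omega), ?_⟩
      intro hmem
      exact ih _ hmem (blk_small (by omega))
  have hle : ∀ x ∈ A, blk j x ≤ l := by
    intro x hx
    by_contra hcon
    have h2 := blk_lt j x
    exact hlater (blk j x - l - 1) (by omega) x hx (by omega)
  have hne : ∃ x ∈ A, blk j x = l := by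
    rcases l with _ | l
    · obtain ⟨x, hx⟩ := Finset.nonempty_iff_ne_empty.2 h0
      exact ⟨x, hx, by have := hle x hx; omega⟩
    · exact (hP l (by omega)).1 (hmin l (by omega))
  rw [Finset.mem_biUnion]
  refine ⟨l, Finset.mem_range.2 hl, ?_⟩
  rw [Zc, Finset.mem_image]
  refine ⟨A ∩ Bk d j l, ?_, ?_⟩
  · rw [Finset.mem_erase, Finset.mem_erase, Finset.mem_powerset]
    refine ⟨?_, ?_, Finset.inter_subset_right⟩
    · intro h
      have : x0 ∈ A ∩ Bk d j l := by rw [h]; exact mem_Bk.2 ⟨hx0, hxl⟩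
      exact hxA (Finset.mem_inter.1 this).1
    · obtain ⟨x, hx, hxb⟩ := hne
      exact Finset.ne_empty_of_mem (Finset.mem_inter.2 ⟨hx, mem_Bk.2 ⟨Finset.mem_range.1 (hAd hx), hxb⟩⟩)
  · ext x
    simp only [Finset.mem_union, Finset.mem_filter, Finset.mem_inter, mem_Bk, Finset.mem_range]
    constructor
    · rintro (⟨h2, h3⟩ | h2)
      · exact hmin _ h3 x h2 rfl
      · exact h2.1
    · intro hx
      have h2 := Finset.mem_range.1 (hAd hx)
      rcases (hle x hx).lt_or_eq with h3 | h3
      · exact Or.inl ⟨h2, h3⟩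
      · exact Or.inr ⟨hx, h2, h3⟩

lemma Zc_card (d j l : ℕ) (hjd : j + 1 ≤ d) (hl : l < j + 1) :
    (Zc d j l).card + 2 ≤ 2 ^ (Bk d j l).card := by
  have hne : Bk d j l ≠ ∅ := by
    rcases l with _ | l
    · exact Finset.ne_empty_of_mem (mem_Bk.2 ⟨(by omega : j < d), by simp [blk]⟩)
    · exact Finset.ne_empty_of_mem (mem_Bk.2 ⟨(by omega : l < d), blk_small (by omega)⟩)
  have h1 : (Zc d j l).card ≤ _ := Finset.card_image_le
  rw [Finset.card_erase_of_mem (Finset.mem_erase.2 ⟨hne, Finset.mem_powerset_self _⟩),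
    Finset.card_erase_of_mem (Finset.empty_mem_powerset _), Finset.card_powerset] at h1
  have h2 : 2 ^ 1 ≤ 2 ^ (Bk d j l).card := Nat.pow_le_pow_right (by omega)
    (Finset.card_pos.2 (Finset.nonempty_iff_ne_empty.2 hne))
  omega

lemma Zm_card (d j : ℕ) (hjd : j + 1 ≤ d) :
    (Zm d j).card + 2 * (j + 1) ≤ 2 + 2 ^ (d / (j + 1)) * ((j + 1) + d % (j + 1)) := by
  have h1 := Finset.card_le_card (Zm_sub d j hjd)
  have h2 := Finset.card_insert_le ∅ (insert (range d) ((range (j + 1)).biUnion (Zc d j)))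
  have h3 := Finset.card_insert_le (range d) ((range (j + 1)).biUnion (Zc d j))
  have h4 : ((range (j + 1)).biUnion (Zc d j)).card ≤ _ := Finset.card_biUnion_le
  have h5 : ∑ l ∈ range (j + 1), ((Zc d j l).card + 2) ≤ ∑ l ∈ range (j + 1), 2 ^ (Bk d j l).card :=
    Finset.sum_le_sum fun l hl => Zc_card d j l hjd (Finset.mem_range.1 hl)
  rw [Finset.sum_add_distrib, Finset.sum_const, Finset.card_range, smul_eq_mul, sum_Bk] at h5
  omega

lemma Wm_card (d j : ℕ) : (Wm d j).card + (Zm d j).card = 2 ^ d := by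
  have : Wm d j ⊆ (range d).powerset := fun x hx => Finset.mem_powerset.2 (mem_Wm.1 hx).1
  rw [Zm, add_comm, Finset.card_sdiff_add_card_eq_card this, Finset.card_powerset, Finset.card_range]

lemma mj_eq (d e : ℕ) (he : 1 ≤ e) (hed : e ≤ d) :
    mj d (d - e) + (d - e) + 2 * e = 2 ^ (d / e) * (e + d % e) := by
  have hc := Nat.mod_lt d he
  have hq := Nat.div_add_mod d e
  have hsub : d - (d - e) = e := by omega
  have hq1 : 1 ≤ d / e := (Nat.one_le_div_iff he).2 hed
  rw [mj, hsub]
  split_ifs with h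
  · have h2 : d / e ≤ 2 := by
      by_contra hcon
      have : e * 3 ≤ e * (d / e) := Nat.mul_le_mul_left _ (by omega)
      omega
    generalize hqq : d / e = q at *
    generalize hcc : d % e = c at *
    obtain rfl | rfl : q = 1 ∨ q = 2 := by omega
    · omega
    · omega
  · have e1 : 2 * (d - e) - d = d - 2 * e := by omega
    have e2 : (d - 2 * e) / e + 2 = d / e := by
      rw [← Nat.add_mul_div_left _ _ he]; congr 1; omega
    have e3 : (d - 2 * e) % e = d % e := by
      rw [← Nat.add_mul_mod_self_right (d - 2 * e) 2 e]; congr 1; omega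
    rw [e1, e2, e3, add_comm (d % e) e]
    have h5 : d / e + 1 ≤ 2 ^ (d / e) := Nat.lt_two_pow_self
    have h6 : (d / e + 1) * (e + d % e) ≤ 2 ^ (d / e) * (e + d % e) := Nat.mul_le_mul_right _ h5
    have h7 : (d / e + 1) * (e + d % e) = e * (d / e) + e + d % e + (d / e) * (d % e) := by ring
    omega

/-! assembly -/

lemma vertexSet_FC (V : Finset (Finset ℕ)) : vertexSet (FC V) = V.image enc := by
  ext x
  rw [vertexSet, Finset.mem_sup, Finset.mem_image]
  constructor
  · rintro ⟨s, hs, hx⟩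
    obtain ⟨C, h1, h2, rfl⟩ := mem_FC.1 hs
    obtain ⟨y, hy, rfl⟩ := Finset.mem_image.1 hx
    exact ⟨y, h1 hy, rfl⟩
  · rintro ⟨y, hy, rfl⟩
    refine ⟨({y} : Finset (Finset ℕ)).image enc, mem_FC'.2 ⟨by simpa using hy, ?_⟩, by simp⟩
    intro s hs t ht
    rw [Finset.mem_singleton] at hs ht
    subst hs ht
    exact Or.inl le_rfl

lemma induced_FC (V S : Finset (Finset ℕ)) (h : S ⊆ V) :
    inducedSC (FC V) (S.image enc) = FC S := by
  ext s
  rw [inducedSC, Finset.mem_filter]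
  constructor
  · rintro ⟨hs, hsub⟩
    obtain ⟨C, h1, h2, rfl⟩ := mem_FC.1 hs
    exact mem_FC'.2 ⟨(Finset.image_subset_image_iff enc_inj).1 hsub, h2⟩
  · intro hs
    obtain ⟨C, h1, h2, rfl⟩ := mem_FC.1 hs
    exact ⟨mem_FC'.2 ⟨h1.trans h, h2⟩, Finset.image_subset_image h1⟩

lemma betti_zero (V : Finset (Finset ℕ)) (i j : ℕ)
    (h : ∀ S ⊆ V, S.card = i + j → AcV K S j) : bettiSR K (FC V) i (i + j) = 0 := by
  rw [bettiSR]
  apply Finset.sum_eq_zero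
  intro W hW
  rw [Finset.mem_filter, Finset.mem_powerset, vertexSet_FC, Finset.subset_image_iff] at hW
  obtain ⟨⟨S, hS, rfl⟩, hc⟩ := hW
  have hS : S ⊆ V := by exact_mod_cast hS
  rw [Finset.card_image_of_injective _ enc_inj] at hc
  rw [induced_FC V S hS, show (((i + j : ℕ) : ℤ) - i) = j by push_cast; ring]
  exact redH_zero (h S hS hc)

lemma betti_ne (V : Finset (Finset ℕ)) (i j : ℕ) (S : Finset (Finset ℕ)) (hS : S ⊆ V)
    (hc : S.card = i + j) (h : ¬ AcV K S j) : bettiSR K (FC V) i (i + j) ≠ 0 := by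
  rw [bettiSR]
  intro h0
  rw [Finset.sum_eq_zero_iff] at h0
  have := h0 (S.image enc) (by
    rw [Finset.mem_filter, Finset.mem_powerset, vertexSet_FC,
      Finset.card_image_of_injective _ enc_inj]
    exact ⟨Finset.image_subset_image hS, hc⟩)
  rw [induced_FC V S hS, show (((i + j : ℕ) : ℤ) - i) = j by push_cast; ring] at this
  exact redH_ne h this

lemma mem_V {d : ℕ} {x : Finset ℕ} : x ∈ (simplexC d).erase ∅ ↔ x ≠ ∅ ∧ x ⊆ range d := by
  simp [simplexC]

lemma part1 (d i j : ℕ) (hj : 1 ≤ j) (hi : i ≤ j - 1) : bettiSR K (sd (simplexC d)) i (i + j) = 0 := by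
  refine betti_zero ((simplexC d).erase ∅) i j fun S hS hc => ?_
  exact few_vertices (i + j) S j (by omega) (by omega)

lemma part3 (d i j : ℕ) (hd : 1 ≤ d) (hjd : 2 * j ≤ d) (hi : 2 ^ d - 2 * d + j < i) :
    bettiSR K (sd (simplexC d)) i (i + j) = 0 := by
  refine betti_zero ((simplexC d).erase ∅) i j fun S hS hc => ?_
  by_cases hr : range d ∈ S
  · exact AcV_cone j (range d) hr fun x hx => Or.inl (mem_V.1 (hS hx)).2
  · have hSP : S ⊆ Pd d := fun x hx => mem_Pd.2 ⟨(mem_V.1 (hS hx)).2, (mem_V.1 (hS hx)).1,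
      fun h => hr (h ▸ hx)⟩
    have hlk : lkF d ∅ = Pd d := by ext x; simp [mem_lkF]
    have hPc : (Pd d).card + 2 = 2 ^ d := by
      have : Pd d = ((range d).powerset.erase ∅).erase (range d) := by
        ext x; simp only [mem_Pd, Finset.mem_erase, Finset.mem_powerset]; tauto
      have h2 : 2 ^ 1 ≤ 2 ^ d := Nat.pow_le_pow_right (by omega) hd
      rw [this, Finset.card_erase_of_mem, Finset.card_erase_of_mem (Finset.empty_mem_powerset _),
        Finset.card_powerset, Finset.card_range]
      · omega
      · rw [Finset.mem_erase]
        exact ⟨Finset.ne_empty_of_mem (Finset.mem_range.2 (show 0 < d by omega)),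
          Finset.mem_powerset_self _⟩
    have h1 := Finset.card_sdiff_add_card_eq_card hSP
    have := lkF_few (K := K) d (Pd d).card ∅ (Pd d \ S) (by intro s hs; simp at hs) (by simp)
      (by rw [hlk]; exact Finset.sdiff_subset) (Finset.card_le_card Finset.sdiff_subset) j
      (by simp only [Finset.card_empty]; omega)
    rwa [hlk, Finset.sdiff_sdiff_eq_self hSP] at this

lemma part2 (d i j : ℕ) (hj : 1 ≤ j) (hjd : 2 * j ≤ d) (hji : j ≤ i)
    (hi : i ≤ 2 ^ d - d - 1 - mj d (d - j - 1)) : bettiSR K (sd (simplexC d)) i (i + j) ≠ 0 := by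
  have hm := mj_eq d (j + 1) (by omega) (by omega)
  have hz := Zm_card d j (by omega)
  have hw := Wm_card d j
  rw [show d - (j + 1) = d - j - 1 by omega] at hm
  have hcard : i + j ≤ (Wm d j).card := by omega
  let P := (range j).image (Ub d j) ∪ (range j).image (Vb d j)
  have hP : P.card ≤ i + j := by
    have h1 := Finset.card_union_le ((range j).image (Ub d j)) ((range j).image (Vb d j))
    have h2 := Finset.card_image_le (s := range j) (f := Ub d j)
    have h3 := Finset.card_image_le (s := range j) (f := Vb d j)
    rw [Finset.card_range] at h2 h3
    have : P.card ≤ j + j := h1.trans (by omega)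
    omega
  have hPW : P ⊆ Wm d j := by
    apply Finset.union_subset
    · intro x hx
      obtain ⟨l, hl, rfl⟩ := Finset.mem_image.1 hx
      exact Ub_mem (Finset.mem_range.1 hl)
    · intro x hx
      obtain ⟨l, hl, rfl⟩ := Finset.mem_image.1 hx
      exact Vb_mem hjd (Finset.mem_range.1 hl)
  obtain ⟨S, hPS, hSW, hSc⟩ := Finset.exists_subsuperset_card_eq hPW hP hcard
  refine betti_ne ((simplexC d).erase ∅) i j S ?_ hSc ?_
  · intro x hx
    obtain ⟨h1, l, hl, h2⟩ := mem_Wm.1 (hSW hx)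
    refine mem_V.2 ⟨?_, h1⟩
    rintro rfl
    rcases h2 with h2 | h2
    · have := h2.1 (l + j) (by omega) (blk_add hl)
      simp at this
    · obtain ⟨y, hy, _⟩ := h2.2
      simp at hy
  · refine nonvanish hjd S hSW (fun l hl => hPS ?_) (fun l hl => hPS ?_)
    · exact Finset.mem_union_left _ (Finset.mem_image_of_mem _ (Finset.mem_range.2 hl))
    · exact Finset.mem_union_right _ (Finset.mem_image_of_mem _ (Finset.mem_range.2 hl))


end
end SdProof

/-- For `1 ≤ j ≤ d/2` the `j`-th linear strand of the minimal free
resolution of `K[sd(Δ_{d-1})]`: `β_{i,i+j} = 0` for `0 ≤ i ≤ j-1`, `β_{i,i+j} ≠ 0` for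
`j ≤ i ≤ 2^d - d - 1 - m_{d-j-1}(d)`, and `β_{i,i+j} = 0` for
`2^d - 2d + j < i ≤ 2^d - d - 1`. -/
theorem statement_0 (K : Type*) [Field K] (d j : ℕ) (hd : 1 ≤ d) (hj1 : 1 ≤ j)
    (hj2 : 2 * j ≤ d) :
    (∀ i : ℕ, i ≤ j - 1 → bettiSR K (sd (simplexC d)) i (i + j) = 0) ∧
    (∀ i : ℕ, j ≤ i → i ≤ 2 ^ d - d - 1 - mj d (d - j - 1) →
      bettiSR K (sd (simplexC d)) i (i + j) ≠ 0) ∧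
    (∀ i : ℕ, 2 ^ d - 2 * d + j < i → i ≤ 2 ^ d - d - 1 →
      bettiSR K (sd (simplexC d)) i (i + j) = 0) := by
  
  exact ⟨fun i hi => SdProof.part1 d i j hj1 hi, fun i h1 h2 => SdProof.part2 d i j hj1 hj2 h1 h2,
    fun i h1 _ => SdProof.part3 d i j hd hj2 h1⟩
end

section
/- Let d ≥ 1 and let j be an integer with d/2 < j ≤ d-2. Then the graded Betti numbers of the Stanley-Reisner ring of the barycentric subdivision of the (d-1)-simplex satisfy: β_{i,i+j}(K[sd(Δ_{d-1})]) = 0 for 0 ≤ i ≤ j-1; β_{i,i+j}(K[sd(Δ_{d-1})]) ≠ 0 for every integer i with m_j(d) ≤ i ≤ 2^d - 2d + j; and β_{i,i+j}(K[sd(Δ_{d-1})]) = 0 for 2^d - 2d + j < i ≤ 2^d - d - 1. -/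
open Finset BigOperators

noncomputable section
open scoped Classical

def decS (n : ℕ) : Finset ℕ := (Encodable.decode n).getD ∅

theorem decS_enc (s : Finset ℕ) : decS (enc s) = s := by simp [decS, enc]

theorem enc_inj : Function.Injective enc := Encodable.encode_injective

def RR (a b : ℕ) : Prop := decS a ⊆ decS b ∨ decS b ⊆ decS a

theorem RR_symm {a b : ℕ} (h : RR a b) : RR b a := Or.symm h
theorem RR_refl (a : ℕ) : RR a a := Or.inl (Finset.Subset.refl _)

def flagC (W : Finset ℕ) : SC := W.powerset.filter (fun s => ∀ a ∈ s, ∀ b ∈ s, RR a b)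

theorem mem_flagC {W s : Finset ℕ} : s ∈ flagC W ↔ s ⊆ W ∧ ∀ a ∈ s, ∀ b ∈ s, RR a b := by
  simp [flagC]

def lkN (W : Finset ℕ) (v : ℕ) : Finset ℕ := W.filter (fun w => w ≠ v ∧ RR v w)

variable (K : Type*) [Field K]

theorem mem_facesSpan (Δ : SC) (n : ℤ) (c : Finset ℕ →₀ K) :
    c ∈ facesSpan K Δ n ↔ ∀ s, c s ≠ 0 → s ∈ Δ ∧ (s.card : ℤ) = n := by
  unfold facesSpan
  rw [← Finsupp.supported_eq_span_single, Finsupp.mem_supported]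
  simp [Set.subset_def]

theorem single_mem_facesSpan {Δ : SC} {n : ℤ} {s : Finset ℕ} (h : s ∈ Δ) (h2 : (s.card : ℤ) = n) :
    Finsupp.single s (1 : K) ∈ facesSpan K Δ n :=
  Submodule.subset_span ⟨s, ⟨h, h2⟩, rfl⟩

theorem facesSpan_mono {Δ Δ' : SC} (h : Δ ⊆ Δ') (n : ℤ) : facesSpan K Δ n ≤ facesSpan K Δ' n := by
  apply Submodule.span_mono
  apply Set.image_mono
  rintro s ⟨a, b⟩
  exact ⟨h a, b⟩

theorem bdry_single (s : Finset ℕ) : bdry K (Finsupp.single s 1) = bdryFace K s := by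
  simp [bdry]

def sg (v : ℕ) (s : Finset ℕ) : K := (-1 : K) ^ ((s.filter (fun w => w < v)).card)

theorem sg_mul_self (v : ℕ) (s : Finset ℕ) : sg K v s * sg K v s = 1 := by
  unfold sg; rw [← pow_add, ← two_mul, pow_mul]; simp

theorem bdryFace_eq (s : Finset ℕ) : bdryFace K s = ∑ v ∈ s, sg K v s • Finsupp.single (s.erase v) (1 : K) := rfl

def coneF (v : ℕ) (s : Finset ℕ) : Finset ℕ →₀ K :=
  if v ∈ s then 0 else sg K v s • Finsupp.single (insert v s) (1 : K)

def cone (v : ℕ) : (Finset ℕ →₀ K) →ₗ[K] (Finset ℕ →₀ K) :=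
  Finsupp.lsum K fun s => LinearMap.toSpanSingleton K (Finset ℕ →₀ K) (coneF K v s)

theorem cone_single (v : ℕ) (s : Finset ℕ) : cone K v (Finsupp.single s 1) = coneF K v s := by
  simp [cone]

def Av (v : ℕ) : Submodule K (Finset ℕ →₀ K) :=
  Submodule.span K ((fun s => Finsupp.single s (1 : K)) '' {s | v ∉ s})
def Hv (v : ℕ) : Submodule K (Finset ℕ →₀ K) :=
  Submodule.span K ((fun s => Finsupp.single s (1 : K)) '' {s | v ∈ s})

theorem single_mem_Av {v : ℕ} {s : Finset ℕ} (h : v ∉ s) : Finsupp.single s (1 : K) ∈ Av K v :=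
  Submodule.subset_span ⟨s, h, rfl⟩

theorem Av_Hv {v : ℕ} {x : Finset ℕ →₀ K} (h1 : x ∈ Av K v) (h2 : x ∈ Hv K v) : x = 0 := by
  unfold Av at h1; unfold Hv at h2
  rw [← Finsupp.supported_eq_span_single, Finsupp.mem_supported] at h1 h2
  ext s
  by_contra h
  have hs : s ∈ (x.support : Set (Finset ℕ)) := by simpa using h
  exact (h1 hs) (h2 hs)

theorem cone_mem_Hv (v : ℕ) (x : Finset ℕ →₀ K) : cone K v x ∈ Hv K v := by
  induction x using Finsupp.induction_linear with
  | zero => simp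
  | add f g hf hg => rw [map_add]; exact add_mem hf hg
  | single s a =>
    have : Finsupp.single s a = a • Finsupp.single s (1 : K) := by simp
    rw [this, map_smul, cone_single]
    refine Submodule.smul_mem _ _ ?_
    unfold coneF
    split_ifs
    · simp
    · exact Submodule.smul_mem _ _ (Submodule.subset_span ⟨_, by simp, rfl⟩)

theorem sg_rel {v u : ℕ} {s : Finset ℕ} (hv : v ∉ s) (hu : u ∈ s) :
    sg K v s * sg K u (insert v s) = - (sg K u s * sg K v (s.erase u)) := by
  have hne : u ≠ v := fun h => hv (h ▸ hu)
  unfold sg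
  rcases lt_or_gt_of_ne hne with h | h
  · have e1 : (insert v s).filter (fun w => w < u) = s.filter (fun w => w < u) := by
      rw [Finset.filter_insert, if_neg (by omega)]
    have e2 : (s.erase u).filter (fun w => w < v) = (s.filter (fun w => w < v)).erase u := by
      rw [Finset.filter_erase]
    have hm : u ∈ s.filter (fun w => w < v) := by simp [hu, h]
    have e3 := Finset.card_erase_add_one hm
    rw [e1, e2, ← e3, pow_succ]; ring
  · have e1 : (insert v s).filter (fun w => w < u) = insert v (s.filter (fun w => w < u)) := by
      rw [Finset.filter_insert, if_pos h]
    have e2 : (s.erase u).filter (fun w => w < v) = s.filter (fun w => w < v) := by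
      rw [Finset.filter_erase, Finset.erase_eq_of_notMem]; simp; omega
    rw [e1, e2, Finset.card_insert_of_notMem (by simp [hv]), pow_succ]; ring

theorem sg_insert_self (v : ℕ) (s : Finset ℕ) : sg K v (insert v s) = sg K v s := by
  unfold sg; rw [Finset.filter_insert, if_neg (by omega)]

theorem bdry_cone_single {v : ℕ} {s : Finset ℕ} (hv : v ∉ s) :
    bdry K (cone K v (Finsupp.single s 1)) =
      Finsupp.single s 1 - cone K v (bdry K (Finsupp.single s 1)) := by
  rw [cone_single, bdry_single, coneF, if_neg hv, map_smul, bdry_single, bdryFace_eq, bdryFace_eq,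
    Finset.sum_insert hv, smul_add, Finset.erase_insert hv, smul_smul, sg_insert_self, sg_mul_self,
    one_smul, sub_eq_add_neg]
  congr 1
  rw [map_sum, Finset.smul_sum, ← Finset.sum_neg_distrib]
  refine Finset.sum_congr rfl fun u hu => ?_
  have hne : u ≠ v := fun h => hv (h ▸ hu)
  rw [map_smul, cone_single, coneF, if_neg (by simp [hv]), smul_smul, smul_smul, sg_rel K hv hu,
    Finset.erase_insert_of_ne hne.symm, neg_smul]

theorem bdry_cone {v : ℕ} {x : Finset ℕ →₀ K} (hx : x ∈ Av K v) :
    bdry K (cone K v x) = x - cone K v (bdry K x) := by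
  unfold Av at hx
  induction hx using Submodule.span_induction with
  | mem x h => obtain ⟨s, hs, rfl⟩ := h; exact bdry_cone_single K hs
  | zero => simp
  | add x y _ _ hx hy => simp only [map_add, hx, hy]; abel
  | smul a x _ hx => simp only [map_smul, hx, smul_sub]

theorem bdry_mem_Av {v : ℕ} {x : Finset ℕ →₀ K} (hx : x ∈ Av K v) : bdry K x ∈ Av K v := by
  unfold Av at hx
  induction hx using Submodule.span_induction with
  | mem x h =>
    obtain ⟨s, hs, rfl⟩ := h
    simp only [bdry_single, bdryFace_eq]
    exact Submodule.sum_mem _ fun u _ => Submodule.smul_mem _ _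
      (single_mem_Av K (fun h => hs (Finset.mem_of_mem_erase h)))
  | zero => simp
  | add x y _ _ hx hy => rw [map_add]; exact add_mem hx hy
  | smul a x _ hx => rw [map_smul]; exact Submodule.smul_mem _ _ hx

theorem bdry_bdry_single (s : Finset ℕ) : bdry K (bdry K (Finsupp.single s 1)) = 0 := by
  induction s using Finset.induction_on with
  | empty => simp [bdry_single, bdryFace]
  | insert v t hv ih =>
    have h1 : Finsupp.single (insert v t) (1 : K) = sg K v t • cone K v (Finsupp.single t 1) := by
      rw [cone_single, coneF, if_neg hv, smul_smul, sg_mul_self, one_smul]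
    have ht := single_mem_Av K hv
    rw [h1, map_smul, map_smul, bdry_cone K ht, map_sub, bdry_cone K (bdry_mem_Av K ht), ih]
    simp

theorem bdry_bdry (x : Finset ℕ →₀ K) : bdry K (bdry K x) = 0 := by
  induction x using Finsupp.induction_linear with
  | zero => simp
  | add f g hf hg => simp [hf, hg]
  | single s a =>
    have : Finsupp.single s a = a • Finsupp.single s (1 : K) := by simp
    rw [this, map_smul, map_smul, bdry_bdry_single, smul_zero]

theorem flagC_mono {W W' : Finset ℕ} (h : W ⊆ W') : flagC W ⊆ flagC W' := by
  intro s hs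
  rw [mem_flagC] at *
  exact ⟨hs.1.trans h, hs.2⟩

abbrev CC (W : Finset ℕ) (n : ℤ) := facesSpan K (flagC W) n

theorem CC_mono {W W' : Finset ℕ} (h : W ⊆ W') (n : ℤ) : CC K W n ≤ CC K W' n :=
  facesSpan_mono K (flagC_mono h) n

theorem CC_le_Av {W : Finset ℕ} {v : ℕ} (h : v ∉ W) (n : ℤ) : CC K W n ≤ Av K v := by
  apply Submodule.span_mono
  apply Set.image_mono
  rintro s ⟨a, b⟩ hv
  exact h ((mem_flagC.1 a).1 hv)

theorem bdry_CC {W : Finset ℕ} {n : ℤ} {x : Finset ℕ →₀ K} (hx : x ∈ CC K W (n + 1)) :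
    bdry K x ∈ CC K W n := by
  unfold CC facesSpan at hx
  induction hx using Submodule.span_induction with
  | mem x h =>
    obtain ⟨s, ⟨hs, hc⟩, rfl⟩ := h
    simp only [bdry_single, bdryFace_eq]
    refine Submodule.sum_mem _ fun u hu => Submodule.smul_mem _ _ (single_mem_facesSpan K ?_ ?_)
    · rw [mem_flagC] at *
      exact ⟨(Finset.erase_subset _ _).trans hs.1, fun a ha b hb =>
        hs.2 a (Finset.mem_of_mem_erase ha) b (Finset.mem_of_mem_erase hb)⟩
    · have := Finset.card_erase_add_one hu
      omega
  | zero => simp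
  | add x y _ _ hx hy => rw [map_add]; exact add_mem hx hy
  | smul a x _ hx => rw [map_smul]; exact Submodule.smul_mem _ _ hx

theorem cone_CC {W U : Finset ℕ} {v : ℕ} {n : ℤ} (hv : v ∈ W) (hU : U ⊆ W)
    (hr : ∀ w ∈ U, RR v w) {x : Finset ℕ →₀ K} (hx : x ∈ CC K U n) :
    cone K v x ∈ CC K W (n + 1) := by
  unfold CC facesSpan at hx
  induction hx using Submodule.span_induction with
  | mem x h =>
    obtain ⟨s, ⟨hs, hc⟩, rfl⟩ := h
    simp only [cone_single, coneF]
    split_ifs with hvs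
    · simp
    refine Submodule.smul_mem _ _ (single_mem_facesSpan K ?_ ?_)
    · rw [mem_flagC] at *
      refine ⟨Finset.insert_subset hv (hs.1.trans hU), fun a ha b hb => ?_⟩
      rcases Finset.mem_insert.1 ha with h1 | h1
      · rcases Finset.mem_insert.1 hb with h2 | h2
        · rw [h1, h2]; exact RR_refl _
        · rw [h1]; exact hr _ (hs.1 h2)
      · rcases Finset.mem_insert.1 hb with h2 | h2
        · rw [h2]; exact RR_symm (hr _ (hs.1 h1))
        · exact hs.2 a h1 b h2
    · rw [Finset.card_insert_of_notMem hvs]; push_cast; omega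
  | zero => simp
  | add x y _ _ hx hy => rw [map_add]; exact add_mem hx hy
  | smul a x _ hx => rw [map_smul]; exact Submodule.smul_mem _ _ hx

theorem decomp {W : Finset ℕ} (v : ℕ) {n : ℤ} {x : Finset ℕ →₀ K} (hx : x ∈ CC K W n) :
    ∃ a ∈ CC K (W.erase v) n, ∃ b ∈ CC K (lkN W v) (n - 1), x = a + cone K v b := by
  unfold CC facesSpan at hx
  induction hx using Submodule.span_induction with
  | mem x h =>
    obtain ⟨s, ⟨hs, hc⟩, rfl⟩ := h
    rw [mem_flagC] at hs
    by_cases hv : v ∈ s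
    · refine ⟨0, zero_mem _, sg K v (s.erase v) • Finsupp.single (s.erase v) 1,
        Submodule.smul_mem _ _ (single_mem_facesSpan K ?_ ?_), ?_⟩
      · rw [mem_flagC]
        refine ⟨fun w hw => ?_, fun a ha b hb =>
          hs.2 a (Finset.mem_of_mem_erase ha) b (Finset.mem_of_mem_erase hb)⟩
        have := Finset.mem_erase.1 hw
        simp only [lkN, Finset.mem_filter]
        exact ⟨hs.1 this.2, this.1, hs.2 _ hv _ this.2⟩
      · have := Finset.card_erase_add_one hv
        omega
      · simp only
        rw [map_smul, cone_single, coneF, if_neg (by simp), smul_smul, sg_mul_self, one_smul,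
          Finset.insert_erase hv, zero_add]
    · refine ⟨Finsupp.single s 1, single_mem_facesSpan K ?_ hc, 0, zero_mem _, by simp⟩
      rw [mem_flagC]
      exact ⟨Finset.subset_erase.2 ⟨hs.1, hv⟩, hs.2⟩
  | zero => exact ⟨0, zero_mem _, 0, zero_mem _, by simp⟩
  | add x y _ _ hx hy =>
    obtain ⟨a, ha, b, hb, rfl⟩ := hx
    obtain ⟨a', ha', b', hb', rfl⟩ := hy
    exact ⟨a + a', add_mem ha ha', b + b', add_mem hb hb', by rw [map_add]; abel⟩
  | smul r x _ hx =>
    obtain ⟨a, ha, b, hb, rfl⟩ := hx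
    exact ⟨r • a, Submodule.smul_mem _ _ ha, r • b, Submodule.smul_mem _ _ hb, by
      rw [map_smul, smul_add]⟩

def AcN (W : Finset ℕ) (n : ℤ) : Prop :=
  ∀ x ∈ CC K W n, bdry K x = 0 → ∃ y ∈ CC K W (n + 1), bdry K y = x

theorem lkN_subset (W : Finset ℕ) (v : ℕ) : lkN W v ⊆ W.erase v := by
  intro w hw
  simp only [lkN, Finset.mem_filter] at hw
  exact Finset.mem_erase.2 ⟨hw.2.1, hw.1⟩

theorem v_notMem_lkN (W : Finset ℕ) (v : ℕ) : v ∉ lkN W v :=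
  fun h => Finset.notMem_erase v W (lkN_subset W v h)

/-- if `a + cone b` has boundary `z` away from `v`, separate. -/
theorem separate {v : ℕ} {a b z : Finset ℕ →₀ K} (ha : a ∈ Av K v) (hb : b ∈ Av K v)
    (hz : z ∈ Av K v) (h : bdry K (a + cone K v b) = z) : bdry K a + b = z := by
  rw [map_add, bdry_cone K hb] at h
  have h1 : bdry K a + b - z = cone K v (bdry K b) := by rw [← h]; abel
  have h2 : bdry K a + b - z ∈ Av K v := sub_mem (add_mem (bdry_mem_Av K ha) hb) hz
  have h3 := Av_Hv K h2 (h1 ▸ cone_mem_Hv K v _)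
  exact sub_eq_zero.1 h3

theorem acN_cone {W : Finset ℕ} {v : ℕ} (hv : v ∈ W) (hr : ∀ w ∈ W, RR v w) (n : ℤ) :
    AcN K W n := by
  intro x hx h0
  obtain ⟨a, ha, b, hb, rfl⟩ := decomp K v hx
  have ha' := CC_le_Av K (Finset.notMem_erase v W) n ha
  have hb' := CC_le_Av K (v_notMem_lkN W v) _ hb
  have h := separate K ha' hb' (zero_mem _) h0
  refine ⟨cone K v a, cone_CC K hv (Finset.erase_subset _ _)
    (fun w hw => hr w (Finset.mem_of_mem_erase hw)) ha, ?_⟩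
  rw [bdry_cone K ha', eq_neg_of_add_eq_zero_left h, map_neg, sub_neg_eq_add]

theorem lkN_RR {W : Finset ℕ} {v : ℕ} : ∀ w ∈ lkN W v, RR v w := by
  intro w hw
  simp only [lkN, Finset.mem_filter] at hw
  exact hw.2.2

theorem acN_glue {W : Finset ℕ} {v : ℕ} (hv : v ∈ W) {n : ℤ} (h1 : AcN K (W.erase v) n)
    (h2 : AcN K (lkN W v) (n - 1)) : AcN K W n := by
  intro x hx h0
  obtain ⟨a, ha, b, hb, rfl⟩ := decomp K v hx
  have ha' := CC_le_Av K (Finset.notMem_erase v W) n ha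
  have hb' := CC_le_Av K (v_notMem_lkN W v) _ hb
  have h := separate K ha' hb' (zero_mem _) h0
  have hb0 : bdry K b = 0 := by
    rw [eq_neg_of_add_eq_zero_right h, map_neg, bdry_bdry, neg_zero]
  obtain ⟨c, hc, rfl⟩ := h2 b hb hb0
  rw [sub_add_cancel] at hc
  have hc' := CC_le_Av K (v_notMem_lkN W v) _ hc
  obtain ⟨e, he, hee⟩ := h1 (a + c) (add_mem ha (CC_mono K (lkN_subset W v) _ hc))
    (by rw [map_add, h])
  refine ⟨e - cone K v c, sub_mem (CC_mono K (Finset.erase_subset _ _) _ he)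
    (cone_CC K hv ((lkN_subset W v).trans (Finset.erase_subset _ _)) lkN_RR hc), ?_⟩
  rw [map_sub, bdry_cone K hc', hee]; abel

theorem acN_remove {W : Finset ℕ} {v : ℕ} {n : ℤ} (h1 : AcN K W n)
    (h2 : AcN K (lkN W v) n) : AcN K (W.erase v) n := by
  intro z hz h0
  obtain ⟨x, hx, hxz⟩ := h1 z (CC_mono K (Finset.erase_subset _ _) _ hz) h0
  obtain ⟨a, ha, b, hb, rfl⟩ := decomp K v hx
  have ha' := CC_le_Av K (Finset.notMem_erase v W) _ ha
  have hb' := CC_le_Av K (v_notMem_lkN W v) _ hb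
  have h := separate K ha' hb' (CC_le_Av K (Finset.notMem_erase v W) _ hz) hxz
  rw [add_sub_cancel_right] at hb
  have hb0 : bdry K b = 0 := by
    have : b = z - bdry K a := by rw [← h]; abel
    rw [this, map_sub, h0, bdry_bdry, sub_zero]
  obtain ⟨c, hc, rfl⟩ := h2 b hb hb0
  exact ⟨a + c, add_mem ha (CC_mono K (lkN_subset W v) _ hc), by rw [map_add, h]⟩

theorem acN_neg (W : Finset ℕ) {n : ℤ} (hn : n < 0) : AcN K W n := by
  intro x hx _
  have : x = 0 := by
    ext s
    by_contra h
    have := ((mem_facesSpan K _ _ _).1 hx s h).2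
    omega
  exact ⟨0, zero_mem _, by simp [this]⟩

theorem acN_flag (m : ℕ) : ∀ (W : Finset ℕ), W.card = m → ∀ n : ℤ, (W.card : ℤ) < 2 * n →
    AcN K W n := by
  induction m using Nat.strong_induction_on with
  | _ m ih =>
  intro W hm n hn
  by_cases hcl : ∀ a ∈ W, ∀ b ∈ W, RR a b
  · rcases W.eq_empty_or_nonempty with rfl | ⟨v, hv⟩
    · intro x hx _
      have : x = 0 := by
        ext s
        by_contra h
        have h1 := ((mem_facesSpan K _ _ _).1 hx s h)
        have h2 := (mem_flagC.1 h1.1).1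
        have h3 := Finset.card_le_card h2
        simp at h3 hn
        subst h3
        simp at h1
        omega
      exact ⟨0, zero_mem _, by simp [this]⟩
    · exact acN_cone K hv (hcl v hv) n
  · push Not at hcl
    obtain ⟨v, hv, u, hu, huv⟩ := hcl
    have c1 := Finset.card_erase_add_one hv
    have c2 : (lkN W v).card + 2 ≤ W.card := by
      have hne : u ≠ v := fun h => huv (h ▸ RR_refl _)
      have hs : lkN W v ⊆ (W.erase v).erase u := by
        refine Finset.subset_erase.2 ⟨lkN_subset W v, fun h => huv (lkN_RR u h)⟩
      have := Finset.card_le_card hs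
      have := Finset.card_erase_add_one (Finset.mem_erase.2 ⟨hne, hu⟩)
      omega
    refine acN_glue K hv (ih _ (by omega) _ rfl n (by omega)) (ih _ (by omega) _ rfl _ (by omega))

theorem redHdim_eq_zero {W : Finset ℕ} {n : ℤ} (h : AcN K W n) : redHdim K (flagC W) n = 0 := by
  unfold redHdim
  have : cyclesOn K (flagC W) n ≤ boundariesOn K (flagC W) n := by
    intro x hx
    obtain ⟨y, hy, hyx⟩ := h x hx.1 hx.2
    exact ⟨y, hy, hyx⟩
  rw [inf_eq_right.2 this, Nat.sub_self]

theorem redHdim_ne_zero {W : Finset ℕ} {n : ℤ} {z : Finset ℕ →₀ K} (hz : z ∈ CC K W n)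
    (h0 : bdry K z = 0) (hn : ∀ y ∈ CC K W (n + 1), bdry K y ≠ z) :
    redHdim K (flagC W) n ≠ 0 := by
  unfold redHdim
  have hfin : FiniteDimensional K (facesSpan K (flagC W) n) := by
    apply FiniteDimensional.span_of_finite
    apply Set.Finite.image
    exact (flagC W).finite_toSet.subset (fun s hs => hs.1)
  have hfc : FiniteDimensional K (cyclesOn K (flagC W) n) :=
    Submodule.finiteDimensional_of_le (inf_le_left : _ ≤ facesSpan K (flagC W) n)
  have hlt : boundariesOn K (flagC W) n ⊓ cyclesOn K (flagC W) n < cyclesOn K (flagC W) n := by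
    refine lt_of_le_of_ne inf_le_right fun h => ?_
    have hzc : z ∈ cyclesOn K (flagC W) n := ⟨hz, h0⟩
    rw [← h] at hzc
    obtain ⟨y, hy, hyz⟩ := hzc.1
    exact hn y hy hyz
  have := Submodule.finrank_lt_finrank_of_lt hlt
  omega
def AcS (X : Finset (Finset ℕ)) (n : ℤ) : Prop := AcN K (X.image enc) n

def lkS (X : Finset (Finset ℕ)) (v : Finset ℕ) : Finset (Finset ℕ) :=
  X.filter (fun x => x ⊂ v ∨ v ⊂ x)

theorem RR_enc (x y : Finset ℕ) : RR (enc x) (enc y) ↔ x ⊆ y ∨ y ⊆ x := by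
  simp [RR, decS_enc]

theorem lkN_image (X : Finset (Finset ℕ)) (v : Finset ℕ) :
    lkN (X.image enc) (enc v) = (lkS X v).image enc := by
  ext a
  simp only [lkN, lkS, Finset.mem_filter, Finset.mem_image]
  constructor
  · rintro ⟨⟨x, hx, rfl⟩, h1, h2⟩
    rw [RR_enc] at h2
    have hne : x ≠ v := fun h => h1 (by rw [h])
    refine ⟨x, ⟨hx, ?_⟩, rfl⟩
    rcases h2 with h | h
    · exact Or.inr (Finset.ssubset_iff_subset_ne.2 ⟨h, hne.symm⟩)
    · exact Or.inl (Finset.ssubset_iff_subset_ne.2 ⟨h, hne⟩)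
  · rintro ⟨x, ⟨hx, h⟩, rfl⟩
    refine ⟨⟨x, hx, rfl⟩, fun e => ?_, ?_⟩
    · have := enc_inj e
      subst this
      rcases h with h | h <;> exact (lt_irrefl _ h)
    · rw [RR_enc]
      rcases h with h | h
      · exact Or.inr h.1
      · exact Or.inl h.1

theorem erase_image (X : Finset (Finset ℕ)) (v : Finset ℕ) :
    (X.image enc).erase (enc v) = (X.erase v).image enc :=
  (Finset.image_erase enc_inj X v).symm

variable {K}

theorem acS_cone {X : Finset (Finset ℕ)} {v : Finset ℕ} (hv : v ∈ X)
    (h : ∀ x ∈ X, v ⊆ x ∨ x ⊆ v) (n : ℤ) : AcS K X n := by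
  refine acN_cone K (Finset.mem_image_of_mem enc hv) ?_ n
  intro w hw
  obtain ⟨x, hx, rfl⟩ := Finset.mem_image.1 hw
  exact (RR_enc _ _).2 (h x hx)

theorem acS_glue {X : Finset (Finset ℕ)} {v : Finset ℕ} (hv : v ∈ X) {n : ℤ}
    (h1 : AcS K (X.erase v) n) (h2 : AcS K (lkS X v) (n - 1)) : AcS K X n := by
  refine acN_glue K (Finset.mem_image_of_mem enc hv) ?_ ?_
  · rw [erase_image]; exact h1
  · rw [lkN_image]; exact h2

theorem acS_remove {X : Finset (Finset ℕ)} {v : Finset ℕ} {n : ℤ}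
    (h1 : AcS K X n) (h2 : AcS K (lkS X v) n) : AcS K (X.erase v) n := by
  unfold AcS
  rw [← erase_image]
  refine acN_remove K h1 ?_
  rw [lkN_image]; exact h2

theorem acS_closure {X : Finset (Finset ℕ)} (f : Finset ℕ → Finset ℕ)
    (h1 : ∀ x ∈ X, x ⊆ f x) (h2 : ∀ x ∈ X, f x ∈ X) (h3 : ∀ x ∈ X, f (f x) = f x)
    (h4 : ∀ x ∈ X, ∀ y ∈ X, x ⊆ y → f x ⊆ f y) {y0 : Finset ℕ} (hy0 : y0 ∈ X) (hfy : f y0 = y0)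
    (h5 : ∀ x ∈ X, f x = x → y0 ⊆ x ∨ x ⊆ y0) (n : ℤ) : AcS K X n := by
  have key : ∀ T : Finset (Finset ℕ), T ⊆ X.filter (fun x => f x ≠ x) →
      ∀ n, AcS K (X.filter (fun x => f x = x) ∪ T) n := by
    intro T
    refine Finset.induction_on_max_value (fun s => Finset.card s) T ?_ ?_
    · intro _ n
      rw [Finset.union_empty]
      refine acS_cone (v := y0) (by simp [hy0, hfy]) ?_ n
      intro x hx
      rw [Finset.mem_filter] at hx
      exact h5 x hx.1 hx.2
    · intro a s ha hmax ih hT n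
      rw [Finset.insert_subset_iff] at hT
      have hs := hT.2
      have haX := Finset.mem_filter.1 hT.1
      have e : (X.filter (fun x => f x = x) ∪ insert a s).erase a
          = X.filter (fun x => f x = x) ∪ s := by
        ext x
        simp only [Finset.mem_erase, Finset.mem_union, Finset.mem_insert, Finset.mem_filter]
        constructor
        · rintro ⟨h, h' | h' | h'⟩
          · exact Or.inl h'
          · exact absurd h' h
          · exact Or.inr h'
        · rintro (h | h)
          · refine ⟨fun e => haX.2 (e ▸ h.2), Or.inl h⟩
          · exact ⟨fun e => ha (e ▸ h), Or.inr (Or.inr h)⟩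
      refine acS_glue (v := a) (by simp) (by rw [e]; exact ih hs n) ?_
      have hfa : a ⊂ f a := Finset.ssubset_iff_subset_ne.2 ⟨h1 a haX.1, fun h => haX.2 h.symm⟩
      refine acS_cone (v := f a) ?_ ?_ _
      · simp only [lkS, Finset.mem_filter, Finset.mem_union]
        exact ⟨Or.inl ⟨h2 a haX.1, h3 a haX.1⟩, Or.inr hfa⟩
      · intro x hx
        simp only [lkS, Finset.mem_filter, Finset.mem_union, Finset.mem_insert] at hx
        obtain ⟨hx, hc⟩ := hx
        rcases hc with hc | hc
        · exact Or.inr (hc.1.trans hfa.1)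
        · rcases hx with hx | hx | hx
          · left
            have := h4 a haX.1 x hx.1 hc.1
            rwa [hx.2] at this
          · subst hx; exact absurd hc (lt_irrefl _)
          · have h6 := hmax x hx
            have h7 := Finset.card_lt_card hc
            omega
  have := key (X.filter (fun x => f x ≠ x)) (Finset.Subset.refl _) n
  rwa [Finset.filter_union_filter_not_eq] at this

def PP (d : ℕ) : Finset (Finset ℕ) := ((Finset.range d).powerset.erase ∅).erase (Finset.range d)

theorem mem_PP {d : ℕ} {x : Finset ℕ} : x ∈ PP d ↔ x ⊂ Finset.range d ∧ x ≠ ∅ := by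
  simp only [PP, Finset.mem_erase, Finset.mem_powerset, Finset.ssubset_iff_subset_ne]
  tauto

def LL (d : ℕ) (C : Finset (Finset ℕ)) : Finset (Finset ℕ) :=
  (PP d).filter (fun x => ∀ c ∈ C, x ⊂ c ∨ c ⊂ x)

theorem mem_LL {d : ℕ} {C : Finset (Finset ℕ)} {x : Finset ℕ} :
    x ∈ LL d C ↔ (x ⊂ Finset.range d ∧ x ≠ ∅) ∧ ∀ c ∈ C, x ⊂ c ∨ c ⊂ x := by
  simp only [LL, Finset.mem_filter, mem_PP]

theorem lkS_LL (d : ℕ) (C : Finset (Finset ℕ)) (v : Finset ℕ) :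
    lkS (LL d C) v = LL d (insert v C) := by
  ext x
  simp only [lkS, Finset.mem_filter, mem_LL, Finset.forall_mem_insert]
  tauto

theorem lkS_sdiff (X M : Finset (Finset ℕ)) (v : Finset ℕ) :
    lkS (X \ M) v = lkS X v \ lkS M v := by
  ext x
  simp only [lkS, Finset.mem_filter, Finset.mem_sdiff]
  tauto

theorem chain_insert {d : ℕ} {C : Finset (Finset ℕ)} {v : Finset ℕ} (hC : IsChainF C)
    (hv : v ∈ LL d C) : IsChainF (insert v C) := by
  have hv' := (mem_LL.1 hv).2
  intro s hs t ht
  rcases Finset.mem_insert.1 hs with h1 | h1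
  · rcases Finset.mem_insert.1 ht with h2 | h2
    · left; rw [h1, h2]
    · rw [h1]; rcases hv' t h2 with h | h
      · exact Or.inl h.1
      · exact Or.inr h.1
  · rcases Finset.mem_insert.1 ht with h2 | h2
    · rw [h2]; rcases hv' s h1 with h | h
      · exact Or.inr h.1
      · exact Or.inl h.1
    · exact hC s h1 t h2

theorem sub_insert {d : ℕ} {C : Finset (Finset ℕ)} {v : Finset ℕ} (hC : C ⊆ PP d)
    (hv : v ∈ LL d C) : insert v C ⊆ PP d :=
  Finset.insert_subset (Finset.mem_filter.1 hv).1 hC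

theorem notMem_of_LL {d : ℕ} {C : Finset (Finset ℕ)} {v : Finset ℕ}
    (hv : v ∈ LL d C) : v ∉ C := fun h => by
  rcases (mem_LL.1 hv).2 v h with h | h <;> exact lt_irrefl _ h

theorem LL_card_lt {d : ℕ} {C : Finset (Finset ℕ)} {v : Finset ℕ} (hv : v ∈ LL d C) :
    (LL d (insert v C)).card < (LL d C).card := by
  apply Finset.card_lt_card
  rw [← lkS_LL]
  refine Finset.ssubset_iff_subset_ne.2 ⟨Finset.filter_subset _ _, fun h => ?_⟩
  rw [← h] at hv
  rcases (Finset.mem_filter.1 hv).2 with h | h <;> exact lt_irrefl _ h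

theorem exists_upper {d : ℕ} {C : Finset (Finset ℕ)} (hC : IsChainF C) (hCP : C ⊆ PP d)
    {v : Finset ℕ} (hv : v ∈ LL d C) :
    ∃ u, (u ∈ C ∨ u = Finset.range d) ∧ v ⊂ u ∧ ∀ c ∈ C, c ⊂ v ∨ u ⊆ c := by
  have hv' := mem_LL.1 hv
  obtain ⟨u, hu, hmin⟩ := Finset.exists_min_image
    ((insert (Finset.range d) C).filter (fun c => v ⊂ c)) Finset.card
    ⟨Finset.range d, by simp [hv'.1.1]⟩
  rw [Finset.mem_filter, Finset.mem_insert] at hu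
  refine ⟨u, hu.1.symm, hu.2, fun c hc => ?_⟩
  rcases hv'.2 c hc with h | h
  · right
    have hle := hmin c (by simp [hc, h])
    have hcomp : u ⊆ c ∨ c ⊆ u := by
      rcases hu.1 with h1 | h1
      · right; rw [h1]; exact (mem_PP.1 (hCP hc)).1.1
      · exact hC u h1 c hc
    rcases hcomp with h1 | h1
    · exact h1
    · rw [Finset.eq_of_subset_of_card_le h1 hle]
  · exact Or.inl h

theorem acS_sphere_minus (d : ℕ) (m : ℕ) : ∀ (C : Finset (Finset ℕ)) (v : Finset ℕ),
    IsChainF C → C ⊆ PP d → v ∈ LL d C → (LL d C).card = m →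
    ∀ n, AcS K ((LL d C).erase v) n := by
  induction m using Nat.strong_induction_on with
  | _ m ih =>
  intro C v hC hCP hv hm n
  obtain ⟨u, hu, hvu, huC⟩ := exists_upper hC hCP hv
  obtain ⟨p, hpu, hpv⟩ := Finset.exists_of_ssubset hvu
  have hv' := mem_LL.1 hv
  have hur : u ⊆ Finset.range d := by
    rcases hu with h | h
    · exact (mem_PP.1 (hCP h)).1.1
    · rw [h]
  have hwu : u.erase p ⊂ u := Finset.erase_ssubset hpu
  have hvw : v ⊆ u.erase p := Finset.subset_erase.2 ⟨hvu.1, hpv⟩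
  set w := u.erase p with hw
  have hpw : p ∉ w := by simp [hw]
  -- the acyclic part
  have hX : ∀ n, AcS K (((LL d C).erase v).erase w) n := by
    set l := (C.filter (fun c => c ⊆ v)).sup id with hl
    have hlc : ∀ c ∈ C, c ⊆ v → c ⊆ l := fun c hc hcv =>
      Finset.le_sup (f := id) (Finset.mem_filter.2 ⟨hc, hcv⟩)
    have hlv : l ⊆ v := by
      apply Finset.sup_le
      intro c hc
      exact (Finset.mem_filter.1 hc).2
    have hlne : l ≠ v := by
      intro h
      rcases (C.filter (fun c => c ⊆ v)).eq_empty_or_nonempty with he | hne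
      · rw [he] at hl
        apply hv'.1.2
        rw [← h, hl]; rfl
      · obtain ⟨c, hc, hmax⟩ := Finset.exists_max_image _ Finset.card hne
        have hc' := Finset.mem_filter.1 hc
        have : l ⊆ c := by
          apply Finset.sup_le
          intro c2 hc2
          have hc2' := Finset.mem_filter.1 hc2
          rcases hC c2 hc2'.1 c hc'.1 with h1 | h1
          · exact h1
          · have := Finset.eq_of_subset_of_card_le h1 (hmax c2 hc2)
            rw [this]; exact Finset.Subset.refl _
        have hcv : c = v := Finset.Subset.antisymm hc'.2 (h ▸ this)
        exact notMem_of_LL hv (hcv ▸ hc'.1)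
    have hmemX : ∀ x, x ∈ ((LL d C).erase v).erase w ↔ x ≠ w ∧ x ≠ v ∧
        (x ⊂ Finset.range d ∧ x ≠ ∅) ∧ ∀ c ∈ C, x ⊂ c ∨ c ⊂ x := by
      intro x; rw [Finset.mem_erase, Finset.mem_erase, mem_LL]
    have hyu : insert p l ⊂ u := by
      refine Finset.ssubset_iff_subset_ne.2 ⟨Finset.insert_subset hpu (hlv.trans hvu.1), fun h => ?_⟩
      apply hlne
      refine Finset.Subset.antisymm hlv fun x hx => ?_
      have h1 : x ∈ insert p l := by rw [h]; exact hvu.1 hx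
      rcases Finset.mem_insert.1 h1 with h2 | h2
      · exact absurd (h2 ▸ hx) hpv
      · exact h2
    refine acS_closure (fun x => if (∀ c ∈ C, c ⊆ v → c ⊆ x) then insert p x else x)
      ?_ ?_ ?_ ?_ (y0 := insert p l) ?_ ?_ ?_
    · intro x _
      split_ifs
      · exact Finset.subset_insert _ _
      · exact Finset.Subset.refl _
    · intro x hx
      split_ifs with hcond
      · by_cases hpx : p ∈ x
        · rwa [Finset.insert_eq_of_mem hpx]
        rw [hmemX] at hx ⊢
        have hxu : x ⊂ u := by
          rcases hu with h | h
          · rcases hx.2.2.2 u h with h1 | h1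
            · exact h1
            · exact absurd (h1.1 hpu) hpx
          · rw [h]; exact hx.2.2.1.1
        have hixu : insert p x ⊂ u := by
          refine Finset.ssubset_iff_subset_ne.2 ⟨Finset.insert_subset hpu hxu.1, fun h => ?_⟩
          apply hx.1
          rw [hw, ← h, Finset.erase_insert hpx]
        refine ⟨fun h => hpw (h ▸ Finset.mem_insert_self _ _),
          fun h => hpv (h ▸ Finset.mem_insert_self _ _),
          ⟨lt_of_lt_of_le hixu hur, Finset.insert_ne_empty _ _⟩, fun c hc => ?_⟩
        rcases huC c hc with h | h
        · right
          refine lt_of_lt_of_le (b := x) ?_ (Finset.subset_insert _ _)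
          refine lt_of_le_of_ne (hcond c hc h.1) fun e => ?_
          rcases hx.2.2.2 c hc with h1 | h1 <;> exact lt_irrefl _ (e ▸ h1)
        · left; exact lt_of_lt_of_le hixu h
      · exact hx
    · intro x _
      by_cases hcond : ∀ c ∈ C, c ⊆ v → c ⊆ x
      · rw [if_pos hcond, if_pos (fun c hc hcv => (hcond c hc hcv).trans (Finset.subset_insert _ _)),
          Finset.insert_idem]
      · rw [if_neg hcond, if_neg hcond]
    · intro x _ y _ hxy
      by_cases hcond : ∀ c ∈ C, c ⊆ v → c ⊆ x
      · rw [if_pos hcond, if_pos (fun c hc hcv => (hcond c hc hcv).trans hxy)]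
        exact Finset.insert_subset_insert _ hxy
      · rw [if_neg hcond]
        split_ifs
        · exact hxy.trans (Finset.subset_insert _ _)
        · exact hxy
    · rw [hmemX]
      refine ⟨fun h => hpw (h ▸ Finset.mem_insert_self _ _),
          fun h => hpv (h ▸ Finset.mem_insert_self _ _),
          ⟨lt_of_lt_of_le hyu hur, Finset.insert_ne_empty _ _⟩, fun c hc => ?_⟩
      rcases huC c hc with h | h
      · right
        refine lt_of_le_of_ne ((hlc c hc h.1).trans (Finset.subset_insert _ _)) fun e => ?_
        exact hpv (h.1 (e ▸ Finset.mem_insert_self _ _))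
      · left; exact lt_of_lt_of_le hyu h
    · simp
    · intro x hx hfx
      split_ifs at hfx with hcond
      · left
        refine Finset.insert_subset (by rw [← hfx]; simp) ?_
        apply Finset.sup_le
        intro c hc
        have hc' := Finset.mem_filter.1 hc
        exact hcond c hc'.1 hc'.2
      · right
        push Not at hcond
        obtain ⟨c, hc, hcv, hcx⟩ := hcond
        rcases ((hmemX x).1 hx).2.2.2 c hc with h | h
        · exact h.1.trans ((hlc c hc hcv).trans (Finset.subset_insert _ _))
        · exact absurd h.1 hcx
  by_cases hwv : w = v
  · have := hX n
    rwa [hwv, Finset.erase_eq_of_notMem (Finset.notMem_erase _ _)] at this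
  · have hvw' : v ⊂ w := Finset.ssubset_iff_subset_ne.2 ⟨hvw, Ne.symm hwv⟩
    have hwL : w ∈ LL d C := by
      rw [mem_LL]
      refine ⟨⟨lt_of_lt_of_le hwu hur, fun h => ?_⟩, fun c hc => ?_⟩
      · rw [h] at hvw'; exact Finset.not_ssubset_empty _ hvw'
      · rcases huC c hc with h | h
        · right; exact lt_of_lt_of_le h hvw
        · left; exact lt_of_lt_of_le hwu h
    refine acS_glue (v := w) (Finset.mem_erase.2 ⟨hwv, hwL⟩) (hX n) ?_
    have e : lkS ((LL d C).erase v) w = (LL d (insert w C)).erase v := by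
      rw [← lkS_LL]
      ext x
      simp only [lkS, Finset.mem_filter, Finset.mem_erase]
      tauto
    rw [e]
    refine ih _ (hm ▸ LL_card_lt hwL) (insert w C) v (chain_insert hC hwL) (sub_insert hCP hwL) ?_ rfl _
    rw [← lkS_LL]
    exact Finset.mem_filter.2 ⟨hv, Or.inl hvw'⟩

theorem LL_nonempty {d : ℕ} {C : Finset (Finset ℕ)} (hC : IsChainF C) (hCP : C ⊆ PP d)
    (h : C.card < d - 1) : (LL d C).Nonempty := by
  obtain ⟨i, hi, hiC⟩ : ∃ i ∈ Finset.Ico 1 d, i ∉ C.image Finset.card := by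
    by_contra hcon
    push Not at hcon
    have h1 := Finset.card_le_card (show Finset.Ico 1 d ⊆ C.image Finset.card from hcon)
    have h2 := Finset.card_image_le (s := C) (f := Finset.card)
    simp at h1
    omega
  rw [Finset.mem_Ico] at hi
  have hne : ∀ c ∈ C, c.card ≠ i := fun c hc e => hiC (Finset.mem_image.2 ⟨c, hc, e⟩)
  set D := insert ∅ C
  set E := insert (Finset.range d) C
  obtain ⟨l, hl, hlmax⟩ := Finset.exists_max_image (D.filter (fun c => c.card < i)) Finset.card
    ⟨∅, by simp [D]; omega⟩
  obtain ⟨u, hu, humin⟩ := Finset.exists_min_image (E.filter (fun c => i < c.card)) Finset.card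
    ⟨Finset.range d, by simp [E]; omega⟩
  rw [Finset.mem_filter, Finset.mem_insert] at hl hu
  have hlu : l ⊆ u := by
    rcases hl.1 with h1 | h1
    · rw [h1]; exact Finset.empty_subset _
    · rcases hu.1 with h2 | h2
      · rw [h2]; exact (mem_PP.1 (hCP h1)).1.1
      · rcases hC l h1 u h2 with h3 | h3
        · exact h3
        · have := Finset.card_le_card h3; omega
  obtain ⟨v, hlv, hvu, hvc⟩ := Finset.exists_subsuperset_card_eq hlu hl.2.le hu.2.le
  have hur : u ⊆ Finset.range d := by
    rcases hu.1 with h | h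
    · rw [h]
    · exact (mem_PP.1 (hCP h)).1.1
  have aux : ∀ {a b : Finset ℕ}, a ⊆ b → a.card < b.card → a ⊂ b := fun h1 h2 =>
    Finset.ssubset_iff_subset_ne.2 ⟨h1, fun e => by rw [e] at h2; omega⟩
  refine ⟨v, mem_LL.2 ⟨⟨aux (hvu.trans hur) (by simp; omega), fun e => ?_⟩, fun c hc => ?_⟩⟩
  · rw [e] at hvc; simp at hvc; omega
  · rcases lt_or_gt_of_ne (hne c hc) with h1 | h1
    · right
      have h2 := hlmax c (by simp [D, hc, h1])
      refine aux (Finset.Subset.trans ?_ hlv) (by omega)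
      rcases hl.1 with h3 | h3
      · rw [h3] at h2; simp at h2; rw [h2]; exact Finset.empty_subset _
      · rcases hC c hc l h3 with h4 | h4
        · exact h4
        · rw [Finset.eq_of_subset_of_card_le h4 h2]
    · left
      have h2 := humin c (by simp [E, hc, h1])
      refine aux (hvu.trans ?_) (by omega)
      rcases hu.1 with h3 | h3
      · have h5 := (mem_PP.1 (hCP hc)).1.1
        rw [h3] at h2 ⊢
        rw [Finset.eq_of_subset_of_card_le h5 h2]
      · rcases hC u h3 c hc with h4 | h4
        · exact h4
        · rw [Finset.eq_of_subset_of_card_le h4 h2]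

theorem acS_sphere (d : ℕ) (m : ℕ) : ∀ (C : Finset (Finset ℕ)),
    IsChainF C → C ⊆ PP d → d - 1 - C.card = m →
    ∀ n : ℤ, n < (d : ℤ) - 1 - C.card → AcS K (LL d C) n := by
  induction m with
  | zero =>
    intro C _ _ h n hn
    exact acN_neg K _ (by omega)
  | succ m ih =>
    intro C hC hCP h n hn
    obtain ⟨v, hv⟩ := LL_nonempty (d := d) hC hCP (by omega)
    refine acS_glue hv (acS_sphere_minus d _ C v hC hCP hv rfl n) ?_
    rw [lkS_LL]
    have hc := Finset.card_insert_of_notMem (notMem_of_LL hv)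
    exact ih _ (chain_insert hC hv) (sub_insert hCP hv) (by omega) _ (by rw [hc]; push_cast; omega)

theorem sdiff_insert_erase (X M : Finset (Finset ℕ)) (v : Finset ℕ) :
    X \ insert v M = (X \ M).erase v := by
  ext x; simp only [Finset.mem_sdiff, Finset.mem_insert, Finset.mem_erase]; tauto

theorem acS_minus_chain (d : ℕ) (M : Finset (Finset ℕ)) : ∀ (C : Finset (Finset ℕ)),
    IsChainF C → C ⊆ PP d → M ⊆ LL d C → M.Nonempty → IsChainF M →
    ∀ n, AcS K (LL d C \ M) n := by
  induction M using Finset.induction_on with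
  | empty => intro C _ _ _ h; simp at h
  | insert v M hvM ih =>
    intro C hC hCP hM _ hMc n
    have hv := hM (Finset.mem_insert_self _ _)
    have hM' : M ⊆ LL d C := (Finset.subset_insert _ _).trans hM
    have hMc' : IsChainF M := fun s hs t ht =>
      hMc s (Finset.mem_insert_of_mem hs) t (Finset.mem_insert_of_mem ht)
    rw [sdiff_insert_erase]
    rcases M.eq_empty_or_nonempty with rfl | hne
    · rw [Finset.sdiff_empty]; exact acS_sphere_minus d _ C v hC hCP hv rfl n
    have hlk : lkS M v = M := by
      apply Finset.filter_true_of_mem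
      intro x hx
      have hxv : x ≠ v := fun h => hvM (h ▸ hx)
      rcases hMc x (Finset.mem_insert_of_mem hx) v (Finset.mem_insert_self _ _) with h | h
      · exact Or.inl (Finset.ssubset_iff_subset_ne.2 ⟨h, hxv⟩)
      · exact Or.inr (Finset.ssubset_iff_subset_ne.2 ⟨h, hxv.symm⟩)
    refine acS_remove (ih C hC hCP hM' hne hMc' n) ?_
    rw [lkS_sdiff, hlk, lkS_LL]
    refine ih _ (chain_insert hC hv) (sub_insert hCP hv) ?_ hne hMc' n
    rw [← lkS_LL]
    intro x hx
    rw [← hlk] at hx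
    exact Finset.mem_filter.2 ⟨hM' (Finset.mem_filter.1 hx).1, (Finset.mem_filter.1 hx).2⟩

theorem acS_minus (d : ℕ) (m : ℕ) : ∀ (C M : Finset (Finset ℕ)),
    IsChainF C → C ⊆ PP d → M ⊆ LL d C → M.card = m → ∀ k : ℤ, (M.card : ℤ) < 2 * k →
    AcS K (LL d C \ M) ((d : ℤ) - 1 - C.card - k) := by
  induction m using Nat.strong_induction_on with
  | _ m ih =>
  intro C M hC hCP hM hm k hk
  rcases M.eq_empty_or_nonempty with rfl | hne
  · rw [Finset.sdiff_empty]
    exact acS_sphere d _ C hC hCP rfl _ (by simp at hk; omega)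
  by_cases hMc : IsChainF M
  · exact acS_minus_chain d M C hC hCP hM hne hMc _
  unfold IsChainF at hMc
  push Not at hMc
  obtain ⟨v, hv, u, hu, h1, h2⟩ := hMc
  have hvL := hM hv
  have huv : u ≠ v := fun h => h1 (h ▸ Finset.Subset.refl _)
  have c1 := Finset.card_erase_add_one hv
  have c2 : (lkS M v).card + 2 ≤ M.card := by
    have hs : lkS M v ⊆ (M.erase v).erase u := by
      intro x hx
      obtain ⟨hx1, hx2⟩ := Finset.mem_filter.1 hx
      refine Finset.mem_erase.2 ⟨fun e => ?_, Finset.mem_erase.2 ⟨fun e => ?_, hx1⟩⟩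
      · subst e
        rcases hx2 with h | h
        · exact h2 h.1
        · exact h1 h.1
      · subst e
        rcases hx2 with h | h <;> exact lt_irrefl _ h
    have := Finset.card_le_card hs
    have := Finset.card_erase_add_one (Finset.mem_erase.2 ⟨huv, hu⟩)
    omega
  have e : LL d C \ M = (LL d C \ M.erase v).erase v := by
    rw [← sdiff_insert_erase, Finset.insert_erase hv]
  have hlk : lkS (M.erase v) v = lkS M v := by
    ext x
    simp only [lkS, Finset.mem_filter, Finset.mem_erase]
    constructor
    · rintro ⟨⟨_, a⟩, b⟩; exact ⟨a, b⟩
    · rintro ⟨a, b⟩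
      refine ⟨⟨fun e => ?_, a⟩, b⟩
      subst e
      rcases b with h | h <;> exact lt_irrefl _ h
  rw [e]
  refine acS_remove (ih _ (by omega) C _ hC hCP ((Finset.erase_subset _ _).trans hM) rfl k
    (by omega)) ?_
  rw [lkS_sdiff, hlk, lkS_LL]
  have hc := Finset.card_insert_of_notMem (notMem_of_LL hvL)
  have := ih (lkS M v).card (by omega) (insert v C) (lkS M v) (chain_insert hC hvL)
    (sub_insert hCP hvL) (by
      rw [← lkS_LL]
      exact Finset.filter_subset_filter _ hM) rfl (k - 1) (by omega)
  rw [hc] at this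
  convert this using 1
  push_cast; ring

theorem vertexSet_sd (d : ℕ) :
    vertexSet (sd (simplexC d)) = ((Finset.range d).powerset.erase ∅).image enc := by
  ext a
  simp only [vertexSet, Finset.mem_sup, sd, simplexC, id]
  constructor
  · rintro ⟨s, hs, ha⟩
    obtain ⟨C, hC, rfl⟩ := Finset.mem_image.1 hs
    rw [Finset.mem_filter, Finset.mem_powerset] at hC
    exact Finset.image_subset_image hC.1 ha
  · intro ha
    obtain ⟨x, hx, rfl⟩ := Finset.mem_image.1 ha
    refine ⟨({x} : Finset (Finset ℕ)).image enc, Finset.mem_image.2 ⟨{x}, ?_, rfl⟩, by simp⟩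
    rw [Finset.mem_filter, Finset.mem_powerset, Finset.singleton_subset_iff]
    refine ⟨hx, fun s hs t ht => ?_⟩
    rw [Finset.mem_singleton] at hs ht
    left; rw [hs, ht]

theorem induced_eq (d : ℕ) {X : Finset (Finset ℕ)} (hX : X ⊆ (Finset.range d).powerset.erase ∅) :
    inducedSC (sd (simplexC d)) (X.image enc) = flagC (X.image enc) := by
  ext s
  simp only [inducedSC, Finset.mem_filter, mem_flagC, sd, simplexC, Finset.mem_image,
    Finset.mem_powerset]
  constructor
  · rintro ⟨⟨C, ⟨hC1, hC2⟩, rfl⟩, hs⟩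
    refine ⟨hs, fun a ha b hb => ?_⟩
    obtain ⟨x, hx, rfl⟩ := Finset.mem_image.1 ha
    obtain ⟨y, hy, rfl⟩ := Finset.mem_image.1 hb
    exact (RR_enc _ _).2 (hC2 x hx y hy)
  · rintro ⟨hs, hr⟩
    refine ⟨?_, hs⟩
    obtain ⟨C, hC, rfl⟩ := Finset.subset_image_iff.1 hs
    refine ⟨C, ⟨(by exact_mod_cast hC : C ⊆ X).trans hX, fun x hx y hy => ?_⟩, rfl⟩
    exact (RR_enc _ _).1 (hr _ (Finset.mem_image_of_mem _ hx) _ (Finset.mem_image_of_mem _ hy))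

theorem betti_eq_zero {d i j : ℕ} (h : ∀ X ⊆ (Finset.range d).powerset.erase ∅, X.card = i + j →
    AcS K X j) : bettiSR K (sd (simplexC d)) i (i + j) = 0 := by
  unfold bettiSR
  apply Finset.sum_eq_zero
  intro W hW
  rw [Finset.mem_filter, Finset.mem_powerset, vertexSet_sd] at hW
  obtain ⟨hW, hc⟩ := hW
  obtain ⟨X, hX, rfl⟩ := Finset.subset_image_iff.1 hW
  have hX' : X ⊆ (Finset.range d).powerset.erase ∅ := by exact_mod_cast hX
  rw [induced_eq d hX']
  have : (((i + j : ℕ) : ℤ) - i) = j := by push_cast; ring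
  rw [this]
  rw [Finset.card_image_of_injective _ enc_inj] at hc
  exact redHdim_eq_zero K (h X hX' hc)

theorem betti_ne_zero {d i j : ℕ} {X : Finset (Finset ℕ)}
    (hX : X ⊆ (Finset.range d).powerset.erase ∅) (hc : X.card = i + j)
    (h : redHdim K (flagC (X.image enc)) j ≠ 0) : bettiSR K (sd (simplexC d)) i (i + j) ≠ 0 := by
  unfold bettiSR
  intro h0
  rw [Finset.sum_eq_zero_iff] at h0
  have := h0 (X.image enc) (by
    rw [Finset.mem_filter, Finset.mem_powerset, vertexSet_sd]
    exact ⟨Finset.image_subset_image hX, by rw [Finset.card_image_of_injective _ enc_inj, hc]⟩)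
  rw [induced_eq d hX] at this
  have e : (((i + j : ℕ) : ℤ) - i) = j := by push_cast; ring
  rw [e] at this
  exact h this

theorem part1 {d i j : ℕ} (hj : 1 ≤ j) (h : i ≤ j - 1) :
    bettiSR K (sd (simplexC d)) i (i + j) = 0 := by
  apply betti_eq_zero
  intro X _ hc
  refine acN_flag K _ _ rfl _ ?_
  rw [Finset.card_image_of_injective _ enc_inj]
  omega

theorem card_PP {d : ℕ} (hd : 1 ≤ d) : (PP d).card + 2 = 2 ^ d := by
  have h1 : (∅ : Finset ℕ) ∈ (Finset.range d).powerset := by simp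
  have h2 : Finset.range d ∈ (Finset.range d).powerset.erase ∅ := by
    simp; omega
  have := Finset.card_erase_add_one h1
  have := Finset.card_erase_add_one h2
  rw [Finset.card_powerset, Finset.card_range] at *
  unfold PP
  omega

theorem part3 {d i j : ℕ} (hd : 2 * d ≤ 2 ^ d) (hj : j + 2 ≤ d) (h : 2 ^ d - 2 * d + j < i) :
    bettiSR K (sd (simplexC d)) i (i + j) = 0 := by
  apply betti_eq_zero
  intro X hX hc
  by_cases htop : Finset.range d ∈ X
  · refine acS_cone htop ?_ _
    intro x hx
    right
    exact Finset.mem_powerset.1 (Finset.mem_of_mem_erase (hX hx))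
  · have hXP : X ⊆ PP d := Finset.subset_erase.2 ⟨hX, htop⟩
    have hL : LL d ∅ = PP d := by
      unfold LL; simp
    have hM := acS_minus (K := K) d (PP d \ X).card ∅ (PP d \ X) (fun s hs => by simp at hs) (by simp)
      (by rw [hL]; exact Finset.sdiff_subset) rfl ((d : ℤ) - 1 - j) (by
        have h1 := Finset.card_sdiff_add_card_eq_card hXP
        have h2 := card_PP (d := d) (by omega)
        omega)
    rw [hL, Finset.sdiff_sdiff_eq_self hXP] at hM
    simpa using hM
variable (K)

def rk (n : ℕ) : ℕ := (decS n).card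

def eps (s : Finset ℕ) : K :=
  ∏ u ∈ s, ∏ w ∈ s, if w < u then (if rk u < rk w then (-1 : K) else 1) else 1

theorem eps_ne_zero (s : Finset ℕ) : eps K s ≠ 0 := by
  unfold eps
  refine Finset.prod_ne_zero_iff.2 fun u _ => Finset.prod_ne_zero_iff.2 fun w _ => ?_
  split_ifs <;> simp

theorem eps_insert {v : ℕ} {t : Finset ℕ} (hv : v ∉ t) (hr : ∀ w ∈ t, rk w ≠ rk v) :
    eps K (insert v t) * sg K v (insert v t) =
      eps K t * ∏ w ∈ t, (if rk w < rk v then (-1 : K) else 1) := by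
  have hsg : sg K v (insert v t) = ∏ w ∈ t, (if w < v then (-1 : K) else 1) := by
    rw [sg_insert_self, sg, Finset.prod_ite]; simp
  rw [hsg, eps, Finset.prod_insert hv, Finset.prod_insert hv]
  have h1 : ∀ u ∈ t, (∏ w ∈ insert v t, if w < u then (if rk u < rk w then (-1 : K) else 1) else 1)
      = (if v < u then (if rk u < rk v then (-1 : K) else 1) else 1) *
        ∏ w ∈ t, if w < u then (if rk u < rk w then (-1 : K) else 1) else 1 :=
    fun u _ => Finset.prod_insert hv
  rw [Finset.prod_congr rfl h1, Finset.prod_mul_distrib]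
  rw [if_neg (lt_irrefl v), one_mul]
  have h2 : (∏ w ∈ t, if w < v then (if rk v < rk w then (-1 : K) else 1) else 1) *
      (∏ u ∈ t, if v < u then (if rk u < rk v then (-1 : K) else 1) else 1) *
      (∏ w ∈ t, (if w < v then (-1 : K) else 1)) =
      ∏ w ∈ t, (if rk w < rk v then (-1 : K) else 1) := by
    rw [← Finset.prod_mul_distrib, ← Finset.prod_mul_distrib]
    refine Finset.prod_congr rfl fun w hw => ?_
    have hne : w ≠ v := fun h => hv (h ▸ hw)
    have hne2 := hr w hw
    rcases lt_or_gt_of_ne hne with h | h <;> rcases lt_or_gt_of_ne hne2 with h' | h' <;>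
      simp [h, h', h.not_gt, h'.not_gt]
  rw [← h2]
  unfold eps
  ring

def Fl {d : ℕ} (σ : Equiv.Perm (Fin d)) (i : ℕ) : Finset ℕ :=
  (Finset.univ.filter (fun x : Fin d => (x : ℕ) < i)).image (fun x => ((σ x : Fin d) : ℕ))

theorem mem_Fl {d : ℕ} {σ : Equiv.Perm (Fin d)} {i a : ℕ} :
    a ∈ Fl σ i ↔ ∃ x : Fin d, (x : ℕ) < i ∧ ((σ x : Fin d) : ℕ) = a := by
  simp [Fl]

theorem card_Fl {d : ℕ} (σ : Equiv.Perm (Fin d)) {i : ℕ} (hi : i ≤ d) : (Fl σ i).card = i := by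
  unfold Fl
  rw [Finset.card_image_of_injective _ (fun a b h => σ.injective (Fin.ext h))]
  have : (Finset.univ.filter (fun x : Fin d => (x : ℕ) < i)).image (fun x : Fin d => (x : ℕ))
      = Finset.range i := by
    ext a
    simp only [Finset.mem_image, Finset.mem_filter, Finset.mem_univ, true_and, Finset.mem_range]
    constructor
    · rintro ⟨x, h, rfl⟩; exact h
    · intro h; exact ⟨⟨a, by omega⟩, h, rfl⟩
  rw [← Finset.card_image_of_injective _ (Fin.val_injective), this, Finset.card_range]

theorem Fl_mono {d : ℕ} (σ : Equiv.Perm (Fin d)) {i i' : ℕ} (h : i ≤ i') : Fl σ i ⊆ Fl σ i' := by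
  intro a ha
  rw [mem_Fl] at *
  obtain ⟨x, hx, e⟩ := ha
  exact ⟨x, by omega, e⟩

theorem Fl_ssub {d : ℕ} (σ : Equiv.Perm (Fin d)) {i i' : ℕ} (h : i < i') (h' : i' ≤ d) :
    Fl σ i ⊂ Fl σ i' := by
  refine Finset.ssubset_iff_subset_ne.2 ⟨Fl_mono σ h.le, fun e => ?_⟩
  have := congrArg Finset.card e
  rw [card_Fl σ h', card_Fl σ (by omega)] at this
  omega

theorem Fl_range {d : ℕ} (σ : Equiv.Perm (Fin d)) (i : ℕ) : Fl σ i ⊆ Finset.range d := by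
  intro a ha
  obtain ⟨x, _, rfl⟩ := mem_Fl.1 ha
  exact Finset.mem_range.2 (σ x).2

theorem Fl_one {d : ℕ} {i : ℕ} (hi : i ≤ d) : Fl (1 : Equiv.Perm (Fin d)) i = Finset.range i := by
  ext a
  rw [mem_Fl, Finset.mem_range]
  constructor
  · rintro ⟨x, h, rfl⟩; exact h
  · intro h; exact ⟨⟨a, by omega⟩, h, rfl⟩

theorem Fl_swap {d : ℕ} (σ : Equiv.Perm (Fin d)) {i i' : ℕ} (hi : 1 ≤ i) (hid : i < d)
    (hi' : i' ≤ d) (hne : i' ≠ i) :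
    Fl (σ * Equiv.swap ⟨i - 1, by omega⟩ ⟨i, hid⟩) i' = Fl σ i' := by
  refine Finset.eq_of_subset_of_card_le ?_ (by rw [card_Fl _ hi', card_Fl _ hi'])
  intro a ha
  obtain ⟨x, hx, rfl⟩ := mem_Fl.1 ha
  refine mem_Fl.2 ⟨Equiv.swap ⟨i - 1, by omega⟩ ⟨i, hid⟩ x, ?_, rfl⟩
  rw [Equiv.swap_apply_def]
  split_ifs with h1 h2
  · have := congrArg Fin.val h1
    simp at this ⊢
    omega
  · have := congrArg Fin.val h2
    simp at this ⊢
    omega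
  · exact hx

def fac {d : ℕ} (J : Finset ℕ) (σ : Equiv.Perm (Fin d)) : Finset ℕ :=
  J.image (fun i => enc (Fl σ i))

theorem rk_Fl {d : ℕ} (σ : Equiv.Perm (Fin d)) {i : ℕ} (hi : i ≤ d) : rk (enc (Fl σ i)) = i := by
  rw [rk, decS_enc, card_Fl σ hi]

theorem encFl_inj {d : ℕ} (σ : Equiv.Perm (Fin d)) {i i' : ℕ} (hi : i ≤ d) (hi' : i' ≤ d)
    (h : enc (Fl σ i) = enc (Fl σ i')) : i = i' := by
  rw [← rk_Fl σ hi, ← rk_Fl σ hi', h]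

theorem notMem_fac {d : ℕ} {J : Finset ℕ} (hJ : ∀ i ∈ J, i ≤ d) (σ : Equiv.Perm (Fin d)) {i : ℕ}
    (hi : i ∈ J) : enc (Fl σ i) ∉ fac (J.erase i) σ := by
  intro h
  obtain ⟨i', h1, h2⟩ := Finset.mem_image.1 h
  have := Finset.mem_erase.1 h1
  exact this.1 (encFl_inj σ (hJ _ this.2) (hJ _ hi) h2)

theorem fac_eq_insert {d : ℕ} {J : Finset ℕ} (σ : Equiv.Perm (Fin d)) {i : ℕ}
    (hi : i ∈ J) : fac J σ = insert (enc (Fl σ i)) (fac (J.erase i) σ) := by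
  unfold fac
  rw [← Finset.image_insert (fun i => enc (Fl σ i)), Finset.insert_erase hi]

theorem bdry_fac {d : ℕ} {J : Finset ℕ} (hJ : ∀ i ∈ J, i ≤ d) (σ : Equiv.Perm (Fin d)) :
    eps K (fac J σ) • bdry K (Finsupp.single (fac J σ) 1) =
      ∑ i ∈ J, (eps K (fac (J.erase i) σ) * ∏ i' ∈ J.erase i, (if i' < i then (-1 : K) else 1)) •
        Finsupp.single (fac (J.erase i) σ) (1 : K) := by
  rw [bdry_single, bdryFace_eq, Finset.smul_sum]
  have hinj : Set.InjOn (fun i => enc (Fl σ i)) (J : Set ℕ) := fun a ha b hb h =>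
    encFl_inj σ (hJ a ha) (hJ b hb) h
  conv_lhs => rw [show (∑ v ∈ fac J σ, eps K (fac J σ) • sg K v (fac J σ) •
    Finsupp.single ((fac J σ).erase v) (1 : K)) = ∑ i ∈ J, eps K (fac J σ) •
      sg K (enc (Fl σ i)) (fac J σ) • Finsupp.single ((fac J σ).erase (enc (Fl σ i))) (1 : K) from
      Finset.sum_image hinj]
  refine Finset.sum_congr rfl fun i hi => ?_
  have hn := notMem_fac hJ σ hi
  have hinj' : Set.InjOn (fun i => enc (Fl σ i)) ((J.erase i : Finset ℕ) : Set ℕ) := fun a ha b hb h =>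
    hinj (Finset.mem_of_mem_erase ha) (Finset.mem_of_mem_erase hb) h
  rw [smul_smul, fac_eq_insert σ hi, Finset.erase_insert hn, eps_insert K hn]
  · congr 2
    rw [fac, Finset.prod_image hinj']
    refine Finset.prod_congr rfl fun i' hi' => ?_
    rw [rk_Fl σ (hJ _ (Finset.mem_of_mem_erase hi')), rk_Fl σ (hJ _ hi)]
  · intro w hw
    obtain ⟨i', h1, rfl⟩ := Finset.mem_image.1 hw
    have h2 := Finset.mem_erase.1 h1
    rw [rk_Fl σ (hJ _ h2.2), rk_Fl σ (hJ _ hi)]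
    exact h2.1

def GG (d : ℕ) (Gl : Finset ℕ) : Finset (Equiv.Perm (Fin d)) :=
  Finset.univ.filter (fun σ => ∀ g ∈ Gl, Fl σ g = Finset.range g)

def zz (d : ℕ) (Gl J : Finset ℕ) : Finset ℕ →₀ K :=
  ∑ σ ∈ GG d Gl, (((Equiv.Perm.sign σ : ℤ) : K)) •
    (eps K (fac J σ) • Finsupp.single (fac J σ) (1 : K))

theorem bdry_zz {d : ℕ} {Gl J : Finset ℕ} (hJ : ∀ i ∈ J, 1 ≤ i ∧ i < d ∧ i ∉ Gl)
    (hG : ∀ g ∈ Gl, g ≤ d) : bdry K (zz K d Gl J) = 0 := by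
  unfold zz
  rw [map_sum]
  simp only [map_smul, bdry_fac K (fun i hi => (hJ i hi).2.1.le), Finset.smul_sum]
  rw [Finset.sum_comm]
  refine Finset.sum_eq_zero fun i hi => ?_
  obtain ⟨h1, h2, h3⟩ := hJ i hi
  have hfac : ∀ σ : Equiv.Perm (Fin d), fac (J.erase i)
      (σ * Equiv.swap ⟨i - 1, by omega⟩ ⟨i, h2⟩) = fac (J.erase i) σ := by
    intro σ
    unfold fac
    refine Finset.image_congr fun i' hi' => ?_
    have := Finset.mem_erase.1 (Finset.mem_coe.1 hi')
    rw [Fl_swap σ h1 h2 (hJ _ this.2).2.1.le this.1]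
  have hne : (⟨i - 1, by omega⟩ : Fin d) ≠ ⟨i, h2⟩ := by
    intro h
    have := congrArg Fin.val h
    simp at this
    omega
  refine Finset.sum_involution (fun σ _ => σ * Equiv.swap ⟨i - 1, by omega⟩ ⟨i, h2⟩) ?_ ?_ ?_ ?_
  · intro σ _
    rw [hfac, Equiv.Perm.sign_mul, Equiv.Perm.sign_swap hne, ← add_smul]
    simp
  · intro σ _ _ h
    have h4 : Equiv.swap (⟨i - 1, by omega⟩ : Fin d) ⟨i, h2⟩ = 1 := mul_eq_left.1 h
    exact hne (Equiv.swap_eq_one_iff.1 h4)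
  · intro σ hσ
    have hσ' := (Finset.mem_filter.1 hσ).2
    refine Finset.mem_filter.2 ⟨Finset.mem_univ _, fun g hg => ?_⟩
    rw [Fl_swap σ h1 h2 (hG g hg) (fun e => h3 (e ▸ hg)), hσ' g hg]
  · intro σ _
    simp [mul_assoc]

theorem perm_eq_one {d : ℕ} {σ : Equiv.Perm (Fin d)} (h : ∀ i, i < d → Fl σ i = Finset.range i) :
    σ = 1 := by
  have h' : ∀ i, i ≤ d → Fl σ i = Finset.range i := by
    intro i hi
    rcases hi.lt_or_eq with h1 | h1
    · exact h i h1
    · subst h1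
      exact Finset.eq_of_subset_of_card_le (Fl_range σ _) (by rw [card_Fl σ le_rfl]; simp)
  ext x
  have h1 : ((σ x : Fin d) : ℕ) ∈ Fl σ (x + 1) := mem_Fl.2 ⟨x, by omega, rfl⟩
  have h2 : ((σ x : Fin d) : ℕ) ∉ Fl σ x := by
    intro hm
    obtain ⟨y, hy, e⟩ := mem_Fl.1 hm
    have : y = x := σ.injective (Fin.ext e)
    subst this
    omega
  rw [h' _ (by omega), Finset.mem_range] at h1
  rw [h' _ (by omega), Finset.mem_range] at h2
  simp
  omega

theorem zz_apply {d : ℕ} {Gl J : Finset ℕ} (hJ : J = Finset.Ico 1 d \ Gl) (hG : ∀ g ∈ Gl, g ≤ d) :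
    zz K d Gl J (fac J (1 : Equiv.Perm (Fin d))) ≠ 0 := by
  have hJd : ∀ i ∈ J, i ≤ d := fun i hi => by
    rw [hJ, Finset.mem_sdiff, Finset.mem_Ico] at hi; omega
  have key : ∀ σ ∈ GG d Gl, fac J σ = fac J (1 : Equiv.Perm (Fin d)) → σ = 1 := by
    intro σ hσ hf
    have hσ' := (Finset.mem_filter.1 hσ).2
    refine perm_eq_one fun i hi => ?_
    rcases Nat.eq_zero_or_pos i with h0 | h0
    · subst h0
      have := card_Fl σ (Nat.zero_le d)
      rw [Finset.card_eq_zero] at this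
      rw [this]; rfl
    by_cases hg : i ∈ Gl
    · exact hσ' i hg
    · have hiJ : i ∈ J := by
        rw [hJ, Finset.mem_sdiff, Finset.mem_Ico]; exact ⟨⟨h0, hi⟩, hg⟩
      have hm : enc (Fl σ i) ∈ fac J (1 : Equiv.Perm (Fin d)) := by
        rw [← hf]; exact Finset.mem_image.2 ⟨i, hiJ, rfl⟩
      obtain ⟨i', h1, h2⟩ := Finset.mem_image.1 hm
      have h3 : i' = i := by
        rw [← rk_Fl 1 (hJd i' h1), ← rk_Fl σ hi.le, h2]
      rw [← enc_inj h2, h3, Fl_one hi.le]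
  have hone : (1 : Equiv.Perm (Fin d)) ∈ GG d Gl :=
    Finset.mem_filter.2 ⟨Finset.mem_univ _, fun g hg => Fl_one (hG g hg)⟩
  unfold zz
  rw [Finsupp.finset_sum_apply, Finset.sum_eq_single (1 : Equiv.Perm (Fin d))]
  · simp [eps_ne_zero]
  · intro σ hσ hne
    have : fac J σ ≠ fac J (1 : Equiv.Perm (Fin d)) := fun h => hne (key σ hσ h)
    simp [Finsupp.single_apply, this]
  · intro h; exact absurd hone h

theorem between {d : ℕ} {Gl J : Finset ℕ} (hJ : J = Finset.Ico 1 d \ Gl)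
    (hG : ∀ g ∈ Gl, 1 ≤ g ∧ g + 1 ≤ d ∧ g + 1 ∉ Gl) {x : Finset ℕ} (hx : x ∈ PP d)
    (hc : ∀ i ∈ J, x ⊆ Finset.range i ∨ Finset.range i ⊆ x) (hn : ∀ i ∈ J, x ≠ Finset.range i) :
    ∃ g ∈ Gl, x = Finset.range g ∨ x = insert g (Finset.range (g - 1)) := by
  rw [mem_PP] at hx
  have hcard : x.card < d := by
    have := Finset.card_lt_card hx.1
    simpa using this
  have hpos : 0 < x.card := Finset.card_pos.2 (Finset.nonempty_iff_ne_empty.2 hx.2)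
  have memJ : ∀ i, i ∈ J ↔ (1 ≤ i ∧ i < d) ∧ i ∉ Gl := fun i => by
    rw [hJ, Finset.mem_sdiff, Finset.mem_Ico]
  have hg : x.card ∈ Gl := by
    by_contra h
    have hm := (memJ x.card).2 ⟨⟨hpos, hcard⟩, h⟩
    apply hn _ hm
    rcases hc _ hm with h1 | h1
    · exact Finset.eq_of_subset_of_card_le h1 (by simp)
    · exact (Finset.eq_of_subset_of_card_le h1 (by simp)).symm
  generalize hxg : x.card = g at *
  obtain ⟨g1, g2, g3⟩ := hG g hg
  have hlow : Finset.range (g - 1) ⊆ x := by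
    rcases Nat.eq_zero_or_pos (g - 1) with h0 | h0
    · rw [h0]; simp
    · have hm : g - 1 ∈ J := (memJ _).2 ⟨⟨h0, by omega⟩, fun h => by
        have := (hG _ h).2.2
        rw [Nat.sub_add_cancel g1] at this
        exact this hg⟩
      rcases hc _ hm with h1 | h1
      · have := Finset.card_le_card h1
        simp at this; omega
      · exact h1
  have hup : x ⊆ Finset.range (g + 1) := by
    rcases Nat.lt_or_ge (g + 1) d with h0 | h0
    · have hm : g + 1 ∈ J := (memJ _).2 ⟨⟨by omega, h0⟩, g3⟩
      rcases hc _ hm with h1 | h1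
      · exact h1
      · have := Finset.card_le_card h1
        simp at this; omega
    · have : g + 1 = d := by omega
      rw [this]; exact hx.1.1
  refine ⟨g, hg, ?_⟩
  by_cases hgx : g ∈ x
  · right
    refine (Finset.eq_of_subset_of_card_le (Finset.insert_subset hgx hlow) ?_).symm
    rw [Finset.card_insert_of_notMem (by simp), Finset.card_range]; omega
  · left
    refine Finset.eq_of_subset_of_card_le ?_ (by simp [hxg])
    intro a ha
    have h1 := Finset.mem_range.1 (hup ha)
    have h2 : a ≠ g := fun e => hgx (e ▸ ha)
    exact Finset.mem_range.2 (by omega)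

theorem sphere_class {d : ℕ} {Gl J : Finset ℕ} (hJ : J = Finset.Ico 1 d \ Gl)
    (hG : ∀ g ∈ Gl, 1 ≤ g ∧ g + 1 ≤ d ∧ g + 1 ∉ Gl) {X : Finset (Finset ℕ)}
    (h1 : ∀ x ∈ PP d, (∀ g ∈ Gl, x ⊂ Finset.range g ∨ Finset.range g ⊂ x) → x ∈ X)
    (h2 : ∀ x ∈ X, x ∈ PP d ∧ ∀ g ∈ Gl, x ≠ Finset.range g ∧ x ≠ insert g (Finset.range (g - 1))) :
    redHdim K (flagC (X.image enc)) J.card ≠ 0 := by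
  have hGd : ∀ g ∈ Gl, g ≤ d := fun g hg => by have := hG g hg; omega
  have memJ : ∀ i, i ∈ J ↔ (1 ≤ i ∧ i < d) ∧ i ∉ Gl := fun i => by
    rw [hJ, Finset.mem_sdiff, Finset.mem_Ico]
  refine redHdim_ne_zero K (z := zz K d Gl J) ?_ (bdry_zz K (fun i hi => ?_) hGd) ?_
  · unfold zz
    refine Submodule.sum_mem _ fun σ hσ => Submodule.smul_mem _ _ (Submodule.smul_mem _ _
      (single_mem_facesSpan K ?_ ?_))
    · have hσ' := (Finset.mem_filter.1 hσ).2
      rw [mem_flagC]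
      refine ⟨fun a ha => ?_, fun a ha b hb => ?_⟩
      · obtain ⟨i, hi, rfl⟩ := Finset.mem_image.1 ha
        have hi' := (memJ i).1 hi
        refine Finset.mem_image_of_mem _ (h1 _ (mem_PP.2 ⟨?_, ?_⟩) fun g hg => ?_)
        · refine Finset.ssubset_iff_subset_ne.2 ⟨Fl_range σ i, fun e => ?_⟩
          have := congrArg Finset.card e
          rw [card_Fl σ (by omega), Finset.card_range] at this
          omega
        · intro e
          have := congrArg Finset.card e
          rw [card_Fl σ (by omega), Finset.card_empty] at this
          omega
        · have hgd := hG g hg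
          rw [← hσ' g hg]
          have hne : i ≠ g := fun e => hi'.2 (e ▸ hg)
          rcases lt_or_gt_of_ne hne with h | h
          · left; exact Fl_ssub σ h (by omega)
          · right; exact Fl_ssub σ h (by omega)
      · obtain ⟨i, hi, rfl⟩ := Finset.mem_image.1 ha
        obtain ⟨i', hi', rfl⟩ := Finset.mem_image.1 hb
        rw [RR_enc]
        rcases le_total i i' with h | h
        · left; exact Fl_mono σ h
        · right; exact Fl_mono σ h
    · unfold fac
      rw [Finset.card_image_of_injOn]
      intro a ha b hb h
      exact encFl_inj σ ((memJ a).1 ha).1.2.le ((memJ b).1 hb).1.2.le h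
  · have := (memJ i).1 hi
    exact ⟨this.1.1, this.1.2, this.2⟩
  · intro y hy hyz
    apply zz_apply K hJ hGd
    rw [← hyz]
    clear hyz
    unfold CC facesSpan at hy
    induction hy using Submodule.span_induction with
    | mem x h =>
      obtain ⟨t, ⟨ht, hc⟩, rfl⟩ := h
      simp only [bdry_single, bdryFace_eq]
      rw [Finsupp.finset_sum_apply]
      refine Finset.sum_eq_zero fun v hv => ?_
      rw [Finsupp.smul_apply, Finsupp.single_apply, if_neg, smul_zero]
      intro e
      rw [mem_flagC] at ht
      obtain ⟨x, hx, rfl⟩ := Finset.mem_image.1 (ht.1 hv)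
      have hin : ∀ i ∈ J, enc (Finset.range i) ∈ t.erase (enc x) := by
        intro i hi
        rw [e, ← Fl_one ((memJ i).1 hi).1.2.le]
        exact Finset.mem_image.2 ⟨i, hi, rfl⟩
      obtain ⟨g, hg, h⟩ := between hJ hG (h2 x hx).1
        (fun i hi => (RR_enc _ _).1 (ht.2 _ hv _ (Finset.mem_of_mem_erase (hin i hi))))
        (fun i hi e2 => by
          have := Finset.mem_erase.1 (hin i hi)
          exact this.1 (by rw [e2]))
      have h3 := (h2 x hx).2 g hg
      rcases h with h | h
      · exact h3.1 h
      · exact h3.2 h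
    | zero => simp
    | add x y _ _ hx hy => rw [map_add, Finsupp.add_apply, hx, hy, add_zero]
    | smul a x _ hx => rw [map_smul, Finsupp.smul_apply, hx, smul_zero]

variable {K}

theorem part2 {d j a c k i : ℕ} (hk : 2 ≤ k) (hd : d = (a + 2) * k + c) (hj : j + k = d) (hc : c < k)
    (hlo : 2 ^ (a + 2) * (c + k) ≤ i + j + 2 * k) (hhi : i + j + 2 * k ≤ 2 ^ d) :
    bettiSR K (sd (simplexC d)) i (i + j) ≠ 0 := by
  set g : ℕ → ℕ := fun r => r * (a + 2) + min r c with hg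
  have g0 : g 0 = 0 := by simp [hg]
  have gk : g k = d := by simp [hg]; rw [hd, min_eq_right hc.le]; ring
  have gs : ∀ r, g (r + 1) = g r + (a + 2) + (if r < c then 1 else 0) := by
    intro r
    simp only [hg]
    split_ifs with h
    · rw [min_eq_left (by omega), min_eq_left (by omega)]; ring
    · rw [min_eq_right (by omega), min_eq_right (by omega)]; ring
  have gmono : StrictMono g := strictMono_nat_of_lt_succ fun r => by rw [gs]; omega
  set Gl := (Finset.Ico 1 k).image g with hGl
  have hG : ∀ x ∈ Gl, 1 ≤ x ∧ x + 1 ≤ d ∧ x + 1 ∉ Gl := by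
    intro x hx
    obtain ⟨r, hr, rfl⟩ := Finset.mem_image.1 hx
    rw [Finset.mem_Ico] at hr
    have h1 := gmono (show 0 < r by omega)
    have h2 := gmono hr.2
    refine ⟨by omega, by omega, fun h => ?_⟩
    obtain ⟨r', _, he⟩ := Finset.mem_image.1 h
    have h3 : r < r' := gmono.lt_iff_lt.1 (by omega)
    have h4 := gmono.monotone (show r + 1 ≤ r' by omega)
    have := gs r
    omega
  have hGcard : Gl.card = k - 1 := by
    rw [hGl, Finset.card_image_of_injective _ gmono.injective]; simp
  have hGsub : Gl ⊆ Finset.Ico 1 d := fun x hx => by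
    have := hG x hx
    rw [Finset.mem_Ico]; omega
  set J := Finset.Ico 1 d \ Gl with hJ
  have hJcard : J.card = j := by
    have := Finset.card_sdiff_add_card_eq_card hGsub
    rw [← hJ, hGcard, Nat.card_Ico] at this
    omega
  set Wm := (PP d).filter (fun x => ∀ y ∈ Gl, x ⊂ Finset.range y ∨ Finset.range y ⊂ x) with hWm
  set O := Gl.image (fun y => Finset.range y) ∪ Gl.image (fun y => insert y (Finset.range (y - 1)))
    with hO
  have hOcard : O.card ≤ 2 * (k - 1) := by
    refine (Finset.card_union_le _ _).trans ?_
    have h1 := Finset.card_image_le (s := Gl) (f := fun y => Finset.range y)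
    have h2 := Finset.card_image_le (s := Gl) (f := fun y => insert y (Finset.range (y - 1)))
    omega
  have hWO : Wm ⊆ PP d \ O := by
    intro x hx
    rw [hWm, Finset.mem_filter] at hx
    refine Finset.mem_sdiff.2 ⟨hx.1, fun h => ?_⟩
    rcases Finset.mem_union.1 h with h | h
    · obtain ⟨y, hy, rfl⟩ := Finset.mem_image.1 h
      rcases hx.2 y hy with h | h <;> exact lt_irrefl _ h
    · obtain ⟨y, hy, rfl⟩ := Finset.mem_image.1 h
      have hcd : (insert y (Finset.range (y - 1))).card = y := by
        rw [Finset.card_insert_of_notMem (by simp), Finset.card_range]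
        have := hG y hy; omega
      rcases hx.2 y hy with h | h <;> have := Finset.card_lt_card h <;>
        rw [hcd, Finset.card_range] at this <;> omega
  have hWcard : Wm.card + 2 * k ≤ 2 ^ (a + 2) * (c + k) := by
    have hsub : Wm ⊆ (Finset.range k).biUnion
        (fun r => Finset.Ioo (Finset.range (g r)) (Finset.range (g (r + 1)))) := by
      intro x hx
      rw [hWm, Finset.mem_filter, mem_PP] at hx
      obtain ⟨⟨hx1, hx2⟩, hx3⟩ := hx
      obtain ⟨r, hr, hmax⟩ := Finset.exists_max_image
        ((Finset.range k).filter (fun r => Finset.range (g r) ⊂ x)) id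
        ⟨0, by simp [g0, Finset.empty_ssubset, Finset.nonempty_iff_ne_empty, hx2]; omega⟩
      rw [Finset.mem_filter, Finset.mem_range] at hr
      refine Finset.mem_biUnion.2 ⟨r, Finset.mem_range.2 hr.1, Finset.mem_Ioo.2 ⟨hr.2, ?_⟩⟩
      rcases Nat.lt_or_ge (r + 1) k with h | h
      · rcases hx3 (g (r + 1)) (Finset.mem_image.2 ⟨r + 1, Finset.mem_Ico.2 ⟨by omega, h⟩, rfl⟩)
          with h1 | h1
        · exact h1
        · have := hmax (r + 1) (Finset.mem_filter.2 ⟨Finset.mem_range.2 h, h1⟩)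
          simp at this
      · have : r + 1 = k := by omega
        rw [this, gk]; exact hx1
    have h1 : Wm.card ≤ ∑ r ∈ Finset.range k, (2 ^ (g (r + 1) - g r) - 2) := by
      refine (Finset.card_le_card hsub).trans (Finset.card_biUnion_le.trans ?_)
      refine Finset.sum_le_sum fun r _ => ?_
      rw [Finset.card_Ioo_finset (by
        rw [Finset.range_subset_range]; exact gmono.monotone (by omega))]
      simp
    have h2 : (∑ r ∈ Finset.range k, (2 ^ (g (r + 1) - g r) - 2)) + 2 * k
        = ∑ r ∈ Finset.range k, (2 ^ (a + 2) + if r < c then 2 ^ (a + 2) else 0) := by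
      have : 2 * k = ∑ r ∈ Finset.range k, 2 := by simp; ring
      rw [this, ← Finset.sum_add_distrib]
      refine Finset.sum_congr rfl fun r _ => ?_
      have h4 : 2 ≤ 2 ^ (a + 2) := by
        calc 2 = 2 ^ 1 := rfl
          _ ≤ 2 ^ (a + 2) := Nat.pow_le_pow_right (by norm_num) (by omega)
      rw [gs r]
      split_ifs with h
      · rw [show g r + (a + 2) + 1 - g r = (a + 2) + 1 by omega, pow_succ]; omega
      · rw [show g r + (a + 2) + 0 - g r = a + 2 by omega]; omega
    have h3 : ∑ r ∈ Finset.range k, (2 ^ (a + 2) + if r < c then 2 ^ (a + 2) else 0)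
        = 2 ^ (a + 2) * (c + k) := by
      rw [Finset.sum_add_distrib, ← Finset.sum_filter]
      have : (Finset.range k).filter (fun r => r < c) = Finset.range c := by
        ext r; simp; omega
      rw [this]; simp; ring
    omega
  have hPO : 2 ^ d ≤ (PP d \ O).card + 2 * k := by
    have h1 := card_PP (d := d) (by omega)
    have h2 := Finset.le_card_sdiff O (PP d)
    omega
  obtain ⟨X, hX1, hX2, hX3⟩ := Finset.exists_subsuperset_card_eq hWO
    (show Wm.card ≤ i + j by omega) (show i + j ≤ (PP d \ O).card by omega)
  refine betti_ne_zero (X := X) ?_ hX3 ?_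
  · exact hX2.trans (Finset.sdiff_subset.trans (Finset.erase_subset _ _))
  · rw [← hJcard]
    refine sphere_class K hJ hG (fun x hx h => hX1 (Finset.mem_filter.2 ⟨hx, h⟩)) fun x hx => ?_
    have hx' := Finset.mem_sdiff.1 (hX2 hx)
    refine ⟨hx'.1, fun y hy => ⟨fun e => hx'.2 ?_, fun e => hx'.2 ?_⟩⟩
    · exact Finset.mem_union_left _ (Finset.mem_image.2 ⟨y, hy, e.symm⟩)
    · exact Finset.mem_union_right _ (Finset.mem_image.2 ⟨y, hy, e.symm⟩)

end

/-- For `d/2 < j ≤ d-2` the `j`-th linear strand of the minimal free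
resolution of `K[sd(Δ_{d-1})]`: `β_{i,i+j} = 0` for `0 ≤ i ≤ j-1`, `β_{i,i+j} ≠ 0` for
`m_j(d) ≤ i ≤ 2^d - 2d + j`, and `β_{i,i+j} = 0` for `2^d - 2d + j < i ≤ 2^d - d - 1`. -/
theorem statement_1 (K : Type*) [Field K] (d j : ℕ) (hd : 1 ≤ d) (hj1 : d < 2 * j)
    (hj2 : j ≤ d - 2) :
    (∀ i : ℕ, i ≤ j - 1 → bettiSR K (sd (simplexC d)) i (i + j) = 0) ∧
    (∀ i : ℕ, mj d j ≤ i → i ≤ 2 ^ d - 2 * d + j →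
      bettiSR K (sd (simplexC d)) i (i + j) ≠ 0) ∧
    (∀ i : ℕ, 2 ^ d - 2 * d + j < i → i ≤ 2 ^ d - d - 1 →
      bettiSR K (sd (simplexC d)) i (i + j) = 0) := by
  have h2d : 2 * d ≤ 2 ^ d := by
    have h := Nat.lt_two_pow_self (n := d - 1)
    have e : 2 ^ d = 2 ^ (d - 1) * 2 := by rw [← pow_succ]; congr 1; omega
    omega
  refine ⟨fun i hi => part1 (by omega) hi, fun i h1 h2 => ?_, fun i h1 _ =>
    part3 h2d (by omega) h1⟩
  have hdm := Nat.div_add_mod (2 * j - d) (d - j)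
  have hlt := Nat.mod_lt (2 * j - d) (show d - j > 0 by omega)
  unfold mj at h1
  rw [if_neg (by omega)] at h1
  generalize (2 * j - d) / (d - j) = a at *
  generalize (2 * j - d) % (d - j) = c at *
  obtain ⟨k, hk⟩ : ∃ k, j + k = d := ⟨d - j, by omega⟩
  have hk' : d - j = k := by omega
  rw [hk'] at hdm hlt h1
  refine part2 (a := a) (c := c) (k := k) (by omega) ?_ hk hlt (by omega) (by omega)
  have e1 : (a + 2) * k = k * a + 2 * k := by ring
  rw [e1]
  omega
end
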